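/- For every odd p ≥ 3, the group QS(S_p) of all quasisymmetric self-homeomorphisms of S_p is finite. -/

import Mathlib

open Set Metric

noncomputable section

/-- Level-`n` approximation `Q_n` of the standard `1/p`-Sierpiński carpet in `ℂ ≅ ℝ²`:
`Q_0` is the closed unit square, and `Q_{n+1}` is the union of the images of `Q_n` under
the `p² - 1` contractions `z ↦ (z + i + j·√-1)/p` with `(i,j)` ranging over all non-middle
positions; this is the usual subdivide-and-remove-middle-squares construction. -/
def carpetApprox (p : ℕ) : ℕ → Set ℂ
  | 0 => {z : ℂ | z.re ∈ Set.Icc (0:ℝ) 1 ∧ z.im ∈ Set.Icc (0:ℝ) 1}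
  | n + 1 =>
      ⋃ (i : ℕ) (j : ℕ) (_ : i < p) (_ : j < p)
        (_ : ¬(i = (p - 1) / 2 ∧ j = (p - 1) / 2)),
        (fun z : ℂ => (z + (i : ℂ) + (j : ℂ) * Complex.I) / (p : ℂ)) '' carpetApprox p n

/-- The standard `1/p`-Sierpiński carpet `S_p ⊆ ℝ² ≅ ℂ`. -/
def sierpinskiCarpet (p : ℕ) : Set ℂ := ⋂ n, carpetApprox p n

/-- `η : [0,∞) → [0,∞)` is a (self-)homeomorphism of `[0,∞)`: it is continuous, strictly
increasing on `[0,∞)`, fixes `0` and maps `[0,∞)` onto `[0,∞)`. -/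
def IsQSControl (η : ℝ → ℝ) : Prop :=
  ContinuousOn η (Set.Ici 0) ∧ StrictMonoOn η (Set.Ici 0) ∧ η 0 = 0 ∧
    Set.SurjOn η (Set.Ici 0) (Set.Ici 0)

/-- A map `f` between metric spaces is quasisymmetric: for some homeomorphism
`η : [0,∞) → [0,∞)` one has `d(f u, f v) ≤ η(d(u,v)/d(u,w)) · d(f u, f w)` for all `u,v,w`
with `u ≠ w`. -/
def IsQSMap {X Y : Type*} [MetricSpace X] [MetricSpace Y] (f : X → Y) : Prop :=
  ∃ η : ℝ → ℝ, IsQSControl η ∧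
    ∀ u v w : X, u ≠ w → dist (f u) (f v) ≤ η (dist u v / dist u w) * dist (f u) (f w)

/-- The boundary of the axis-parallel closed square with lower-left corner `c` and
side length `l`. -/
def squareBoundary (c : ℂ) (l : ℝ) : Set ℂ :=
  {z : ℂ | max |z.re - (c.re + l / 2)| |z.im - (c.im + l / 2)| = l / 2}

/-- The outer square `O = ∂([0,1]×[0,1])`. -/
def outerSquare : Set ℂ := squareBoundary 0 1

/-- The middle square `M = ∂([(p-1)/(2p),(p+1)/(2p)]²)`. -/
def middleSquare (p : ℕ) : Set ℂ :=
  squareBoundary ((((p : ℝ) - 1) / (2 * p) : ℝ) * (1 + Complex.I)) (1 / p)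

end

set_option linter.unusedSectionVars false

namespace Carpet

noncomputable section

/-- The standing assumption on the subdivision parameter. -/
class OddBase (p : ℕ) : Prop where
  three_le : 3 ≤ p
  odd : Odd p

/-- Closed axis-parallel square. -/
def csq (a b s : ℝ) : Set ℂ := {z | (a ≤ z.re ∧ z.re ≤ a + s) ∧ (b ≤ z.im ∧ z.im ≤ b + s)}

/-- Open axis-parallel square. -/
def osq (a b s : ℝ) : Set ℂ := {z | (a < z.re ∧ z.re < a + s) ∧ (b < z.im ∧ z.im < b + s)}

/-- Boundary of an axis-parallel square. -/
def sqb (a b s : ℝ) : Set ℂ := csq a b s \ osq a b s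

/-- Positions of the non-middle subsquares. -/
abbrev Dig (p : ℕ) :=
  {d : Fin p × Fin p // ¬((d.1 : ℕ) = (p - 1) / 2 ∧ (d.2 : ℕ) = (p - 1) / 2)}

/-- Addresses of cells. -/
abbrev Word (p : ℕ) := List (Dig p)

variable {p : ℕ}

/-- Left abscissa of a cell. -/
def cx : Word p → ℝ
  | [] => 0
  | d :: w => ((d.1.1 : ℕ) + cx w) / p

/-- Lower ordinate of a cell. -/
def cy : Word p → ℝ
  | [] => 0
  | d :: w => ((d.1.2 : ℕ) + cy w) / p

/-- Side length of a cell. -/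
def sc (w : Word p) : ℝ := ((p : ℝ) ^ w.length)⁻¹

/-- Left abscissa of the hole of a cell. -/
def hx (w : Word p) : ℝ := cx w + sc w * (((p : ℝ) - 1) / (2 * p))

/-- Lower ordinate of the hole of a cell. -/
def hy (w : Word p) : ℝ := cy w + sc w * (((p : ℝ) - 1) / (2 * p))

/-- Side length of the hole of a cell. -/
def hs (w : Word p) : ℝ := sc w / p

/-- The similarity mapping the unit square onto a cell. -/
def emb (w : Word p) (z : ℂ) : ℂ := ⟨cx w + sc w * z.re, cy w + sc w * z.im⟩

/-- The closed cell. -/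
def cell (w : Word p) : Set ℂ := csq (cx w) (cy w) (sc w)

/-- The open cell. -/
def ocell (w : Word p) : Set ℂ := osq (cx w) (cy w) (sc w)

/-- The open middle square of a cell. -/
def hole (w : Word p) : Set ℂ := osq (hx w) (hy w) (hs w)

/-- The closed middle square of a cell. -/
def chole (w : Word p) : Set ℂ := csq (hx w) (hy w) (hs w)

/-- The peripheral circles; `none` is the outer one. -/
def circ : Option (Word p) → Set ℂ
  | none => sqb 0 0 1
  | some w => sqb (hx w) (hy w) (hs w)

section
variable [OddBase p]

lemma three_le_real : (3 : ℝ) ≤ p := by exact_mod_cast (OddBase.three_le : 3 ≤ p)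

lemma p_pos : (0 : ℝ) < p := by linarith [three_le_real (p := p)]

lemma mid_cast : (((p - 1) / 2 : ℕ) : ℝ) = ((p : ℝ) - 1) / 2 := by
  obtain ⟨m, hm⟩ := (OddBase.odd : Odd p)
  have : (p - 1) / 2 = m := by omega
  rw [this, hm]; push_cast; ring

@[simp] lemma sc_nil : sc ([] : Word p) = 1 := by simp [sc]
@[simp] lemma cx_nil : cx ([] : Word p) = 0 := rfl
@[simp] lemma cy_nil : cy ([] : Word p) = 0 := rfl
lemma sc_cons (d : Dig p) (w : Word p) : sc (d :: w) = sc w / p := by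
  simp [sc, pow_succ, div_eq_mul_inv, mul_comm]
lemma cx_cons (d : Dig p) (w : Word p) : cx (d :: w) = ((d.1.1 : ℕ) + cx w) / p := rfl
lemma cy_cons (d : Dig p) (w : Word p) : cy (d :: w) = ((d.1.2 : ℕ) + cy w) / p := rfl
lemma hx_cons (d : Dig p) (w : Word p) : hx (d :: w) = ((d.1.1 : ℕ) + hx w) / p := by
  simp only [hx, cx_cons, sc_cons]; ring
lemma hy_cons (d : Dig p) (w : Word p) : hy (d :: w) = ((d.1.2 : ℕ) + hy w) / p := by
  simp only [hy, cy_cons, sc_cons]; ring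
lemma hs_cons (d : Dig p) (w : Word p) : hs (d :: w) = hs w / p := by
  simp only [hs, sc_cons]
lemma sc_pos (w : Word p) : 0 < sc w := by
  have := p_pos (p := p)
  unfold sc; positivity
lemma hs_pos (w : Word p) : 0 < hs w := div_pos (sc_pos w) p_pos

lemma sc_le_one (w : Word p) : sc w ≤ 1 := by
  unfold sc
  apply inv_le_one_of_one_le₀
  exact one_le_pow₀ (by linarith [three_le_real (p := p)])

lemma hs_le (w : Word p) : hs w ≤ sc w / 3 := by
  unfold hs
  exact div_le_div_of_nonneg_left (sc_pos w).le (by norm_num) three_le_real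

/-- The hole is centred in its cell. -/
lemma two_hx (w : Word p) : 2 * hx w + hs w = 2 * cx w + sc w := by
  have := p_pos (p := p)
  simp only [hx, hs]; field_simp; ring

lemma two_hy (w : Word p) : 2 * hy w + hs w = 2 * cy w + sc w := by
  have := p_pos (p := p)
  simp only [hy, hs]; field_simp; ring

lemma dig_le (d : Fin p) : ((d : ℕ) : ℝ) + 1 ≤ p := by
  exact_mod_cast d.2

lemma cx_nonneg (w : Word p) : 0 ≤ cx w := by
  induction w with
  | nil => simp
  | cons d w ih => rw [cx_cons]; positivity

lemma cy_nonneg (w : Word p) : 0 ≤ cy w := by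
  induction w with
  | nil => simp
  | cons d w ih => rw [cy_cons]; positivity

lemma cx_add_le (w : Word p) : cx w + sc w ≤ 1 := by
  induction w with
  | nil => simp
  | cons d w ih =>
    rw [cx_cons, sc_cons, ← add_div, div_le_one p_pos]
    linarith [dig_le d.1.1]

lemma cy_add_le (w : Word p) : cy w + sc w ≤ 1 := by
  induction w with
  | nil => simp
  | cons d w ih =>
    rw [cy_cons, sc_cons, ← add_div, div_le_one p_pos]
    linarith [dig_le d.1.2]

lemma mem_csq_div {a b s x y : ℝ} {z : ℂ} :
    z ∈ csq ((x + a) / p) ((y + b) / p) (s / p) ↔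
      (⟨p * z.re - x, p * z.im - y⟩ : ℂ) ∈ csq a b s := by
  have := p_pos (p := p)
  simp only [csq, Set.mem_ofPred_eq, ← add_div, div_le_iff₀ this, le_div_iff₀ this]
  constructor <;> rintro ⟨⟨h1, h2⟩, h3, h4⟩ <;> refine ⟨⟨?_, ?_⟩, ?_, ?_⟩ <;> linarith

lemma mem_osq_div {a b s x y : ℝ} {z : ℂ} :
    z ∈ osq ((x + a) / p) ((y + b) / p) (s / p) ↔
      (⟨p * z.re - x, p * z.im - y⟩ : ℂ) ∈ osq a b s := by
  have := p_pos (p := p)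
  simp only [osq, Set.mem_ofPred_eq, ← add_div, div_lt_iff₀ this, lt_div_iff₀ this]
  constructor <;> rintro ⟨⟨h1, h2⟩, h3, h4⟩ <;> refine ⟨⟨?_, ?_⟩, ?_, ?_⟩ <;> linarith

/-- The inverse of the similarity of a single digit. -/
def unshift (d : Dig p) (z : ℂ) : ℂ := ⟨p * z.re - (d.1.1 : ℕ), p * z.im - (d.1.2 : ℕ)⟩

lemma mem_cell_cons {d : Dig p} {w : Word p} {z : ℂ} :
    z ∈ cell (d :: w) ↔ unshift d z ∈ cell w := by
  simp only [cell, cx_cons, cy_cons, sc_cons, mem_csq_div, unshift]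

lemma mem_ocell_cons {d : Dig p} {w : Word p} {z : ℂ} :
    z ∈ ocell (d :: w) ↔ unshift d z ∈ ocell w := by
  simp only [ocell, cx_cons, cy_cons, sc_cons, mem_osq_div, unshift]

lemma mem_hole_cons {d : Dig p} {w : Word p} {z : ℂ} :
    z ∈ hole (d :: w) ↔ unshift d z ∈ hole w := by
  simp only [hole, hx_cons, hy_cons, hs_cons, mem_osq_div, unshift]

lemma mem_chole_cons {d : Dig p} {w : Word p} {z : ℂ} :
    z ∈ chole (d :: w) ↔ unshift d z ∈ chole w := by
  simp only [chole, hx_cons, hy_cons, hs_cons, mem_csq_div, unshift]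

lemma osq_subset_csq (a b s : ℝ) : osq a b s ⊆ csq a b s :=
  fun _ h => ⟨⟨h.1.1.le, h.1.2.le⟩, h.2.1.le, h.2.2.le⟩

lemma hole_subset_chole (w : Word p) : hole w ⊆ chole w := osq_subset_csq _ _ _

lemma ocell_subset_cell (w : Word p) : ocell w ⊆ cell w := osq_subset_csq _ _ _

lemma cx_lt_hx (w : Word p) : cx w + hs w ≤ hx w := by
  have := hs_le w; have := two_hx w; linarith
lemma cy_lt_hy (w : Word p) : cy w + hs w ≤ hy w := by
  have := hs_le w; have := two_hy w; linarith

lemma chole_subset_ocell (w : Word p) : chole w ⊆ ocell w := by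
  rintro z ⟨⟨h1, h2⟩, h3, h4⟩
  have := hs_pos w; have := cx_lt_hx w; have := cy_lt_hy w
  have := two_hx w; have := two_hy w
  exact ⟨⟨by linarith, by linarith⟩, by linarith, by linarith⟩

lemma cell_subset_unit (w : Word p) : cell w ⊆ csq 0 0 1 := by
  rintro z ⟨⟨h1, h2⟩, h3, h4⟩
  have := cx_nonneg w; have := cy_nonneg w; have := cx_add_le w; have := cy_add_le w
  exact ⟨⟨by linarith, by linarith⟩, by linarith, by linarith⟩

lemma unit_eq_cell_nil : csq 0 0 1 = cell ([] : Word p) := by simp [cell]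

lemma ocell_subset_ounit (w : Word p) : ocell w ⊆ osq 0 0 1 := by
  rintro z ⟨⟨h1, h2⟩, h3, h4⟩
  have := cx_nonneg w; have := cy_nonneg w; have := cx_add_le w; have := cy_add_le w
  exact ⟨⟨by linarith, by linarith⟩, by linarith, by linarith⟩

/-- A point whose rescaling lies in two digit cells, one of them open. -/
lemma dig_eq_of_mem {d d' : Dig p} {z : ℂ} (h : unshift d z ∈ osq 0 0 1)
    (h' : unshift d' z ∈ csq 0 0 1) : d = d' := by
  obtain ⟨⟨h1, h2⟩, h3, h4⟩ := h
  obtain ⟨⟨k1, k2⟩, k3, k4⟩ := h'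
  simp only [unshift] at *
  have e1 : ((d.1.1 : ℕ) : ℝ) < (d'.1.1 : ℕ) + 1 := by linarith
  have e2 : ((d'.1.1 : ℕ) : ℝ) < (d.1.1 : ℕ) + 1 := by linarith
  have e3 : ((d.1.2 : ℕ) : ℝ) < (d'.1.2 : ℕ) + 1 := by linarith
  have e4 : ((d'.1.2 : ℕ) : ℝ) < (d.1.2 : ℕ) + 1 := by linarith
  norm_cast at e1 e2 e3 e4
  apply Subtype.ext
  apply Prod.ext <;> apply Fin.ext <;> omega

lemma hx_nil_mul : (p : ℝ) * hx ([] : Word p) = ((p - 1) / 2 : ℕ) := by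
  have := p_pos (p := p)
  rw [mid_cast]; simp [hx]; field_simp
lemma hs_nil_mul : (p : ℝ) * hs ([] : Word p) = 1 := by
  have := p_pos (p := p)
  simp [hs]; field_simp

lemma mem_hole_nil {z : ℂ} : z ∈ hole ([] : Word p) ↔
    ((((p - 1) / 2 : ℕ) : ℝ) < p * z.re ∧ p * z.re < ((p - 1) / 2 : ℕ) + 1) ∧
    ((((p - 1) / 2 : ℕ) : ℝ) < p * z.im ∧ p * z.im < ((p - 1) / 2 : ℕ) + 1) := by
  have hp := p_pos (p := p)
  have h1 := hx_nil_mul (p := p); have h3 := hs_nil_mul (p := p)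
  simp only [hole, osq, Set.mem_ofPred_eq]
  have e : hy ([] : Word p) = hx ([] : Word p) := rfl
  simp only [e, ← h1, ← h3, ← mul_add, mul_lt_mul_iff_right₀ hp]

lemma mem_chole_nil {z : ℂ} : z ∈ chole ([] : Word p) ↔
    ((((p - 1) / 2 : ℕ) : ℝ) ≤ p * z.re ∧ p * z.re ≤ ((p - 1) / 2 : ℕ) + 1) ∧
    ((((p - 1) / 2 : ℕ) : ℝ) ≤ p * z.im ∧ p * z.im ≤ ((p - 1) / 2 : ℕ) + 1) := by
  have hp := p_pos (p := p)
  have h1 := hx_nil_mul (p := p); have h3 := hs_nil_mul (p := p)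
  simp only [chole, csq, Set.mem_ofPred_eq]
  have e : hy ([] : Word p) = hx ([] : Word p) := rfl
  simp only [e, ← h1, ← h3, ← mul_add, mul_le_mul_iff_right₀ hp]

lemma chole_nil_not_mem_osq {d : Dig p} {z : ℂ} (h : unshift d z ∈ osq 0 0 1) :
    z ∉ chole ([] : Word p) := by
  intro hz
  rw [mem_chole_nil] at hz
  obtain ⟨⟨h1, h2⟩, h3, h4⟩ := h
  obtain ⟨⟨k1, k2⟩, k3, k4⟩ := hz
  simp only [unshift] at *
  have e1 : ((d.1.1 : ℕ) : ℝ) < ((p - 1) / 2 : ℕ) + 1 := by linarith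
  have e2 : (((p - 1) / 2 : ℕ) : ℝ) < (d.1.1 : ℕ) + 1 := by linarith
  have e3 : ((d.1.2 : ℕ) : ℝ) < ((p - 1) / 2 : ℕ) + 1 := by linarith
  have e4 : (((p - 1) / 2 : ℕ) : ℝ) < (d.1.2 : ℕ) + 1 := by linarith
  norm_cast at e1 e2 e3 e4
  exact d.2 ⟨by omega, by omega⟩

lemma hole_nil_not_mem_csq {d : Dig p} {z : ℂ} (h : unshift d z ∈ csq 0 0 1) :
    z ∉ hole ([] : Word p) := by
  intro hz
  rw [mem_hole_nil] at hz
  obtain ⟨⟨h1, h2⟩, h3, h4⟩ := h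
  obtain ⟨⟨k1, k2⟩, k3, k4⟩ := hz
  simp only [unshift] at *
  have e1 : ((d.1.1 : ℕ) : ℝ) < ((p - 1) / 2 : ℕ) + 1 := by linarith
  have e2 : (((p - 1) / 2 : ℕ) : ℝ) < (d.1.1 : ℕ) + 1 := by linarith
  have e3 : ((d.1.2 : ℕ) : ℝ) < ((p - 1) / 2 : ℕ) + 1 := by linarith
  have e4 : (((p - 1) / 2 : ℕ) : ℝ) < (d.1.2 : ℕ) + 1 := by linarith
  norm_cast at e1 e2 e3 e4
  exact d.2 ⟨by omega, by omega⟩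

/-- Closed holes avoid the open cells that are not their ancestors. -/
lemma chole_disjoint_ocell {w v : Word p} (h : ¬ w <+: v) {z : ℂ} (hz : z ∈ chole v) :
    z ∉ ocell w := by
  induction w generalizing v z with
  | nil => exact absurd List.nil_prefix h
  | cons d w ih =>
    intro hw
    rw [mem_ocell_cons] at hw
    cases v with
    | nil => exact chole_nil_not_mem_osq (ocell_subset_ounit w hw) hz
    | cons d' v =>
      rw [mem_chole_cons] at hz
      have := dig_eq_of_mem (ocell_subset_ounit w hw)
        (cell_subset_unit v (ocell_subset_cell v (chole_subset_ocell v hz)))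
      subst this
      refine ih (fun hp => h ?_) hz hw
      exact (List.prefix_cons_inj d).2 hp

lemma chole_disjoint {v w : Word p} (h : v ≠ w) : Disjoint (chole v) (chole w) := by
  rw [Set.disjoint_left]
  intro z hv hw
  by_cases h1 : w <+: v
  · have h2 : ¬ v <+: w := fun h2 => h (h2.eq_of_length_le h1.length_le)
    exact chole_disjoint_ocell h2 hw (chole_subset_ocell v hv)
  · exact chole_disjoint_ocell h1 hv (chole_subset_ocell w hw)

lemma exists_dig_coord {x : ℝ} (h0 : 0 ≤ x) (h1 : x ≤ 1) :
    ∃ i : ℕ, i < p ∧ (i : ℝ) ≤ p * x ∧ p * x ≤ i + 1 ∧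
      (i = (p - 1) / 2 → p * x < i + 1) := by
  have hp := p_pos (p := p)
  have h3 := (OddBase.three_le : 3 ≤ p)
  rcases eq_or_lt_of_le h1 with rfl | h1
  · refine ⟨p - 1, by omega, ?_, ?_, ?_⟩
    · rw [Nat.cast_sub (by omega)]; push_cast; linarith
    · rw [Nat.cast_sub (by omega)]; push_cast; linarith
    · intro h; omega
  · have hx : 0 ≤ p * x := by positivity
    refine ⟨⌊p * x⌋₊, ?_, Nat.floor_le hx, (Nat.lt_floor_add_one _).le,
      fun _ => Nat.lt_floor_add_one _⟩
    rw [Nat.floor_lt hx]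
    nlinarith

lemma exists_dig {z : ℂ} (hz : z ∈ csq 0 0 1) (h : z ∉ hole ([] : Word p)) :
    ∃ d : Dig p, unshift d z ∈ csq 0 0 1 := by
  obtain ⟨⟨h1, h2⟩, h3, h4⟩ := hz
  have h3p := (OddBase.three_le : 3 ≤ p)
  obtain ⟨i, hi, hi1, hi2, hi3⟩ := exists_dig_coord (p := p) h1 (by linarith)
  obtain ⟨j, hj, hj1, hj2, hj3⟩ := exists_dig_coord (p := p) h3 (by linarith)
  by_cases hm : i = (p - 1) / 2 ∧ j = (p - 1) / 2
  · have hi3 := hi3 hm.1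
    have hj3 := hj3 hm.2
    rw [mem_hole_nil, ← hm.1] at h
    by_cases hlt : (i : ℝ) < p * z.re
    · have hjlt : ¬ (j : ℝ) < p * z.im := by
        intro hjlt
        exact h ⟨⟨hlt, hi3⟩, by rw [hm.1, ← hm.2]; exact ⟨hjlt, hj3⟩⟩
      have hje : (j : ℝ) = p * z.im := by linarith
      refine ⟨⟨(⟨i, hi⟩, ⟨j - 1, by omega⟩), ?_⟩, ?_⟩
      · simp only; omega
      · have : ((j - 1 : ℕ) : ℝ) = j - 1 := by rw [Nat.cast_sub (by omega)]; simp
        refine ⟨⟨?_, ?_⟩, ?_, ?_⟩ <;> simp only [unshift, this] <;> linarith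
    · have hie : (i : ℝ) = p * z.re := by linarith
      refine ⟨⟨(⟨i - 1, by omega⟩, ⟨j, hj⟩), ?_⟩, ?_⟩
      · simp only; omega
      · have : ((i - 1 : ℕ) : ℝ) = i - 1 := by rw [Nat.cast_sub (by omega)]; simp
        refine ⟨⟨?_, ?_⟩, ?_, ?_⟩ <;> simp only [unshift, this] <;> linarith
  · refine ⟨⟨(⟨i, hi⟩, ⟨j, hj⟩), hm⟩, ?_⟩
    refine ⟨⟨?_, ?_⟩, ?_, ?_⟩ <;> simp only [unshift] <;> linarith

lemma mem_carpetApprox_succ {n : ℕ} {z : ℂ} :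
    z ∈ carpetApprox p (n + 1) ↔ ∃ d : Dig p, unshift d z ∈ carpetApprox p n := by
  have hp := p_pos (p := p)
  have key : ∀ (i j : ℕ) (y : ℂ), (y + (i : ℂ) + (j : ℂ) * Complex.I) / (p : ℂ) =
      (⟨(y.re + i) / p, (y.im + j) / p⟩ : ℂ) := by
    intro i j y
    apply Complex.ext <;> simp [Complex.div_natCast_re, Complex.div_natCast_im]
  constructor
  · intro h
    simp only [carpetApprox, mem_iUnion, mem_image] at h
    obtain ⟨i, j, hi, hj, hm, y, hy, rfl⟩ := h
    refine ⟨⟨(⟨i, hi⟩, ⟨j, hj⟩), hm⟩, ?_⟩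
    convert hy
    rw [key]
    apply Complex.ext <;> simp only [unshift] <;> field_simp <;> ring
  · rintro ⟨d, hd⟩
    simp only [carpetApprox, mem_iUnion, mem_image]
    refine ⟨d.1.1, d.1.2, d.1.1.2, d.1.2.2, d.2, _, hd, ?_⟩
    rw [key]
    apply Complex.ext <;> simp only [unshift] <;> field_simp <;> ring

lemma mem_carpetApprox {n : ℕ} {z : ℂ} :
    z ∈ carpetApprox p n ↔ z ∈ csq 0 0 1 ∧ ∀ w : Word p, w.length < n → z ∉ hole w := by
  induction n generalizing z with
  | zero => simp [carpetApprox, csq]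
  | succ n ih =>
    rw [mem_carpetApprox_succ]
    constructor
    · rintro ⟨d, hd⟩
      obtain ⟨h1, h2⟩ := ih.1 hd
      refine ⟨?_, ?_⟩
      · have : z ∈ cell [d] := by
          rw [mem_cell_cons, ← unit_eq_cell_nil]; exact h1
        exact cell_subset_unit _ this
      · intro w hw hz
        cases w with
        | nil => exact hole_nil_not_mem_csq h1 hz
        | cons d' w =>
          rw [mem_hole_cons] at hz
          have := dig_eq_of_mem
            (ocell_subset_ounit w (chole_subset_ocell w (hole_subset_chole w hz))) h1
          subst this
          exact h2 w (by simpa using hw) hz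
    · rintro ⟨h1, h2⟩
      obtain ⟨d, hd⟩ := exists_dig h1 (h2 [] (by simp))
      refine ⟨d, ih.2 ⟨hd, fun w hw hz => h2 (d :: w) (by simpa using hw) ?_⟩⟩
      rwa [mem_hole_cons]

/-- The carpet is the unit square minus all the holes. -/
lemma mem_carpet {z : ℂ} :
    z ∈ sierpinskiCarpet p ↔ z ∈ csq 0 0 1 ∧ ∀ w : Word p, z ∉ hole w := by
  simp only [sierpinskiCarpet, mem_iInter, mem_carpetApprox]
  constructor
  · intro h
    exact ⟨(h 0).1, fun w => (h (w.length + 1)).2 w (by simp)⟩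
  · rintro ⟨h1, h2⟩ n
    exact ⟨h1, fun w _ => h2 w⟩

lemma mem_carpet_iff_unshift {d : Dig p} {z : ℂ} (h : unshift d z ∈ csq 0 0 1) :
    z ∈ sierpinskiCarpet p ↔ unshift d z ∈ sierpinskiCarpet p := by
  rw [mem_carpet, mem_carpet]
  constructor
  · rintro ⟨h1, h2⟩
    exact ⟨h, fun w hw => h2 (d :: w) (mem_hole_cons.2 hw)⟩
  · rintro ⟨h1, h2⟩
    refine ⟨?_, ?_⟩
    · have : z ∈ cell [d] := by
        rw [mem_cell_cons, ← unit_eq_cell_nil]; exact h1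
      exact cell_subset_unit _ this
    · intro w hz
      cases w with
      | nil => exact hole_nil_not_mem_csq h1 hz
      | cons d' w =>
        rw [mem_hole_cons] at hz
        have := dig_eq_of_mem
          (ocell_subset_ounit w (chole_subset_ocell w (hole_subset_chole w hz))) h1
        subst this
        exact h2 w hz

lemma unshift_emb_cons (d : Dig p) (w : Word p) (z : ℂ) :
    unshift d (emb (d :: w) z) = emb w z := by
  have hp := p_pos (p := p)
  apply Complex.ext <;> simp only [unshift, emb, cx_cons, cy_cons, sc_cons] <;> field_simp <;> ring

@[simp] lemma emb_nil (z : ℂ) : emb ([] : Word p) z = z := by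
  apply Complex.ext <;> simp [emb]

lemma emb_mem_csq {a b s : ℝ} {w : Word p} {z : ℂ} :
    emb w z ∈ csq (cx w + sc w * a) (cy w + sc w * b) (sc w * s) ↔ z ∈ csq a b s := by
  have h := sc_pos w
  simp only [csq, emb, Set.mem_ofPred_eq, add_assoc, ← mul_add, add_le_add_iff_left,
    mul_le_mul_iff_right₀ h]

lemma emb_mem_osq {a b s : ℝ} {w : Word p} {z : ℂ} :
    emb w z ∈ osq (cx w + sc w * a) (cy w + sc w * b) (sc w * s) ↔ z ∈ osq a b s := by
  have h := sc_pos w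
  simp only [osq, emb, Set.mem_ofPred_eq, add_assoc, ← mul_add, add_lt_add_iff_left,
    mul_lt_mul_iff_right₀ h]

lemma emb_mem_cell {w : Word p} {z : ℂ} : emb w z ∈ cell w ↔ z ∈ csq 0 0 1 := by
  have := emb_mem_csq (a := 0) (b := 0) (s := 1) (w := w) (z := z)
  simpa [cell] using this

lemma sc_append (w v : Word p) : sc (w ++ v) = sc w * sc v := by
  simp [sc, pow_add, mul_comm]

lemma cx_append (w v : Word p) : cx (w ++ v) = cx w + sc w * cx v := by
  induction w with
  | nil => simp
  | cons d w ih => simp only [List.cons_append, cx_cons, sc_cons, ih]; ring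

lemma cy_append (w v : Word p) : cy (w ++ v) = cy w + sc w * cy v := by
  induction w with
  | nil => simp
  | cons d w ih => simp only [List.cons_append, cy_cons, sc_cons, ih]; ring

lemma hx_append (w v : Word p) : hx (w ++ v) = cx w + sc w * hx v := by
  simp only [hx, cx_append, sc_append]; ring
lemma hy_append (w v : Word p) : hy (w ++ v) = cy w + sc w * hy v := by
  simp only [hy, cy_append, sc_append]; ring
lemma hs_append (w v : Word p) : hs (w ++ v) = sc w * hs v := by
  simp only [hs, sc_append]; ring

lemma emb_mem_circ {w v : Word p} {z : ℂ} :
    emb w z ∈ circ (some (w ++ v)) ↔ z ∈ circ (some v) := by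
  simp only [circ, sqb, mem_sdiff, hx_append, hy_append, hs_append, emb_mem_osq, emb_mem_csq]

lemma emb_mem_carpet {w : Word p} {z : ℂ} (hz : z ∈ csq 0 0 1) :
    emb w z ∈ sierpinskiCarpet p ↔ z ∈ sierpinskiCarpet p := by
  induction w with
  | nil => simp
  | cons d w ih =>
    rw [mem_carpet_iff_unshift (d := d), unshift_emb_cons, ih]
    rw [unshift_emb_cons]
    exact cell_subset_unit w (emb_mem_cell.2 hz)

/-- Inverse of `emb`. -/
def unemb (w : Word p) (z : ℂ) : ℂ := ⟨(z.re - cx w) / sc w, (z.im - cy w) / sc w⟩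

@[simp] lemma emb_unemb (w : Word p) (z : ℂ) : emb w (unemb w z) = z := by
  have := (sc_pos w).ne'
  apply Complex.ext <;> simp only [unemb, emb] <;> field_simp <;> ring

@[simp] lemma unemb_emb (w : Word p) (z : ℂ) : unemb w (emb w z) = z := by
  have := (sc_pos w).ne'
  apply Complex.ext <;> simp only [unemb, emb] <;> field_simp <;> ring

lemma unemb_mem_unit {w : Word p} {z : ℂ} : unemb w z ∈ csq 0 0 1 ↔ z ∈ cell w := by
  rw [← emb_mem_cell (w := w), emb_unemb]

lemma unemb_mem_carpet {w : Word p} {z : ℂ} (hz : z ∈ cell w) :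
    unemb w z ∈ sierpinskiCarpet p ↔ z ∈ sierpinskiCarpet p := by
  rw [← emb_mem_carpet (w := w) (unemb_mem_unit.2 hz), emb_unemb]

/-- Every point of the carpet lies in a cell of each level. -/
lemma exists_cell (n : ℕ) {z : ℂ} (hz : z ∈ sierpinskiCarpet p) :
    ∃ w : Word p, w.length = n ∧ z ∈ cell w := by
  induction n generalizing z with
  | zero => exact ⟨[], rfl, by rw [← unit_eq_cell_nil]; exact (mem_carpet.1 hz).1⟩
  | succ n ih =>
    obtain ⟨d, hd⟩ := exists_dig (mem_carpet.1 hz).1 ((mem_carpet.1 hz).2 [])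
    obtain ⟨w, hw, hzw⟩ := ih ((mem_carpet_iff_unshift hd).1 hz)
    exact ⟨d :: w, by simp [hw], mem_cell_cons.2 hzw⟩

lemma carpet_subset_unit : sierpinskiCarpet p ⊆ csq 0 0 1 := fun _ h => (mem_carpet.1 h).1

lemma circ_some (w : Word p) : circ (some w) = chole w \ hole w := rfl

lemma circ_none : circ (none : Option (Word p)) = csq 0 0 1 \ osq 0 0 1 := rfl

lemma circ_some_subset_chole (w : Word p) : circ (some w) ⊆ chole w := sdiff_subset

lemma circ_subset_carpet (i : Option (Word p)) : circ i ⊆ sierpinskiCarpet p := by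
  intro z hz
  rw [mem_carpet]
  cases i with
  | none =>
    refine ⟨hz.1, fun w hw => hz.2 ?_⟩
    exact ocell_subset_ounit w (chole_subset_ocell w (hole_subset_chole w hw))
  | some v =>
    refine ⟨cell_subset_unit v (ocell_subset_cell v (chole_subset_ocell v hz.1)), fun w hw => ?_⟩
    by_cases h : v = w
    · subst h; exact hz.2 hw
    · exact Set.disjoint_left.1 (chole_disjoint h) hz.1 (hole_subset_chole w hw)

lemma circ_disjoint {i j : Option (Word p)} (h : i ≠ j) : Disjoint (circ i) (circ j) := by
  have aux : ∀ w : Word p, Disjoint (circ (none : Option (Word p))) (circ (some w)) := by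
    intro w
    rw [Set.disjoint_left]
    intro z hz hw
    exact hz.2 (ocell_subset_ounit w (chole_subset_ocell w hw.1))
  cases i with
  | none =>
    cases j with
    | none => exact absurd rfl h
    | some w => exact aux w
  | some v =>
    cases j with
    | none => exact (aux v).symm
    | some w =>
      exact (chole_disjoint (fun e => h (by rw [e]))).mono sdiff_subset sdiff_subset

/-- Points of a closed hole are at horizontal and vertical distance at least `hs` from the
sides of the unit square. -/
lemma chole_dist_outer {w : Word p} {z : ℂ} (hz : z ∈ chole w) :
    hs w ≤ z.re ∧ z.re ≤ 1 - hs w ∧ hs w ≤ z.im ∧ z.im ≤ 1 - hs w := by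
  obtain ⟨⟨h1, h2⟩, h3, h4⟩ := hz
  have := cx_lt_hx w; have := cy_lt_hy w
  have := two_hx w; have := two_hy w
  have := cx_nonneg w; have := cy_nonneg w; have := cx_add_le w; have := cy_add_le w
  exact ⟨by linarith, by linarith, by linarith, by linarith⟩

lemma isClosed_csq (a b s : ℝ) : IsClosed (csq a b s) := by
  have e : csq a b s = Complex.re ⁻¹' Icc a (a + s) ∩ Complex.im ⁻¹' Icc b (b + s) := by
    ext z; simp [csq]
  rw [e]
  exact (isClosed_Icc.preimage Complex.continuous_re).inter
    (isClosed_Icc.preimage Complex.continuous_im)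

lemma isOpen_osq (a b s : ℝ) : IsOpen (osq a b s) := by
  have e : osq a b s = Complex.re ⁻¹' Ioo a (a + s) ∩ Complex.im ⁻¹' Ioo b (b + s) := by
    ext z; simp [osq]
  rw [e]
  exact (isOpen_Ioo.preimage Complex.continuous_re).inter
    (isOpen_Ioo.preimage Complex.continuous_im)

lemma csq_eq_reProdIm (a b s : ℝ) : csq a b s = Icc a (a + s) ×ℂ Icc b (b + s) := by
  ext z; simp [csq, Complex.mem_reProdIm]

lemma isCompact_csq (a b s : ℝ) : IsCompact (csq a b s) := by
  rw [csq_eq_reProdIm]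
  exact isCompact_Icc.reProdIm isCompact_Icc

lemma isCompact_sqb (a b s : ℝ) : IsCompact (sqb a b s) :=
  (isCompact_csq a b s).diff (isOpen_osq a b s)

lemma isCompact_circ (i : Option (Word p)) : IsCompact (circ i) := by
  cases i <;> exact isCompact_sqb _ _ _

lemma isCompact_carpet : IsCompact (sierpinskiCarpet p) := by
  have : sierpinskiCarpet p = csq 0 0 1 \ ⋃ w : Word p, hole w := by
    ext z; simp [mem_carpet]
  rw [this]
  exact (isCompact_csq 0 0 1).diff (isOpen_iUnion fun w => isOpen_osq _ _ _)

instance : CompactSpace (sierpinskiCarpet p) := isCompact_iff_compactSpace.1 isCompact_carpet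

end

end

end Carpet

namespace Carpet

noncomputable section

variable {p : ℕ}

/-- Reflection in the diagonal. -/
def sw (z : ℂ) : ℂ := ⟨z.im, z.re⟩

/-- Reflection in the vertical axis of the unit square. -/
def fl (z : ℂ) : ℂ := ⟨1 - z.re, z.im⟩

@[simp] lemma sw_re (z : ℂ) : (sw z).re = z.im := rfl
@[simp] lemma sw_im (z : ℂ) : (sw z).im = z.re := rfl
@[simp] lemma fl_re (z : ℂ) : (fl z).re = 1 - z.re := rfl
@[simp] lemma fl_im (z : ℂ) : (fl z).im = z.im := rfl
@[simp] lemma sw_sw (z : ℂ) : sw (sw z) = z := rfl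
@[simp] lemma fl_fl (z : ℂ) : fl (fl z) = z := by apply Complex.ext <;> simp

lemma isometry_sw : Isometry sw := by
  apply Isometry.of_dist_eq
  intro z w
  simp [Complex.dist_eq_re_im, add_comm]

lemma isometry_fl : Isometry fl := by
  apply Isometry.of_dist_eq
  intro z w
  simp only [Complex.dist_eq_re_im, fl_re, fl_im]
  congr 2; ring

section
variable [OddBase p]

/-- Swap of the coordinates of a digit. -/
def digSw (d : Dig p) : Dig p := ⟨(d.1.2, d.1.1), fun h => d.2 ⟨h.2, h.1⟩⟩

/-- Reversal of the first coordinate of a digit. -/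
def digFl (d : Dig p) : Dig p := ⟨(d.1.1.rev, d.1.2), fun h => d.2 ⟨by
  obtain ⟨m, hm⟩ := (OddBase.odd : Odd p)
  have h1 := h.1
  have := d.1.1.2
  rw [Fin.val_rev] at h1
  omega, h.2⟩⟩

@[simp] lemma digSw_digSw (d : Dig p) : digSw (digSw d) = d := rfl
@[simp] lemma digFl_digFl (d : Dig p) : digFl (digFl d) = d := by
  apply Subtype.ext; simp [digFl]

/-- Action of `sw` on addresses. -/
def wSw (w : Word p) : Word p := w.map digSw
/-- Action of `fl` on addresses. -/
def wFl (w : Word p) : Word p := w.map digFl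

@[simp] lemma wSw_wSw (w : Word p) : wSw (wSw w) = w := by
  induction w with
  | nil => rfl
  | cons d w ih => simpa [wSw] using ih
@[simp] lemma wFl_wFl (w : Word p) : wFl (wFl w) = w := by
  induction w with
  | nil => rfl
  | cons d w ih => simpa [wFl] using ih

@[simp] lemma sc_wSw (w : Word p) : sc (wSw w) = sc w := by simp [sc, wSw]
@[simp] lemma sc_wFl (w : Word p) : sc (wFl w) = sc w := by simp [sc, wFl]
@[simp] lemma hs_wSw (w : Word p) : hs (wSw w) = hs w := by simp [hs]
@[simp] lemma hs_wFl (w : Word p) : hs (wFl w) = hs w := by simp [hs]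

@[simp] lemma cx_wSw (w : Word p) : cx (wSw w) = cy w := by
  induction w with
  | nil => rfl
  | cons d w ih =>
    rw [cy_cons, ← ih]; rfl
@[simp] lemma cy_wSw (w : Word p) : cy (wSw w) = cx w := by
  rw [← cx_wSw, wSw_wSw]
@[simp] lemma hx_wSw (w : Word p) : hx (wSw w) = hy w := by simp [hx, hy]
@[simp] lemma hy_wSw (w : Word p) : hy (wSw w) = hx w := by simp [hx, hy]

lemma cx_wFl (w : Word p) : cx (wFl w) = 1 - cx w - sc w := by
  have hp := p_pos (p := p)
  induction w with
  | nil => simp [wFl]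
  | cons d w ih =>
    have e : wFl (d :: w) = digFl d :: wFl w := rfl
    have e2 : (((digFl d).1.1 : ℕ) : ℝ) = p - ((d.1.1 : ℕ) + 1) := by
      have h := d.1.1.2
      have : ((digFl d).1.1 : ℕ) = p - (d.1.1 + 1) := by simp [digFl, Fin.val_rev]
      rw [this, Nat.cast_sub (by omega)]; push_cast; ring
    rw [e, cx_cons, ih, cx_cons, e2, sc_cons]
    field_simp; ring
@[simp] lemma cy_wFl (w : Word p) : cy (wFl w) = cy w := by
  induction w with
  | nil => rfl
  | cons d w ih =>
    rw [cy_cons, ← ih]; rfl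
lemma hx_wFl (w : Word p) : hx (wFl w) = 1 - hx w - hs w := by
  have h1 := two_hx (wFl w); have h2 := two_hx w
  rw [hs_wFl, sc_wFl, cx_wFl] at h1
  linarith
@[simp] lemma hy_wFl (w : Word p) : hy (wFl w) = hy w := by simp [hy]

lemma sw_mem_csq {a b s : ℝ} {z : ℂ} : sw z ∈ csq b a s ↔ z ∈ csq a b s := by
  simp only [csq, Set.mem_ofPred_eq, sw_re, sw_im]; tauto
lemma sw_mem_osq {a b s : ℝ} {z : ℂ} : sw z ∈ osq b a s ↔ z ∈ osq a b s := by
  simp only [osq, Set.mem_ofPred_eq, sw_re, sw_im]; tauto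
lemma fl_mem_csq {a b s : ℝ} {z : ℂ} : fl z ∈ csq (1 - a - s) b s ↔ z ∈ csq a b s := by
  simp only [csq, Set.mem_ofPred_eq, fl_re, fl_im]
  constructor <;> rintro ⟨⟨h1, h2⟩, h3⟩ <;> exact ⟨⟨by linarith, by linarith⟩, h3⟩
lemma fl_mem_osq {a b s : ℝ} {z : ℂ} : fl z ∈ osq (1 - a - s) b s ↔ z ∈ osq a b s := by
  simp only [osq, Set.mem_ofPred_eq, fl_re, fl_im]
  constructor <;> rintro ⟨⟨h1, h2⟩, h3⟩ <;> exact ⟨⟨by linarith, by linarith⟩, h3⟩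

lemma sw_mem_hole {w : Word p} {z : ℂ} : sw z ∈ hole w ↔ z ∈ hole (wSw w) := by
  rw [hole, sw_mem_osq, hole, hx_wSw, hy_wSw, hs_wSw]
lemma fl_mem_hole {w : Word p} {z : ℂ} : fl z ∈ hole w ↔ z ∈ hole (wFl w) := by
  obtain ⟨v, rfl⟩ : ∃ v, w = wFl v := ⟨wFl w, (wFl_wFl w).symm⟩
  rw [hole, hx_wFl, hy_wFl, hs_wFl, fl_mem_osq, wFl_wFl]; rfl

lemma sw_mem_carpet {z : ℂ} : sw z ∈ sierpinskiCarpet p ↔ z ∈ sierpinskiCarpet p := by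
  simp only [mem_carpet, sw_mem_csq, sw_mem_hole]
  refine and_congr_right fun _ => ⟨fun h w => ?_, fun h w => h _⟩
  simpa using h (wSw w)
lemma fl_mem_carpet {z : ℂ} : fl z ∈ sierpinskiCarpet p ↔ z ∈ sierpinskiCarpet p := by
  have := fl_mem_csq (a := 0) (b := 0) (s := 1) (z := z)
  rw [sub_zero, sub_self] at this
  simp only [mem_carpet, this, fl_mem_hole]
  refine and_congr_right fun _ => ⟨fun h w => ?_, fun h w => h _⟩
  simpa using h (wFl w)

lemma sw_mem_circ {i : Option (Word p)} {z : ℂ} :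
    sw z ∈ circ (i.map wSw) ↔ z ∈ circ i := by
  cases i with
  | none => exact and_congr sw_mem_csq (not_congr sw_mem_osq)
  | some w =>
    simp only [Option.map_some, circ, sqb, mem_sdiff, hx_wSw, hy_wSw, hs_wSw, sw_mem_osq, sw_mem_csq]
lemma fl_mem_circ {i : Option (Word p)} {z : ℂ} :
    fl z ∈ circ (i.map wFl) ↔ z ∈ circ i := by
  cases i with
  | none =>
    have h1 := fl_mem_csq (a := 0) (b := 0) (s := 1) (z := z)
    have h2 := fl_mem_osq (a := 0) (b := 0) (s := 1) (z := z)
    rw [sub_zero, sub_self] at h1 h2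
    exact and_congr h1 (not_congr h2)
  | some w =>
    simp only [Option.map_some, circ, sqb, mem_sdiff, hx_wFl, hy_wFl, hs_wFl, fl_mem_osq,
      fl_mem_csq]

/-- `sw` on the carpet. -/
def swX : sierpinskiCarpet p ≃ₜ sierpinskiCarpet p where
  toFun z := ⟨sw z, sw_mem_carpet.2 z.2⟩
  invFun z := ⟨sw z, sw_mem_carpet.2 z.2⟩
  left_inv z := by simp
  right_inv z := by simp
  continuous_toFun := (isometry_sw.continuous.comp continuous_subtype_val).subtype_mk _
  continuous_invFun := (isometry_sw.continuous.comp continuous_subtype_val).subtype_mk _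

/-- `fl` on the carpet. -/
def flX : sierpinskiCarpet p ≃ₜ sierpinskiCarpet p where
  toFun z := ⟨fl z, fl_mem_carpet.2 z.2⟩
  invFun z := ⟨fl z, fl_mem_carpet.2 z.2⟩
  left_inv z := by simp
  right_inv z := by simp
  continuous_toFun := (isometry_fl.continuous.comp continuous_subtype_val).subtype_mk _
  continuous_invFun := (isometry_fl.continuous.comp continuous_subtype_val).subtype_mk _

lemma isometry_swX : Isometry (swX (p := p)) := fun x y => isometry_sw x.1 y.1
lemma isometry_flX : Isometry (flX (p := p)) := fun x y => isometry_fl x.1 y.1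
@[simp] lemma coe_swX (z : sierpinskiCarpet p) : (swX z : ℂ) = sw z := rfl
@[simp] lemma coe_flX (z : sierpinskiCarpet p) : (flX z : ℂ) = fl z := rfl

/-- A locally constant function on a closed subset of the line is constant
when it does not jump across gaps. -/
lemma const_of_gaps {S R : Set ℝ} (hS : IsClosed S) (hR : R.OrdConnected) (f : ℝ → Bool)
    (hf : ContinuousOn f (S ∩ R))
    (hgap : ∀ a ∈ S ∩ R, ∀ b ∈ S ∩ R, a < b → (∀ t ∈ Ioo a b, t ∉ S) → f a = f b)
    {a b : ℝ} (ha : a ∈ S ∩ R) (hb : b ∈ S ∩ R) : f a = f b := by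
  wlog hab : a ≤ b generalizing a b
  · exact (this hb ha (le_of_not_ge hab)).symm
  by_contra hne
  have hsub : ∀ c ∈ Icc a b, c ∈ R := fun c hc => hR.out ha.2 hb.2 hc
  have hcl : ∀ v : Bool, ∀ c ∈ Icc a b, IsCompact {t | t ∈ Icc c b ∩ S ∧ f t = v} ∧
      IsCompact {t | t ∈ Icc a c ∩ S ∧ f t = v} := by
    intro v c hc
    constructor
    · have h1 : ContinuousOn f (Icc c b ∩ S) := hf.mono fun t ht =>
        ⟨ht.2, hsub t ⟨hc.1.trans ht.1.1, ht.1.2⟩⟩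
      have := h1.preimage_isClosed_of_isClosed (isClosed_Icc.inter hS)
        (isClosed_discrete ({v} : Set Bool))
      exact (isCompact_Icc.of_isClosed_subset this fun t ht => ht.1.1)
    · have h1 : ContinuousOn f (Icc a c ∩ S) := hf.mono fun t ht =>
        ⟨ht.2, hsub t ⟨ht.1.1, ht.1.2.trans hc.2⟩⟩
      have := h1.preimage_isClosed_of_isClosed (isClosed_Icc.inter hS)
        (isClosed_discrete ({v} : Set Bool))
      exact (isCompact_Icc.of_isClosed_subset this fun t ht => ht.1.1)
  obtain ⟨t0, ⟨⟨h0, h0S⟩, h0f⟩, h0max⟩ := (hcl (f a) b ⟨hab, le_rfl⟩).2.exists_isGreatest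
    ⟨a, ⟨⟨le_rfl, hab⟩, ha.1⟩, rfl⟩
  obtain ⟨t1, ⟨⟨h1, h1S⟩, h1f⟩, h1min⟩ := (hcl (f b) t0 h0).1.exists_isLeast
    ⟨b, ⟨⟨h0.2, le_rfl⟩, hb.1⟩, rfl⟩
  have hlt : t0 < t1 := lt_of_le_of_ne h1.1 fun e => hne (by rw [← h0f, ← h1f, e])
  refine hne ?_
  rw [← h0f, ← h1f]
  refine hgap t0 ⟨h0S, hsub t0 h0⟩ t1 ⟨h1S, hsub t1 ⟨h0.1.trans h1.1, h1.2⟩⟩ hlt ?_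
  intro t ht htS
  by_cases hft : f t = f a
  · exact absurd (h0max ⟨⟨⟨h0.1.trans ht.1.le, ht.2.le.trans h1.2⟩, htS⟩, hft⟩) (not_le.2 ht.1)
  · have hfb : f t = f b := by
      revert hft hne; cases f t <;> cases f a <;> cases f b <;> simp
    exact absurd (h1min ⟨⟨⟨ht.1.le, ht.2.le.trans h1.2⟩, htS⟩, hfb⟩) (not_le.2 ht.2)

lemma isPreconnected_sqb {a b s : ℝ} (hs : 0 ≤ s) : IsPreconnected (sqb a b s) := by
  have hseg1 : ∀ c : ℝ, IsPreconnected ((fun t : ℝ => (⟨t, c⟩ : ℂ)) '' Icc a (a + s)) := fun c =>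
    isPreconnected_Icc.image _ (by
      apply Continuous.continuousOn
      exact Complex.equivRealProdCLM.symm.continuous.comp (by fun_prop : Continuous fun t : ℝ => (t, c)))
  have hseg2 : ∀ c : ℝ, IsPreconnected ((fun t : ℝ => (⟨c, t⟩ : ℂ)) '' Icc b (b + s)) := fun c =>
    isPreconnected_Icc.image _ (by
      apply Continuous.continuousOn
      exact Complex.equivRealProdCLM.symm.continuous.comp (by fun_prop : Continuous fun t : ℝ => (c, t)))
  have u1 := IsPreconnected.union (⟨a, b⟩ : ℂ) (by exact ⟨a, ⟨le_rfl, by linarith⟩, rfl⟩)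
    (by exact ⟨b, ⟨le_rfl, by linarith⟩, rfl⟩) (hseg1 b) (hseg2 a)
  have u2 := IsPreconnected.union (⟨a + s, b + s⟩ : ℂ)
    (by exact ⟨a + s, ⟨by linarith, le_rfl⟩, rfl⟩)
    (by exact ⟨b + s, ⟨by linarith, le_rfl⟩, rfl⟩) (hseg1 (b + s)) (hseg2 (a + s))
  have u3 := IsPreconnected.union (⟨a + s, b⟩ : ℂ)
    (by exact Or.inl ⟨a + s, ⟨by linarith, le_rfl⟩, rfl⟩)
    (by exact Or.inr ⟨b, ⟨le_rfl, by linarith⟩, rfl⟩) u1 u2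
  convert u3
  ext z
  simp only [sqb, csq, osq, mem_sdiff, Set.mem_ofPred_eq, mem_union, mem_image, mem_Icc]
  constructor
  · rintro ⟨⟨⟨h1, h2⟩, h3, h4⟩, h5⟩
    rcases eq_or_lt_of_le h1 with e | l1
    · exact Or.inl (Or.inr ⟨z.im, ⟨h3, h4⟩, Complex.ext e rfl⟩)
    rcases eq_or_lt_of_le h2 with e | l2
    · exact Or.inr (Or.inr ⟨z.im, ⟨h3, h4⟩, Complex.ext e.symm rfl⟩)
    rcases eq_or_lt_of_le h3 with e | l3
    · exact Or.inl (Or.inl ⟨z.re, ⟨h1, h2⟩, Complex.ext rfl e⟩)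
    rcases eq_or_lt_of_le h4 with e | l4
    · exact Or.inr (Or.inl ⟨z.re, ⟨h1, h2⟩, Complex.ext rfl e.symm⟩)
    exact absurd ⟨⟨l1, l2⟩, l3, l4⟩ h5
  · rintro ((⟨t, ⟨h1, h2⟩, rfl⟩ | ⟨t, ⟨h1, h2⟩, rfl⟩) | (⟨t, ⟨h1, h2⟩, rfl⟩ | ⟨t, ⟨h1, h2⟩, rfl⟩)) <;>
    refine ⟨⟨⟨?_, ?_⟩, ?_, ?_⟩, fun h => ?_⟩ <;> simp only at * <;>
    first | linarith | (obtain ⟨⟨h3, h4⟩, h5, h6⟩ := h; linarith)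

lemma isPreconnected_circ (i : Option (Word p)) : IsPreconnected (circ i) := by
  cases i with
  | none => exact isPreconnected_sqb zero_le_one
  | some w => exact isPreconnected_sqb (hs_pos w).le

/-- The trace of a horizontal line on the carpet, together with the circles of the holes
crossed by the line. -/
def line (p : ℕ) (y : ℝ) (R : Set ℝ) : Set ℂ :=
  {z | z ∈ sierpinskiCarpet p ∧ z.im = y ∧ z.re ∈ R} ∪
    {z | ∃ w : Word p, (hy w < y ∧ y < hy w + hs w) ∧ Icc (hx w) (hx w + hs w) ⊆ R ∧
      z ∈ circ (some w)}

lemma line_subset_carpet (y : ℝ) (R : Set ℝ) : line p y R ⊆ sierpinskiCarpet p := by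
  rintro z (h | ⟨w, -, -, h⟩)
  · exact h.1
  · exact circ_subset_carpet _ h

lemma isClosed_slice (y : ℝ) : IsClosed {t : ℝ | (⟨t, y⟩ : ℂ) ∈ sierpinskiCarpet p} :=
  isCompact_carpet.isClosed.preimage
    (Complex.equivRealProdCLM.symm.continuous.comp (by fun_prop : Continuous fun t : ℝ => (t, y)))

/-- A gap of a horizontal slice of the carpet is a hole. -/
lemma exists_hole_of_gap {y a b : ℝ} (ha : (⟨a, y⟩ : ℂ) ∈ sierpinskiCarpet p)
    (hb : (⟨b, y⟩ : ℂ) ∈ sierpinskiCarpet p) (hab : a < b)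
    (hgap : ∀ t ∈ Ioo a b, (⟨t, y⟩ : ℂ) ∉ sierpinskiCarpet p) :
    ∃ w : Word p, (hy w < y ∧ y < hy w + hs w) ∧ a = hx w ∧ b = hx w + hs w := by
  have hau := (mem_carpet.1 ha).1
  have hbu := (mem_carpet.1 hb).1
  have hm := hgap ((a + b) / 2) ⟨by linarith, by linarith⟩
  rw [mem_carpet] at hm
  push Not at hm
  obtain ⟨w, ⟨h1, h2⟩, h3⟩ := hm
    ⟨⟨by linarith [hau.1.1], by linarith [hbu.1.2]⟩, hau.2⟩
  simp only at h1 h2 h3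
  have hs0 := hs_pos w
  have hl : (⟨hx w, y⟩ : ℂ) ∈ sierpinskiCarpet p := circ_subset_carpet (some w)
    ⟨⟨⟨le_rfl, by simp only; linarith⟩, h3.1.le, h3.2.le⟩, fun h => lt_irrefl _ h.1.1⟩
  have hr : (⟨hx w + hs w, y⟩ : ℂ) ∈ sierpinskiCarpet p := circ_subset_carpet (some w)
    ⟨⟨⟨by simp only; linarith, le_rfl⟩, h3.1.le, h3.2.le⟩, fun h => lt_irrefl _ h.1.2⟩
  refine ⟨w, h3, ?_, ?_⟩
  · by_contra hne
    rcases lt_or_gt_of_ne hne with h | h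
    · exact hgap (hx w) ⟨h, by linarith⟩ hl
    · exact (mem_carpet.1 ha).2 w ⟨⟨h, by simp only; linarith⟩, h3⟩
  · by_contra hne
    rcases lt_or_gt_of_ne hne with h | h
    · exact (mem_carpet.1 hb).2 w ⟨⟨by simp only; linarith, h⟩, h3⟩
    · exact hgap (hx w + hs w) ⟨by linarith, h⟩ hr

lemma isPreconnected_line (y : ℝ) {R : Set ℝ} (hR : R.OrdConnected) :
    IsPreconnected (line p y R) := by
  apply isPreconnected_of_forall_constant
  intro f hf
  set S : Set ℝ := {t : ℝ | (⟨t, y⟩ : ℂ) ∈ sierpinskiCarpet p} with hSdef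
  have hmem : ∀ t ∈ S ∩ R, (⟨t, y⟩ : ℂ) ∈ line p y R := fun t ht => Or.inl ⟨ht.1, rfl, ht.2⟩
  have hcirc : ∀ w : Word p, (hy w < y ∧ y < hy w + hs w) → Icc (hx w) (hx w + hs w) ⊆ R →
      ∀ z ∈ circ (some w), ∀ z' ∈ circ (some w), f z = f z' := by
    intro w h1 h2 z hz z' hz'
    have hc : ContinuousOn f (circ (some w)) := hf.mono fun u hu => Or.inr ⟨w, h1, h2, hu⟩
    exact (((isPreconnected_circ (some w)).image f hc).subsingleton)
      (mem_image_of_mem f hz) (mem_image_of_mem f hz')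
  have hl : ∀ w : Word p, (hy w < y ∧ y < hy w + hs w) → (⟨hx w, y⟩ : ℂ) ∈ circ (some w) ∧
      (⟨hx w + hs w, y⟩ : ℂ) ∈ circ (some w) := by
    intro w h3
    have hs0 := hs_pos w
    exact ⟨⟨⟨⟨le_rfl, by simp only; linarith⟩, h3.1.le, h3.2.le⟩, fun h => lt_irrefl _ h.1.1⟩,
      ⟨⟨⟨by simp only; linarith, le_rfl⟩, h3.1.le, h3.2.le⟩, fun h => lt_irrefl _ h.1.2⟩⟩
  have hconst : ∀ a ∈ S ∩ R, ∀ b ∈ S ∩ R, f ⟨a, y⟩ = f ⟨b, y⟩ := by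
    intro a ha b hb
    refine const_of_gaps (isClosed_slice y) hR (fun t => f ⟨t, y⟩) ?_ ?_ ha hb
    · refine hf.comp (t := line p y R) ?_ hmem
      exact (Complex.equivRealProdCLM.symm.continuous.comp
        (by fun_prop : Continuous fun t : ℝ => (t, y))).continuousOn
    · intro a ha b hb hab hgap
      obtain ⟨w, h1, rfl, rfl⟩ := exists_hole_of_gap ha.1 hb.1 hab hgap
      exact hcirc w h1 (hR.out ha.2 hb.2) _ (hl w h1).1 _ (hl w h1).2
  have hred : ∀ z ∈ line p y R, ∃ t ∈ S ∩ R, f z = f ⟨t, y⟩ := by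
    rintro z (⟨h1, rfl, h3⟩ | ⟨w, h1, h2, h3⟩)
    · exact ⟨z.re, ⟨h1, h3⟩, rfl⟩
    · exact ⟨hx w, ⟨circ_subset_carpet _ (hl w h1).1, h2 ⟨le_rfl, by linarith [hs_pos w]⟩⟩,
        hcirc w h1 h2 _ h3 _ (hl w h1).1⟩
  intro z hz z' hz'
  obtain ⟨t, ht, e⟩ := hred z hz
  obtain ⟨t', ht', e'⟩ := hred z' hz'
  rw [e, e', hconst t ht t' ht']

/-- The vertical analogue of `line`. -/
def vline (p : ℕ) (x : ℝ) (R : Set ℝ) : Set ℂ := sw '' line p x R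

lemma mem_vline {x : ℝ} {R : Set ℝ} {z : ℂ} : z ∈ vline p x R ↔
    (z ∈ sierpinskiCarpet p ∧ z.re = x ∧ z.im ∈ R) ∨
    ∃ w : Word p, (hx w < x ∧ x < hx w + hs w) ∧ Icc (hy w) (hy w + hs w) ⊆ R ∧
      z ∈ circ (some w) := by
  constructor
  · rintro ⟨u, (⟨h1, h2, h3⟩ | ⟨w, h1, h2, h3⟩), rfl⟩
    · exact Or.inl ⟨sw_mem_carpet.2 h1, h2, h3⟩
    · exact Or.inr ⟨wSw w, by simpa using h1, by simpa using h2, sw_mem_circ (i := some w).2 h3⟩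
  · rintro (⟨h1, h2, h3⟩ | ⟨w, h1, h2, h3⟩)
    · exact ⟨sw z, Or.inl ⟨sw_mem_carpet.2 h1, h2, h3⟩, sw_sw z⟩
    · exact ⟨sw z, Or.inr ⟨wSw w, by simpa using h1, by simpa using h2,
        sw_mem_circ (i := some w).2 h3⟩, sw_sw z⟩

lemma isPreconnected_vline (x : ℝ) {R : Set ℝ} (hR : R.OrdConnected) :
    IsPreconnected (vline p x R) :=
  (isPreconnected_line x hR).image _ isometry_sw.continuous.continuousOn

lemma vline_subset_carpet (x : ℝ) (R : Set ℝ) : vline p x R ⊆ sierpinskiCarpet p := by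
  rintro z ⟨u, hu, rfl⟩
  exact sw_mem_carpet.2 (line_subset_carpet _ _ hu)

lemma chole_corner {w : Word p} : (⟨hx w, hy w⟩ : ℂ) ∈ circ (some w) := by
  have := hs_pos w
  exact ⟨⟨⟨le_rfl, by simp only; linarith⟩, le_rfl, by simp only; linarith⟩,
    fun h => lt_irrefl _ h.1.1⟩

lemma hole_range (w : Word p) : 0 < hx w ∧ hx w + hs w < 1 ∧ 0 < hy w ∧ hy w + hs w < 1 := by
  have := cx_lt_hx w; have := cy_lt_hy w
  have := two_hx w; have := two_hy w; have := hs_pos w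
  have := cx_nonneg w; have := cy_nonneg w; have := cx_add_le w; have := cy_add_le w
  exact ⟨by linarith, by linarith, by linarith, by linarith⟩

/-- A row and a column meet. -/
lemma line_inter_vline {x y : ℝ} {R R' : Set ℝ} (hx0 : x ∈ Icc (0 : ℝ) 1) (hy0 : y ∈ Icc (0 : ℝ) 1)
    (hxR : x ∈ R) (hyR : y ∈ R') (hR : Ioo 0 1 ⊆ R) (hR' : Ioo 0 1 ⊆ R') :
    (line p y R ∩ vline p x R').Nonempty := by
  by_cases h : (⟨x, y⟩ : ℂ) ∈ sierpinskiCarpet p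
  · exact ⟨_, Or.inl ⟨h, rfl, hxR⟩, mem_vline.2 (Or.inl ⟨h, rfl, hyR⟩)⟩
  · rw [mem_carpet] at h
    push Not at h
    obtain ⟨w, h1, h2⟩ := h ⟨by simpa using hx0, by simpa using hy0⟩
    obtain ⟨r1, r2, r3, r4⟩ := hole_range w
    refine ⟨⟨hx w, hy w⟩, Or.inr ⟨w, h2, ?_, chole_corner⟩,
      mem_vline.2 (Or.inr ⟨w, h1, ?_, chole_corner⟩)⟩
    · exact fun t ht => hR ⟨by linarith [ht.1], by linarith [ht.2]⟩
    · exact fun t ht => hR' ⟨by linarith [ht.1], by linarith [ht.2]⟩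

/-- Removing a peripheral circle does not disconnect the carpet. -/
lemma isPreconnected_carpet_diff_circ (i : Option (Word p)) :
    IsPreconnected (sierpinskiCarpet p \ circ i) := by
  cases i with
  | none =>
    have hsubL : ∀ y : ℝ, 0 < y → y < 1 → line p y (Ioo 0 1) ⊆
        sierpinskiCarpet p \ circ (none : Option (Word p)) := by
      intro y h0 h1 z hz
      refine ⟨line_subset_carpet _ _ hz, fun ho => ?_⟩
      rcases hz with ⟨-, rfl, h3⟩ | ⟨w, -, -, h3⟩
      · exact ho.2 ⟨⟨h3.1, by simpa using h3.2⟩, h0, by simpa using h1⟩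
      · exact Set.disjoint_left.1 (circ_disjoint (i := none) (j := some w) (by simp)) ho h3
    have hV : vline p (1 / 2) (Ioo 0 1) ⊆
        sierpinskiCarpet p \ circ (none : Option (Word p)) := by
      rintro z ⟨u, hu, rfl⟩
      have := hsubL (1 / 2) (by norm_num) (by norm_num) hu
      exact ⟨sw_mem_carpet.2 this.1, fun h => this.2 ((sw_mem_circ (i := none)).1 h)⟩
    have hb : (⟨hx ([] : Word p), hy ([] : Word p)⟩ : ℂ) ∈ vline p (1 / 2) (Ioo 0 1) := by
      have h2 := two_hx ([] : Word p)
      have h3 := hs_pos ([] : Word p)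
      obtain ⟨r1, r2, r3, r4⟩ := hole_range ([] : Word p)
      simp only [cx_nil, sc_nil] at h2
      exact mem_vline.2 (Or.inr ⟨[], ⟨by linarith, by linarith⟩,
        fun t ht => ⟨by linarith [ht.1], by linarith [ht.2]⟩, chole_corner⟩)
    refine isPreconnected_of_forall (⟨hx ([] : Word p), hy ([] : Word p)⟩ : ℂ) fun z hz => ?_
    have hzo : z ∈ osq 0 0 1 := by
      by_contra h
      exact hz.2 ⟨carpet_subset_unit hz.1, h⟩
    obtain ⟨⟨h1, h2⟩, h3, h4⟩ := hzo
    have hzl : z ∈ line p z.im (Ioo 0 1) := Or.inl ⟨hz.1, rfl, h1, by linarith⟩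
    obtain ⟨q, hq1, hq2⟩ := line_inter_vline (p := p) (x := 1 / 2) (y := z.im) (R := Ioo 0 1)
      (R' := Ioo 0 1) (by norm_num) ⟨h3.le, by linarith⟩ (by norm_num) ⟨h3, by linarith⟩
      subset_rfl subset_rfl
    refine ⟨line p z.im (Ioo 0 1) ∪ vline p (1 / 2) (Ioo 0 1),
      union_subset (hsubL _ h3 (by linarith)) hV, Or.inr hb, Or.inl hzl, ?_⟩
    exact (isPreconnected_line _ ordConnected_Ioo).union q hq1 hq2
      (isPreconnected_vline _ ordConnected_Ioo)
  | some v =>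
    have hO : circ (none : Option (Word p)) ⊆ sierpinskiCarpet p \ circ (some v) := fun z hz =>
      ⟨circ_subset_carpet _ hz, Set.disjoint_left.1 (circ_disjoint (by simp)) hz⟩
    have key : ∀ z ∈ sierpinskiCarpet p \ circ (some v), ∀ R : Set ℝ, R.OrdConnected → z.re ∈ R →
        (0 ∈ R ∨ 1 ∈ R) → (∀ t ∈ R, t < hx v ∨ hx v + hs v < t ∨ z.im < hy v ∨ hy v + hs v < z.im) →
        ∃ t ⊆ sierpinskiCarpet p \ circ (some v), (0 : ℂ) ∈ t ∧ z ∈ t ∧ IsPreconnected t := by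
      intro z hz R hR hzR h01 hav
      have hzu := carpet_subset_unit hz.1
      refine ⟨circ none ∪ line p z.im R, union_subset hO ?_, ?_, Or.inr (Or.inl ⟨hz.1, rfl, hzR⟩), ?_⟩
      · intro q hq
        refine ⟨line_subset_carpet _ _ hq, fun hqv => ?_⟩
        rcases hq with ⟨-, h2, h3⟩ | ⟨w, h1, h2, h3⟩
        · obtain ⟨⟨⟨k1, k2⟩, k3, k4⟩, -⟩ := hqv
          rw [h2] at k3 k4
          rcases hav _ h3 with h | h | h | h <;> linarith
        · have hwv : w = v := by
            by_contra hne
            exact Set.disjoint_left.1 (circ_disjoint (i := some w) (j := some v) (by simpa)) h3 hqv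
          subst hwv
          have hs0 := hs_pos w
          rcases hav _ (h2 (show hx w ∈ _ from ⟨le_rfl, by linarith⟩)) with h | h | h | h <;> linarith
      · refine Or.inl ⟨⟨⟨?_, ?_⟩, ?_, ?_⟩, fun h => ?_⟩ <;> try simp
        exact lt_irrefl _ h.1.1
      · rcases h01 with h | h
        · refine (isPreconnected_circ none).union (⟨0, z.im⟩ : ℂ) ?_ ?_ (isPreconnected_line _ hR)
          · exact ⟨⟨⟨le_rfl, by simp⟩, hzu.2⟩, fun h => lt_irrefl _ h.1.1⟩
          · refine Or.inl ⟨circ_subset_carpet none ?_, rfl, h⟩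
            exact ⟨⟨⟨le_rfl, by simp⟩, hzu.2⟩, fun h => lt_irrefl _ h.1.1⟩
        · refine (isPreconnected_circ none).union (⟨1, z.im⟩ : ℂ) ?_ ?_ (isPreconnected_line _ hR)
          · exact ⟨⟨⟨by simp, by simp⟩, hzu.2⟩, fun h => by have := h.1.2; simp at this⟩
          · refine Or.inl ⟨circ_subset_carpet none ?_, rfl, h⟩
            exact ⟨⟨⟨by simp, by simp⟩, hzu.2⟩, fun h => by have := h.1.2; simp at this⟩
    refine isPreconnected_of_forall (0 : ℂ) fun z hz => ?_
    have hzu := carpet_subset_unit hz.1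
    have hzc : z ∉ chole v := fun h => hz.2 ⟨h, (mem_carpet.1 hz.1).2 v⟩
    by_cases h1 : hx v ≤ z.re
    · by_cases h2 : z.re ≤ hx v + hs v
      · refine key z hz univ ordConnected_univ trivial (Or.inl trivial) fun t _ => ?_
        by_contra h
        push Not at h
        exact hzc ⟨⟨h1, h2⟩, h.2.2⟩
      · refine key z hz (Ici z.re) ordConnected_Ici self_mem_Ici (Or.inr ?_) fun t ht => ?_
        · have := hzu.1.2; simp at this; exact this
        · right; left
          have : z.re ≤ t := ht
          linarith
    · refine key z hz (Iic z.re) ordConnected_Iic self_mem_Iic (Or.inl hzu.1.1) fun t ht => ?_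
      left
      have : t ≤ z.re := ht
      linarith

end

end

end Carpet

namespace Carpet

noncomputable section

/-- Existence of a continuous logarithm. -/
def HasLog {E : Type*} [TopologicalSpace E] (φ : E → ℂ) (S : Set E) : Prop :=
  ∃ g : E → ℂ, ContinuousOn g S ∧ ∀ z ∈ S, φ z = Complex.exp (g z)

section
variable {E : Type*} [TopologicalSpace E] {φ ψ : E → ℂ} {S : Set E}

lemma HasLog.mul (h : HasLog φ S) (h' : HasLog ψ S) : HasLog (fun z => φ z * ψ z) S := by
  obtain ⟨g, hg, e⟩ := h
  obtain ⟨g', hg', e'⟩ := h'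
  exact ⟨fun z => g z + g' z, hg.add hg', fun z hz => by
    simp only [e z hz, e' z hz, Complex.exp_add]⟩

lemma HasLog.zpow (h : HasLog φ S) (n : ℤ) : HasLog (fun z => φ z ^ n) S := by
  obtain ⟨g, hg, e⟩ := h
  exact ⟨fun z => n * g z, continuousOn_const.mul hg, fun z hz => by
    simp only [e z hz, Complex.exp_int_mul]⟩

lemma HasLog.mono {T : Set E} (h : HasLog φ S) (hT : T ⊆ S) : HasLog φ T := by
  obtain ⟨g, hg, e⟩ := h
  exact ⟨g, hg.mono hT, fun z hz => e z (hT hz)⟩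

lemma HasLog.congr (h : HasLog φ S) (he : ∀ z ∈ S, ψ z = φ z) : HasLog ψ S := by
  obtain ⟨g, hg, e⟩ := h
  exact ⟨g, hg, fun z hz => by rw [he z hz, e z hz]⟩

lemma HasLog.prod {ι : Type*} {φ : ι → E → ℂ} (W : Finset ι) (h : ∀ w ∈ W, HasLog (φ w) S) :
    HasLog (fun z => ∏ w ∈ W, φ w z) S := by
  classical
  induction W using Finset.induction_on with
  | empty => exact ⟨fun _ => 0, continuousOn_const, by simp⟩
  | insert w W hw ih =>
    refine ((h w (by simp)).mul (ih fun v hv => h v (by simp [hv]))).congr fun z _ => ?_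
    rw [Finset.prod_insert hw]

lemma hasLog_of_near_one (hφ : ContinuousOn φ S) (h : ∀ z ∈ S, ‖φ z - 1‖ < 1) : HasLog φ S := by
  have hs : ∀ z ∈ S, φ z ∈ Complex.slitPlane := fun z hz => by
    simpa using Complex.mem_slitPlane_of_norm_lt_one (z := φ z - 1) (h z hz)
  refine ⟨fun z => Complex.log (φ z), hφ.clog hs, fun z hz => ?_⟩
  rw [Complex.exp_log (Complex.slitPlane_ne_zero (hs z hz))]

end

lemma hasLog_of_convex {E : Type*} [NormedAddCommGroup E] [NormedSpace ℝ E] {S : Set E}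
    (hc : Convex ℝ S) (hk : IsCompact S) {φ : E → ℂ} (hφ : ContinuousOn φ S)
    (h0 : ∀ z ∈ S, φ z ≠ 0) : HasLog φ S := by
  rcases S.eq_empty_or_nonempty with rfl | ⟨z0, hz0⟩
  · exact ⟨0, continuousOn_empty _, by simp⟩
  obtain ⟨m, hm, hmin⟩ := hk.exists_isMinOn ⟨z0, hz0⟩ hφ.norm
  have hcpos : 0 < ‖φ m‖ := norm_pos_iff.2 (h0 m hm)
  have hu := hk.uniformContinuousOn_of_continuous hφ
  rw [Metric.uniformContinuousOn_iff] at hu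
  obtain ⟨δ, hδ, hu⟩ := hu _ hcpos
  obtain ⟨B, hB⟩ := hk.isBounded.exists_norm_le
  have hB0 : 0 ≤ B := (norm_nonneg _).trans (hB z0 hz0)
  obtain ⟨n, hn⟩ := exists_nat_gt (2 * B / δ)
  have hn0 : (0 : ℝ) < n + 1 := by positivity
  set H : ℕ → E → E := fun k z => z0 + (k / (n + 1) : ℝ) • (z - z0) with hH
  have hHS : ∀ k ≤ n + 1, ∀ z ∈ S, H k z ∈ S := by
    intro k hk z hz
    have : (k : ℝ) ≤ n + 1 := by exact_mod_cast hk
    exact hc.add_smul_sub_mem hz0 hz ⟨by positivity, by rw [div_le_one hn0]; exact this⟩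
  have hHc : ∀ k, Continuous (H k) := fun k => by fun_prop
  have hφH : ∀ k ≤ n + 1, ContinuousOn (fun z => φ (H k z)) S := fun k hk =>
    hφ.comp (hHc k).continuousOn (hHS k hk)
  have key : ∀ k ≤ n + 1, HasLog (fun z => φ (H k z)) S := by
    intro k
    induction k with
    | zero =>
      intro _
      refine ⟨fun _ => Complex.log (φ z0), continuousOn_const, fun z hz => ?_⟩
      rw [Complex.exp_log (h0 z0 hz0)]
      simp [hH]
    | succ k ih =>
      intro hk
      have hk' : k ≤ n + 1 := by omega
      have hr : HasLog (fun z => φ (H (k + 1) z) / φ (H k z)) S := by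
        refine hasLog_of_near_one ((hφH _ hk).div (hφH _ hk') fun z hz => h0 _ (hHS _ hk' z hz)) ?_
        intro z hz
        have hne := h0 _ (hHS k hk' z hz)
        rw [div_sub_one hne, norm_div, div_lt_one (norm_pos_iff.2 hne), ← dist_eq_norm]
        refine lt_of_lt_of_le (hu _ (hHS _ hk z hz) _ (hHS _ hk' z hz) ?_)
          (hmin (hHS k hk' z hz))
        have e : H (k + 1) z - H k z = (1 / (n + 1) : ℝ) • (z - z0) := by
          simp only [hH]; rw [add_sub_add_left_eq_sub, ← sub_smul]; congr 1; push_cast; ring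
        rw [dist_eq_norm, e, norm_smul, Real.norm_of_nonneg (by positivity)]
        have h2 : ‖z - z0‖ ≤ 2 * B := by linarith [norm_sub_le z z0, hB z hz, hB z0 hz0]
        rw [div_lt_iff₀ hδ] at hn
        rw [one_div, inv_mul_lt_iff₀ hn0]
        nlinarith
      refine ((ih hk').mul hr).congr fun z hz => ?_
      rw [mul_div_cancel₀ _ (h0 _ (hHS k hk' z hz))]
  refine (key (n + 1) le_rfl).congr fun z _ => ?_
  simp only [hH]
  congr 1
  push_cast
  rw [div_self hn0.ne', one_smul]; abel

lemma exists_continuous_extension {E : Type*} [TopologicalSpace E] [NormalSpace E] {S : Set E}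
    (hS : IsClosed S) {g : E → ℂ} (hg : ContinuousOn g S) :
    ∃ G : E → ℂ, Continuous G ∧ ∀ z ∈ S, G z = g z := by
  obtain ⟨G, hG⟩ := ContinuousMap.exists_restrict_eq hS ⟨fun z : S => g z, hg.domRestrict⟩
  exact ⟨G, G.continuous, fun z hz => congrArg (fun F : C(S, ℂ) => F ⟨z, hz⟩) hG⟩

/-- Radius of the square of half side `r` in direction `θ`. -/
def sqRad (r θ : ℝ) : ℝ := r / max |Real.cos θ| |Real.sin θ|

lemma max_cos_sin_pos (θ : ℝ) : 0 < max |Real.cos θ| |Real.sin θ| := by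
  by_contra h
  have h1 : |Real.cos θ| ≤ 0 := (le_max_left _ _).trans (not_lt.1 h)
  have h2 : |Real.sin θ| ≤ 0 := (le_max_right _ _).trans (not_lt.1 h)
  have e1 := abs_nonpos_iff.1 h1
  have e2 := abs_nonpos_iff.1 h2
  have := Real.sin_sq_add_cos_sq θ
  rw [e1, e2] at this
  norm_num at this

lemma sqRad_pos {r : ℝ} (hr : 0 < r) (θ : ℝ) : 0 < sqRad r θ := div_pos hr (max_cos_sin_pos θ)

lemma continuous_sqRad (r : ℝ) : Continuous (sqRad r) := by
  unfold sqRad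
  refine continuous_const.div ?_ fun θ => (max_cos_sin_pos θ).ne'
  fun_prop

/-- Radial parametrization of the square with centre `c` and half side `r`. -/
def sqPar (c : ℂ) (r θ : ℝ) : ℂ := c + sqRad r θ * Complex.exp (θ * Complex.I)

lemma continuous_sqPar (c : ℂ) (r : ℝ) : Continuous (sqPar c r) := by
  unfold sqPar
  have := continuous_sqRad r
  fun_prop

lemma sqPar_re (c : ℂ) (r θ : ℝ) : (sqPar c r θ).re = c.re + sqRad r θ * Real.cos θ := by
  simp [sqPar, Complex.exp_ofReal_mul_I_re, Complex.exp_ofReal_mul_I_im]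
lemma sqPar_im (c : ℂ) (r θ : ℝ) : (sqPar c r θ).im = c.im + sqRad r θ * Real.sin θ := by
  simp [sqPar, Complex.exp_ofReal_mul_I_re, Complex.exp_ofReal_mul_I_im]

lemma sqPar_add_two_pi (c : ℂ) (r θ : ℝ) : sqPar c r (θ + 2 * Real.pi) = sqPar c r θ := by
  apply Complex.ext
  · simp [sqPar_re, sqRad]
  · simp [sqPar_im, sqRad]

/-- The centre of a square. -/
def sqCtr (a b s : ℝ) : ℂ := ⟨a + s / 2, b + s / 2⟩

lemma mem_sqb_iff {a b s : ℝ} {z : ℂ} :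
    z ∈ sqb a b s ↔ max |z.re - (sqCtr a b s).re| |z.im - (sqCtr a b s).im| = s / 2 := by
  simp only [sqb, csq, osq, mem_sdiff, Set.mem_ofPred_eq, sqCtr]
  constructor
  · rintro ⟨⟨⟨h1, h2⟩, h3, h4⟩, h5⟩
    apply le_antisymm
    · exact max_le (abs_le.2 ⟨by linarith, by linarith⟩) (abs_le.2 ⟨by linarith, by linarith⟩)
    · by_contra h
      rw [not_le, max_lt_iff, abs_lt, abs_lt] at h
      exact h5 ⟨⟨by linarith, by linarith⟩, by linarith, by linarith⟩
  · intro h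
    have h1 := (le_max_left _ _).trans h.le
    have h2 := (le_max_right _ _).trans h.le
    rw [abs_le] at h1 h2
    refine ⟨⟨⟨by linarith, by linarith⟩, by linarith, by linarith⟩, ?_⟩
    rintro ⟨⟨h3, h4⟩, h5, h6⟩
    refine absurd h (ne_of_lt (max_lt (abs_lt.2 ⟨by linarith, by linarith⟩)
      (abs_lt.2 ⟨by linarith, by linarith⟩)))

lemma sqPar_mem {a b s : ℝ} (hs : 0 < s) (θ : ℝ) :
    sqPar (sqCtr a b s) (s / 2) θ ∈ sqb a b s := by
  rw [mem_sqb_iff, sqPar_re, sqPar_im, add_sub_cancel_left, add_sub_cancel_left, abs_mul, abs_mul,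
    ← mul_max_of_nonneg _ _ (abs_nonneg _), abs_of_pos (sqRad_pos (by linarith) θ), sqRad,
    div_mul_cancel₀ _ (max_cos_sin_pos θ).ne']

lemma eq_sqPar {a b s : ℝ} (hs : 0 < s) {z : ℂ} (hz : z ∈ sqb a b s) {θ : ℝ}
    (hθ : (θ : Real.Angle) = (Complex.arg (z - sqCtr a b s) : Real.Angle)) :
    z = sqPar (sqCtr a b s) (s / 2) θ := by
  rw [mem_sqb_iff] at hz
  set c := sqCtr a b s
  set ρ := ‖z - c‖
  have e : z - c = ρ * Complex.exp (θ * Complex.I) := by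
    have hc : Real.cos θ = Real.cos (Complex.arg (z - c)) := by
      rw [← Real.Angle.cos_coe, hθ, Real.Angle.cos_coe]
    have hsn : Real.sin θ = Real.sin (Complex.arg (z - c)) := by
      rw [← Real.Angle.sin_coe, hθ, Real.Angle.sin_coe]
    have := (Complex.norm_mul_exp_arg_mul_I (z - c)).symm
    rw [this]
    congr 1
    rw [Complex.exp_mul_I, Complex.exp_mul_I, ← Complex.ofReal_cos, ← Complex.ofReal_cos,
      ← Complex.ofReal_sin, ← Complex.ofReal_sin, hc, hsn]
  have h1 : z.re - c.re = ρ * Real.cos θ := by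
    have := congrArg Complex.re e
    simpa [Complex.exp_ofReal_mul_I_re] using this
  have h2 : z.im - c.im = ρ * Real.sin θ := by
    have := congrArg Complex.im e
    simpa [Complex.exp_ofReal_mul_I_im] using this
  have hρ : ρ = sqRad (s / 2) θ := by
    rw [h1, h2, abs_mul, abs_mul, ← mul_max_of_nonneg _ _ (abs_nonneg _),
      abs_of_nonneg (norm_nonneg _)] at hz
    rw [sqRad, ← hz, mul_div_cancel_right₀ _ (max_cos_sin_pos θ).ne']
  rw [sqPar, ← hρ, ← e]; ring

/-- The logarithm of `z - c` along the parametrization. -/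
def sqLog (r θ : ℝ) : ℂ := Real.log (sqRad r θ) + θ * Complex.I

lemma continuous_sqLog {r : ℝ} (hr : 0 < r) : Continuous (sqLog r) := by
  unfold sqLog
  have : Continuous fun θ => Real.log (sqRad r θ) :=
    (continuous_sqRad r).log fun θ => (sqRad_pos hr θ).ne'
  fun_prop

lemma exp_sqLog (c : ℂ) {r : ℝ} (hr : 0 < r) (θ : ℝ) :
    Complex.exp (sqLog r θ) = sqPar c r θ - c := by
  rw [sqLog, Complex.exp_add, ← Complex.ofReal_exp, Real.exp_log (sqRad_pos hr θ), sqPar]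
  ring

lemma sqb_sub_ctr_ne {a b s : ℝ} (hs : 0 < s) {z : ℂ} (hz : z ∈ sqb a b s) :
    z - sqCtr a b s ≠ 0 := by
  intro h
  rw [mem_sqb_iff, ← Complex.sub_re, ← Complex.sub_im, h] at hz
  simp at hz; linarith

lemma not_hasLog_sub_ctr {a b s : ℝ} (hs : 0 < s) :
    ¬ HasLog (fun z => z - sqCtr a b s) (sqb a b s) := by
  rintro ⟨g, hg, e⟩
  have hr : 0 < s / 2 := by linarith
  set P := sqPar (sqCtr a b s) (s / 2) with hP
  have hgc : Continuous fun θ => g (P θ) :=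
    hg.comp_continuous (continuous_sqPar _ _) fun θ => sqPar_mem hs θ
  set k : ℝ → ℝ := fun θ => ((g (P θ)).im - θ) / (2 * Real.pi) with hk
  have hkc : Continuous k := by
    have := Complex.continuous_im.comp hgc
    simp only [Function.comp_def] at this
    fun_prop
  have hpi := Real.pi_pos
  have hkint : ∀ θ, ∃ n : ℤ, k θ = n := by
    intro θ
    have h1 := e (P θ) (sqPar_mem hs θ)
    simp only [hP] at h1
    rw [← exp_sqLog _ hr, Complex.exp_eq_exp_iff_exists_int] at h1
    obtain ⟨n, hn⟩ := h1
    refine ⟨-n, ?_⟩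
    have h2 := congrArg Complex.im hn
    simp [sqLog] at h2
    simp only [hk, hP]
    rw [div_eq_iff (by positivity)]; push_cast; linarith
  have h02 : k (2 * Real.pi) = k 0 - 1 := by
    have : P (2 * Real.pi) = P 0 := by
      have := sqPar_add_two_pi (sqCtr a b s) (s / 2) 0
      rwa [zero_add] at this
    simp only [hk, this]
    field_simp; ring
  have hmem : k 0 - 1 / 2 ∈ Icc (k (2 * Real.pi)) (k 0) := ⟨by linarith, by linarith⟩
  obtain ⟨θ, -, hθ⟩ := intermediate_value_Icc' (by positivity : (0 : ℝ) ≤ 2 * Real.pi)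
    hkc.continuousOn hmem
  obtain ⟨n, hn⟩ := hkint θ
  obtain ⟨m, hm⟩ := hkint 0
  rw [hn, hm] at hθ
  have : (2 * n : ℝ) = 2 * m - 1 := by linarith
  have h3 : (2 * n : ℤ) = 2 * m - 1 := by exact_mod_cast this
  omega

lemma exists_zpow_mul_exp {a b s : ℝ} (hs : 0 < s) {φ : ℂ → ℂ} (hφ : ContinuousOn φ (sqb a b s))
    (h0 : ∀ z ∈ sqb a b s, φ z ≠ 0) :
    ∃ n : ℤ, HasLog (fun z => φ z / (z - sqCtr a b s) ^ n) (sqb a b s) := by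
  have hr : 0 < s / 2 := by linarith
  have hpi := Real.pi_pos
  set c := sqCtr a b s with hc
  set P := sqPar c (s / 2) with hP
  have hφP : Continuous fun θ => φ (P θ) :=
    hφ.comp_continuous (continuous_sqPar _ _) fun θ => sqPar_mem hs θ
  obtain ⟨G, hG, hGe⟩ := hasLog_of_convex (convex_Icc (0 : ℝ) (2 * Real.pi)) isCompact_Icc
    hφP.continuousOn fun θ _ => h0 _ (sqPar_mem hs θ)
  have hP2 : P (2 * Real.pi) = P 0 := by
    have := sqPar_add_two_pi c (s / 2) 0
    rwa [zero_add] at this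
  have hG2 : Complex.exp (G (2 * Real.pi)) = Complex.exp (G 0) := by
    rw [← hGe _ ⟨by positivity, le_rfl⟩, ← hGe _ ⟨le_rfl, by positivity⟩]
    simp only [hP2]
  obtain ⟨n, hn⟩ := Complex.exp_eq_exp_iff_exists_int.1 hG2
  refine ⟨n, ?_⟩
  set H : ℝ → ℂ := fun θ => G θ - n * sqLog (s / 2) θ with hH
  have hHc : ContinuousOn H (Icc 0 (2 * Real.pi)) :=
    hG.sub (continuous_const.mul (continuous_sqLog hr)).continuousOn
  have hH2 : H 0 = H (2 * Real.pi) := by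
    simp only [hH, hn, sqLog, sqRad]
    simp; ring
  haveI : Fact (0 < 2 * Real.pi) := ⟨by positivity⟩
  have hL : Continuous (AddCircle.liftIco (2 * Real.pi) 0 H) :=
    AddCircle.liftIco_zero_continuous hH2 hHc
  refine ⟨fun z => AddCircle.liftIco (2 * Real.pi) 0 H (Complex.arg (z - c) : Real.Angle), ?_, ?_⟩
  · refine hL.comp_continuousOn ?_
    intro z hz
    have h1 := Complex.continuousAt_arg_coe_angle (sqb_sub_ctr_ne hs hz)
    have h2 : ContinuousAt (fun z : ℂ => z - c) z := by fun_prop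
    exact (ContinuousAt.comp (f := fun z : ℂ => z - c) h1 h2).continuousWithinAt
  · intro z hz
    have hne := sqb_sub_ctr_ne hs hz
    obtain ⟨θ, hθ, hθe⟩ : ∃ θ ∈ Ico 0 (2 * Real.pi),
        (θ : Real.Angle) = (Complex.arg (z - c) : Real.Angle) := by
      refine ⟨toIcoMod (by positivity : (0 : ℝ) < 2 * Real.pi) 0 (Complex.arg (z - c)), ?_, ?_⟩
      · have := toIcoMod_mem_Ico (by positivity : (0 : ℝ) < 2 * Real.pi) 0 (Complex.arg (z - c))
        rwa [zero_add] at this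
      · exact Real.Angle.coe_toIcoMod _ _
    have hz2 := eq_sqPar hs hz hθe
    have e1 : AddCircle.liftIco (2 * Real.pi) 0 H (Complex.arg (z - c) : Real.Angle) = H θ := by
      rw [← hθe]
      exact AddCircle.liftIco_coe_apply (by rwa [zero_add])
    refine Eq.trans ?_ (congrArg Complex.exp e1.symm)
    simp only [hH]
    rw [Complex.exp_sub, Complex.exp_int_mul, exp_sqLog c hr, ← hGe θ ⟨hθ.1, hθ.2.le⟩]
    simp only [hP]
    rw [← hc] at hz2
    rw [← hz2]

end

end Carpet

namespace Carpet

noncomputable section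

lemma convex_csq (a b s : ℝ) : Convex ℝ (csq a b s) := by
  have e : csq a b s = Complex.reCLM ⁻¹' Icc a (a + s) ∩ Complex.imCLM ⁻¹' Icc b (b + s) := by
    ext z; simp [csq]
  rw [e]
  exact ((convex_Icc _ _).linear_preimage Complex.reCLM.toLinearMap).inter
    ((convex_Icc _ _).linear_preimage Complex.imCLM.toLinearMap)

lemma convex_osq (a b s : ℝ) : Convex ℝ (osq a b s) := by
  have e : osq a b s = Complex.reCLM ⁻¹' Ioo a (a + s) ∩ Complex.imCLM ⁻¹' Ioo b (b + s) := by
    ext z; simp [osq]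
  rw [e]
  exact ((convex_Ioo _ _).linear_preimage Complex.reCLM.toLinearMap).inter
    ((convex_Ioo _ _).linear_preimage Complex.imCLM.toLinearMap)

lemma sqCtr_mem_osq {a b s : ℝ} (hs : 0 < s) : sqCtr a b s ∈ osq a b s := by
  refine ⟨⟨?_, ?_⟩, ?_, ?_⟩ <;> simp only [sqCtr] <;> linarith

lemma mem_osq_iff {a b s : ℝ} {z : ℂ} :
    z ∈ osq a b s ↔ max |z.re - (sqCtr a b s).re| |z.im - (sqCtr a b s).im| < s / 2 := by
  simp only [osq, Set.mem_ofPred_eq, sqCtr, max_lt_iff, abs_lt]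
  constructor
  · rintro ⟨⟨h1, h2⟩, h3, h4⟩
    exact ⟨⟨by linarith, by linarith⟩, by linarith, by linarith⟩
  · rintro ⟨⟨h1, h2⟩, h3, h4⟩
    exact ⟨⟨by linarith, by linarith⟩, by linarith, by linarith⟩

lemma mem_csq_iff {a b s : ℝ} {z : ℂ} :
    z ∈ csq a b s ↔ max |z.re - (sqCtr a b s).re| |z.im - (sqCtr a b s).im| ≤ s / 2 := by
  simp only [csq, Set.mem_ofPred_eq, sqCtr, max_le_iff, abs_le]
  constructor
  · rintro ⟨⟨h1, h2⟩, h3, h4⟩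
    exact ⟨⟨by linarith, by linarith⟩, by linarith, by linarith⟩
  · rintro ⟨⟨h1, h2⟩, h3, h4⟩
    exact ⟨⟨by linarith, by linarith⟩, by linarith, by linarith⟩

/-- Boundary points of a square are approximated by scaling from the centre. -/
lemma exists_scaled {a b s : ℝ} (hs : 0 < s) {z : ℂ} (hz : z ∈ sqb a b s) {ε : ℝ} (hε : 0 < ε) :
    (∃ z' ∈ osq a b s, dist z z' < ε) ∧ ∃ z', z' ∉ csq a b s ∧ dist z z' < ε := by
  set c := sqCtr a b s with hc
  rw [mem_sqb_iff] at hz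
  have key : ∀ t : ℝ, 0 ≤ t → max |(c + t * (z - c)).re - c.re| |(c + t * (z - c)).im - c.im|
      = t * (s / 2) := by
    intro t ht
    rw [← hz, mul_max_of_nonneg _ _ ht]
    simp [abs_mul, abs_of_nonneg ht, hc]
  have hd : ∀ t : ℝ, dist z (c + t * (z - c)) = |1 - t| * ‖z - c‖ := by
    intro t
    rw [Complex.dist_eq, show z - (c + t * (z - c)) = ((1 - t : ℝ) : ℂ) * (z - c) by push_cast; ring,
      norm_mul, Complex.norm_real, Real.norm_eq_abs]
  set M := ‖z - c‖ + 1 with hM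
  have hMp : 0 < M := by positivity
  set q := min (ε / M) 1 / 2 with hq
  have hq0 : 0 < q := by positivity
  have hq1 : q ≤ 1 / 2 := by
    have := min_le_right (ε / M) 1; linarith
  have hqε : q * ‖z - c‖ < ε := by
    have h1 : q < ε / M := by
      have := min_le_left (ε / M) 1
      have : 0 < ε / M := by positivity
      have : 0 < min (ε / M) 1 := by positivity
      linarith
    rw [lt_div_iff₀ hMp] at h1
    have : q * M = q * ‖z - c‖ + q := by rw [hM]; ring
    linarith
  refine ⟨⟨c + ((1 - q : ℝ) : ℂ) * (z - c), ?_, ?_⟩, ⟨c + ((1 + q : ℝ) : ℂ) * (z - c), ?_, ?_⟩⟩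
  · rw [mem_osq_iff, key _ (by linarith)]
    nlinarith
  · rw [hd]; rwa [show (1 : ℝ) - (1 - q) = q by ring, abs_of_pos hq0]
  · rw [mem_csq_iff, key _ (by linarith)]
    nlinarith
  · rw [hd]; rwa [show (1 : ℝ) - (1 + q) = -q by ring, abs_neg, abs_of_pos hq0]

lemma HasLog.sub_of_lt {J : Set ℂ} {a b : ℂ} (h : HasLog (fun z => z - a) J)
    (hab : ∀ z ∈ J, dist a b < dist z a) : HasLog (fun z => z - b) J := by
  have hne : ∀ z ∈ J, z - a ≠ 0 := fun z hz h0 => by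
    have := hab z hz
    rw [dist_eq_norm z a, h0, norm_zero] at this
    exact absurd this (not_lt.2 dist_nonneg)
  have h1 : HasLog (fun z => (z - b) / (z - a)) J := by
    apply hasLog_of_near_one
    · exact (by fun_prop : ContinuousOn (fun z : ℂ => z - b) J).div (by fun_prop) hne
    · intro z hz
      have := hab z hz
      rw [dist_eq_norm, dist_eq_norm] at this
      rw [show (z - b) / (z - a) - 1 = (a - b) / (z - a) by
        rw [div_sub_one (hne z hz)]; congr 1; ring, norm_div]
      exact (div_lt_one (norm_pos_iff.2 (hne z hz))).2 this
  exact (h1.mul h).congr fun z hz => (div_mul_cancel₀ _ (hne z hz)).symm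

lemma hasLog_locally_const {J : Set ℂ} (hJ : IsCompact J) {a : ℂ} (ha : a ∉ J) :
    ∃ ε > 0, ∀ b, dist a b < ε →
      b ∉ J ∧ (HasLog (fun z => z - b) J ↔ HasLog (fun z => z - a) J) := by
  obtain ⟨r, hr, hsub⟩ := Metric.isOpen_iff.1 hJ.isClosed.isOpen_compl a ha
  have hfar : ∀ z ∈ J, r ≤ dist z a := fun z hz => by
    by_contra hlt
    exact hsub (mem_ball.2 (not_le.1 hlt)) hz
  refine ⟨r / 2, by positivity, fun b hb => ⟨fun hbJ => ?_, fun h => ?_, fun h => ?_⟩⟩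
  · have := hfar b hbJ
    rw [dist_comm] at this; linarith
  · apply h.sub_of_lt
    intro z hz
    have := hfar z hz
    have h2 := dist_triangle z b a
    rw [dist_comm b a] at h2 ⊢
    linarith
  · apply h.sub_of_lt
    intro z hz
    have := hfar z hz
    linarith

lemma hasLog_preconnected {J T : Set ℂ} (hJ : IsCompact J) (hT : IsPreconnected T)
    (hTJ : Disjoint T J) {a b : ℂ} (ha : a ∈ T) (hb : b ∈ T)
    (h : HasLog (fun z => z - a) J) : HasLog (fun z => z - b) J := by
  have ho : ∀ q : Prop, IsOpen {c : ℂ | c ∉ J ∧ (HasLog (fun z => z - c) J ↔ q)} := by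
    intro q
    rw [Metric.isOpen_iff]
    rintro c ⟨hc, hq⟩
    obtain ⟨ε, hε, h⟩ := hasLog_locally_const hJ hc
    refine ⟨ε, hε, fun d hd => ?_⟩
    rw [mem_ball, dist_comm] at hd
    exact ⟨(h d hd).1, (h d hd).2.trans hq⟩
  have hnot : ∀ c ∈ T, c ∉ J := fun c hc hcJ => Set.disjoint_left.1 hTJ hc hcJ
  have := hT.subset_left_of_subset_union (ho True) (ho False) ?_ ?_ ⟨a, ha, hnot a ha, by simpa⟩
  · exact (this hb).2.2 trivial
  · rw [Set.disjoint_left]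
    rintro c ⟨-, h1⟩ ⟨-, h2⟩
    exact h2.1 (h1.2 trivial)
  · intro c hc
    by_cases h1 : HasLog (fun z => z - c) J
    · exact Or.inl ⟨hnot c hc, by simpa⟩
    · exact Or.inr ⟨hnot c hc, by simpa⟩

variable {p : ℕ}

/-- Centre of a hole. -/
def hctr (w : Word p) : ℂ := sqCtr (hx w) (hy w) (hs w)

section
variable [OddBase p]

lemma hctr_mem_hole (w : Word p) : hctr w ∈ hole w := sqCtr_mem_osq (hs_pos w)

lemma hasLog_off_holes (W : Finset (Word p)) : ∀ {φ : ℂ → ℂ} {J : Set ℂ},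
    ContinuousOn φ (csq 0 0 1 \ ⋃ w ∈ W, hole w) →
    (∀ z ∈ csq 0 0 1 \ ⋃ w ∈ W, hole w, φ z ≠ 0) → J ⊆ csq 0 0 1 \ ⋃ w ∈ W, hole w →
    (∀ w ∈ W, HasLog (fun z => z - hctr w) J) → HasLog φ J := by
  classical
  induction W using Finset.induction_on with
  | empty =>
    intro φ J hφ h0 hJ _
    simp only [Finset.notMem_empty, iUnion_of_empty, iUnion_empty, sdiff_empty] at hφ h0 hJ
    exact (hasLog_of_convex (convex_csq 0 0 1) (isCompact_csq 0 0 1) hφ h0).mono hJ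
  | insert w W hw ih =>
    intro φ J hφ h0 hJ hlog
    have hD : csq 0 0 1 \ ⋃ v ∈ insert w W, hole v = (csq 0 0 1 \ ⋃ v ∈ W, hole v) \ hole w := by
      ext z
      simp only [Finset.mem_insert, mem_sdiff, mem_iUnion, exists_prop, not_exists, not_and]
      constructor
      · rintro ⟨h1, h2⟩
        exact ⟨⟨h1, fun v hv => h2 v (Or.inr hv)⟩, h2 w (Or.inl rfl)⟩
      · rintro ⟨⟨h1, h2⟩, h3⟩
        refine ⟨h1, ?_⟩
        rintro v (rfl | hv)
        · exact h3
        · exact h2 v hv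
    rw [hD] at hφ h0 hJ
    set D := csq 0 0 1 \ ⋃ v ∈ W, hole v with hDdef
    have hDc : IsClosed D := by
      rw [hDdef, sdiff_eq]
      exact (isClosed_csq 0 0 1).inter
        (isOpen_biUnion fun v _ => isOpen_osq _ _ _).isClosed_compl
    have hcw : circ (some w) ⊆ D \ hole w := by
      intro z hz
      have hzc := mem_carpet.1 (circ_subset_carpet _ hz)
      refine ⟨⟨hzc.1, ?_⟩, hzc.2 w⟩
      simp only [mem_iUnion, not_exists]
      exact fun v _ => hzc.2 v
    obtain ⟨n, g, hg, hge⟩ := exists_zpow_mul_exp (hs_pos w) (hφ.mono hcw)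
      fun z hz => h0 z (hcw hz)
    obtain ⟨G, hG, hGe⟩ := exists_continuous_extension (isCompact_circ (some w)).isClosed hg
    have hne : ∀ z, z ∉ hole w → z - hctr w ≠ 0 := fun z hz h => by
      rw [sub_eq_zero] at h
      exact hz (h ▸ hctr_mem_hole w)
    set ψ : ℂ → ℂ := fun z => if z ∈ hole w then Complex.exp (G z) else φ z / (z - hctr w) ^ n
      with hψ
    have e1 : ∀ z ∈ D \ hole w, ψ z = φ z / (z - hctr w) ^ n := fun z hz => if_neg hz.2
    have e2 : ∀ z ∈ D ∩ chole w, ψ z = Complex.exp (G z) := by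
      rintro z ⟨-, hz⟩
      by_cases h : z ∈ hole w
      · exact if_pos h
      · simp only [hψ, if_neg h]
        rw [hGe z ⟨hz, h⟩]
        exact hge z ⟨hz, h⟩
    have hDu : D = (D \ hole w) ∪ (D ∩ chole w) := by
      ext z
      constructor
      · intro hz
        by_cases h : z ∈ hole w
        · exact Or.inr ⟨hz, hole_subset_chole _ h⟩
        · exact Or.inl ⟨hz, h⟩
      · rintro (h | h) <;> exact h.1
    have hψc : ContinuousOn ψ D := by
      rw [hDu]
      apply ContinuousOn.union_of_isClosed
      · refine ContinuousOn.congr ?_ e1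
        refine hφ.div (ContinuousOn.zpow₀ (by fun_prop) n fun z hz => Or.inl (hne z hz.2)) ?_
        exact fun z hz => zpow_ne_zero _ (hne z hz.2)
      · exact (hG.cexp).continuousOn.congr e2
      · rw [sdiff_eq]; exact hDc.inter (isOpen_osq _ _ _).isClosed_compl
      · exact hDc.inter (isClosed_csq _ _ _)
    have hψ0 : ∀ z ∈ D, ψ z ≠ 0 := by
      intro z hz
      by_cases h : z ∈ hole w
      · simp only [hψ, if_pos h]; exact Complex.exp_ne_zero _
      · simp only [hψ, if_neg h]
        exact div_ne_zero (h0 z ⟨hz, h⟩) (zpow_ne_zero _ (hne z h))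
    have h3 := ih hψc hψ0 (fun z hz => (hJ hz).1) fun v hv => hlog v (Finset.mem_insert_of_mem hv)
    refine (h3.mul ((hlog w (Finset.mem_insert_self _ _)).zpow n)).congr fun z hz => ?_
    simp only [e1 z (hJ hz)]
    rw [div_mul_cancel₀ _ (zpow_ne_zero _ (hne z (hJ hz).2))]

lemma hasLog_of_carpet {φ : ℂ → ℂ} {J : Set ℂ} (hφ : ContinuousOn φ (sierpinskiCarpet p))
    (h0 : ∀ z ∈ sierpinskiCarpet p, φ z ≠ 0) (hJ : J ⊆ sierpinskiCarpet p)
    (hlog : ∀ w : Word p, HasLog (fun z => z - hctr w) J) : HasLog φ J := by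
  obtain ⟨Φ, hΦ, hΦe⟩ := exists_continuous_extension isCompact_carpet.isClosed hφ
  have hZ : IsCompact (csq 0 0 1 ∩ Φ ⁻¹' {0}) :=
    (isCompact_csq 0 0 1).inter_right (isClosed_singleton.preimage hΦ)
  obtain ⟨W, hW⟩ := hZ.elim_finite_subcover (fun w : Word p => hole w)
    (fun w => isOpen_osq _ _ _) (by
      rintro z ⟨hz, hz0⟩
      by_contra h
      simp only [mem_iUnion, not_exists] at h
      have hc := mem_carpet.2 ⟨hz, h⟩
      exact h0 z hc (by rw [← hΦe z hc]; exact hz0))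
  have hJW : J ⊆ csq 0 0 1 \ ⋃ w ∈ W, hole w := by
    intro z hz
    have := mem_carpet.1 (hJ hz)
    refine ⟨this.1, ?_⟩
    simp only [mem_iUnion, not_exists]
    exact fun v _ => this.2 v
  have := hasLog_off_holes W (φ := Φ) hΦ.continuousOn ?_ hJW fun w _ => hlog w
  · exact this.congr fun z hz => (hΦe z (hJ hz)).symm
  · intro z hz h
    exact hz.2 (hW ⟨hz.1, h⟩)

/-- Peripheral circles as subsets of the carpet. -/
def circX (i : Option (Word p)) : Set (sierpinskiCarpet p) := (↑) ⁻¹' circ i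

lemma coe_circX (i : Option (Word p)) :
    ((↑) '' circX i : Set ℂ) = circ i := by
  rw [circX, Subtype.image_preimage_coe]
  exact inter_eq_right.2 (circ_subset_carpet i)

lemma circ_nonempty (i : Option (Word p)) : (circ i).Nonempty := by
  cases i with
  | none => exact ⟨0, by simp [circ_none, csq, osq]⟩
  | some w => exact ⟨_, chole_corner⟩

lemma circX_nonempty (i : Option (Word p)) : (circX i).Nonempty := by
  obtain ⟨z, hz⟩ := circ_nonempty i
  exact ⟨⟨z, circ_subset_carpet i hz⟩, hz⟩

lemma circX_eq_of_subset {i j : Option (Word p)} (h : circX i ⊆ circX j) : i = j := by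
  by_contra hij
  obtain ⟨z, hz⟩ := circX_nonempty i
  exact Set.disjoint_left.1 (circ_disjoint hij) hz (h hz)

lemma exists_circX_subset (f : sierpinskiCarpet p ≃ₜ sierpinskiCarpet p) (i : Option (Word p)) :
    ∃ k, circX k ⊆ f '' circX i := by
  classical
  set J : Set ℂ := (↑) '' (f '' circX i) with hJdef
  have hcX : IsCompact (circX i) := by
    rw [Subtype.isCompact_iff, coe_circX]
    exact isCompact_circ i
  have hJ : IsCompact J := (hcX.image f.continuous).image continuous_subtype_val
  have hJS : J ⊆ sierpinskiCarpet p := by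
    rintro _ ⟨z, -, rfl⟩; exact z.2
  have hsuff : ∀ k, circ k ⊆ J → circX k ⊆ f '' circX i := by
    intro k hk z hz
    obtain ⟨z', hz', e⟩ := hk hz
    rwa [← Subtype.ext e]
  obtain ⟨a, b, s, hs, hci, hca⟩ : ∃ a b s, 0 < s ∧ circ i = sqb a b s ∧
      sqCtr a b s ∉ sierpinskiCarpet p := by
    cases i with
    | none =>
      refine ⟨0, 0, 1, one_pos, rfl, fun h => (mem_carpet.1 h).2 [] ?_⟩
      have h1 := hctr_mem_hole ([] : Word p)
      have h2 := two_hx ([] : Word p)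
      have h3 := two_hy ([] : Word p)
      simp only [cx_nil, cy_nil, sc_nil] at h2 h3
      convert h1 using 1
      simp only [hctr, sqCtr]
      congr 1 <;> linarith
    | some w => exact ⟨_, _, _, hs_pos w, rfl, fun h => (mem_carpet.1 h).2 w (hctr_mem_hole w)⟩
  set φ : ℂ → ℂ := fun z =>
    if h : z ∈ sierpinskiCarpet p then (f.symm ⟨z, h⟩ : ℂ) - sqCtr a b s else 1 with hφdef
  have hφe : ∀ z : sierpinskiCarpet p, φ z = (f.symm z : ℂ) - sqCtr a b s := fun z => by
    simp [hφdef]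
  have hφ : ContinuousOn φ (sierpinskiCarpet p) := by
    rw [continuousOn_iff_continuous_domRestrict]
    have : (sierpinskiCarpet p).domRestrict φ = fun z => (f.symm z : ℂ) - sqCtr a b s :=
      funext hφe
    rw [this]
    have := f.symm.continuous
    fun_prop
  have hφ0 : ∀ z ∈ sierpinskiCarpet p, φ z ≠ 0 := by
    intro z hz h
    have := hφe ⟨z, hz⟩
    simp only at this
    rw [h, eq_comm, sub_eq_zero] at this
    exact hca (this ▸ (f.symm ⟨z, hz⟩).2)
  have hnolog : ¬ HasLog φ J := by
    rintro ⟨g, hg, hge⟩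
    apply not_hasLog_sub_ctr hs (a := a) (b := b)
    set F : ℂ → ℂ := fun z => if h : z ∈ sierpinskiCarpet p then (f ⟨z, h⟩ : ℂ) else 0 with hF
    have hFe : ∀ z : sierpinskiCarpet p, F z = f z := fun z => by simp [hF]
    have hFc : ContinuousOn F (sierpinskiCarpet p) := by
      rw [continuousOn_iff_continuous_domRestrict]
      have : (sierpinskiCarpet p).domRestrict F = fun z => (f z : ℂ) := funext hFe
      rw [this]
      have := f.continuous
      fun_prop
    have hFJ : ∀ z ∈ circ i, F z ∈ J := by
      intro z hz
      have := hFe ⟨z, circ_subset_carpet i hz⟩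
      simp only at this
      rw [this]
      exact ⟨_, ⟨_, hz, rfl⟩, rfl⟩
    rw [← hci]
    refine ⟨g ∘ F, hg.comp (hFc.mono (circ_subset_carpet i)) hFJ, fun z hz => ?_⟩
    rw [Function.comp_apply, ← hge _ (hFJ z hz)]
    have h1 := hFe ⟨z, circ_subset_carpet i hz⟩
    simp only at h1
    rw [h1, hφe, f.symm_apply_apply]
  obtain ⟨v, hv⟩ : ∃ v : Word p, ¬ HasLog (fun z => z - hctr v) J := by
    by_contra! h
    exact hnolog (hasLog_of_carpet hφ hφ0 hJS h)
  have hhole : ∀ z ∈ hole v, ¬ HasLog (fun z' => z' - z) J := by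
    intro z hz h
    refine hv (hasLog_preconnected hJ (convex_osq _ _ _).isPreconnected ?_ hz (hctr_mem_hole v) h)
    rw [Set.disjoint_left]
    exact fun c hc hcJ => (mem_carpet.1 (hJS hcJ)).2 v hc
  have hout : ∀ z, z ∉ csq 0 0 1 → HasLog (fun z' => z' - z) J := by
    intro z hz
    refine (hasLog_of_convex (convex_csq 0 0 1) (isCompact_csq 0 0 1) (by fun_prop) ?_).mono
      (hJS.trans carpet_subset_unit)
    intro z' hz' h
    rw [sub_eq_zero] at h
    exact hz (h ▸ hz')
  have hT : IsPreconnected (sierpinskiCarpet p \ J) := by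
    have e : sierpinskiCarpet p \ J = (↑) '' (f '' (circX i)ᶜ) := by
      ext z
      constructor
      · rintro ⟨hz, hzJ⟩
        refine ⟨⟨z, hz⟩, ⟨f.symm ⟨z, hz⟩, fun h => hzJ ⟨⟨z, hz⟩, ⟨_, h, by simp⟩, rfl⟩, by simp⟩, rfl⟩
      · rintro ⟨_, ⟨u, hu, rfl⟩, rfl⟩
        refine ⟨(f u).2, ?_⟩
        rintro ⟨_, ⟨u', hu', rfl⟩, e⟩
        rw [f.injective (Subtype.ext e)] at hu'
        exact hu hu'
    rw [e]
    refine IsPreconnected.image (IsPreconnected.image ?_ _ f.continuous.continuousOn) _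
      continuous_subtype_val.continuousOn
    have h1 := isPreconnected_carpet_diff_circ i
    have h2 : ((↑) '' (circX i)ᶜ : Set ℂ) = sierpinskiCarpet p \ circ i := by
      ext z
      constructor
      · rintro ⟨u, hu, rfl⟩; exact ⟨u.2, hu⟩
      · rintro ⟨hz, hz'⟩; exact ⟨⟨z, hz⟩, hz', rfl⟩
    rw [← h2] at h1
    exact Topology.IsInducing.subtypeVal.isPreconnected_image.1 h1
  have hdis : Disjoint (sierpinskiCarpet p \ J) J := disjoint_sdiff_left
  by_cases hex : ∃ b ∈ sierpinskiCarpet p \ J, HasLog (fun z => z - b) J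
  · obtain ⟨b, hb, hbl⟩ := hex
    refine ⟨some v, hsuff _ fun z hz => ?_⟩
    by_contra hzJ
    have hl := hasLog_preconnected hJ hT hdis hb ⟨circ_subset_carpet _ hz, hzJ⟩ hbl
    obtain ⟨ε, hε, h⟩ := hasLog_locally_const hJ hzJ
    obtain ⟨⟨z', hz', hd⟩, -⟩ := exists_scaled (hs_pos v) hz hε
    exact hhole z' hz' ((h z' hd).2.2 hl)
  · refine ⟨none, hsuff _ fun z hz => ?_⟩
    by_contra hzJ
    obtain ⟨ε, hε, h⟩ := hasLog_locally_const hJ hzJ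
    obtain ⟨-, z', hz', hd⟩ := exists_scaled one_pos hz hε
    exact hex ⟨z, ⟨circ_subset_carpet _ hz, hzJ⟩, (h z' hd).2.1 (hout z' hz')⟩

lemma exists_circX_eq (f : sierpinskiCarpet p ≃ₜ sierpinskiCarpet p) (i : Option (Word p)) :
    ∃ k, f '' circX i = circX k := by
  obtain ⟨k, hk⟩ := exists_circX_subset f i
  obtain ⟨l, hl⟩ := exists_circX_subset f.symm k
  have h1 : f.symm '' circX k ⊆ circX i := by
    rintro _ ⟨z, hz, rfl⟩
    obtain ⟨u, hu, rfl⟩ := hk hz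
    simpa using hu
  obtain rfl := circX_eq_of_subset (hl.trans h1)
  refine ⟨k, Subset.antisymm ?_ hk⟩
  rintro _ ⟨z, hz, rfl⟩
  obtain ⟨u, hu, rfl⟩ := hl hz
  simpa using hu

/-- The permutation of the peripheral circles induced by a homeomorphism. -/
def perm (f : sierpinskiCarpet p ≃ₜ sierpinskiCarpet p) (i : Option (Word p)) : Option (Word p) :=
  (exists_circX_eq f i).choose

lemma image_circX (f : sierpinskiCarpet p ≃ₜ sierpinskiCarpet p) (i : Option (Word p)) :
    f '' circX i = circX (perm f i) := (exists_circX_eq f i).choose_spec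

lemma perm_eq {f : sierpinskiCarpet p ≃ₜ sierpinskiCarpet p} {i j : Option (Word p)}
    (h : f '' circX i = circX j) : perm f i = j :=
  circX_eq_of_subset (by rw [← image_circX, h])

lemma perm_trans (f g : sierpinskiCarpet p ≃ₜ sierpinskiCarpet p) (i : Option (Word p)) :
    perm (f.trans g) i = perm g (perm f i) := by
  apply perm_eq
  rw [show ⇑(f.trans g) = g ∘ f from rfl, image_comp, image_circX, image_circX]

lemma perm_refl (i : Option (Word p)) : perm (Homeomorph.refl (sierpinskiCarpet p)) i = i :=
  perm_eq (by simp)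

lemma perm_symm_perm (f : sierpinskiCarpet p ≃ₜ sierpinskiCarpet p) (i : Option (Word p)) :
    perm f.symm (perm f i) = i := by
  rw [← perm_trans, Homeomorph.self_trans_symm, perm_refl]

lemma perm_perm_symm (f : sierpinskiCarpet p ≃ₜ sierpinskiCarpet p) (i : Option (Word p)) :
    perm f (perm f.symm i) = i := by
  rw [← perm_trans, Homeomorph.symm_trans_self, perm_refl]

/-- The induced permutation as an equivalence. -/
def permEquiv (f : sierpinskiCarpet p ≃ₜ sierpinskiCarpet p) : Option (Word p) ≃ Option (Word p) :=
  ⟨perm f, perm f.symm, perm_symm_perm f, perm_perm_symm f⟩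

lemma mem_circX_perm (f : sierpinskiCarpet p ≃ₜ sierpinskiCarpet p) {i : Option (Word p)}
    {z : sierpinskiCarpet p} : f z ∈ circX (perm f i) ↔ z ∈ circX i := by
  rw [← image_circX, f.injective.mem_set_image]

end

end

end Carpet

namespace Carpet

noncomputable section

/-- Oscillation of a function on a set. -/
def osc {α : Type*} (u : α → ℝ) (D : Set α) : ℝ := diam (u '' D)

section osc
variable {α : Type*} {u v : α → ℝ} {D : Set α}

lemma osc_nonneg (u : α → ℝ) (D : Set α) : 0 ≤ osc u D := diam_nonneg

lemma osc_le {C : ℝ} (hC : 0 ≤ C) (h : ∀ x ∈ D, ∀ y ∈ D, |u x - u y| ≤ C) : osc u D ≤ C := by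
  refine diam_le_of_forall_dist_le hC ?_
  rintro _ ⟨x, hx, rfl⟩ _ ⟨y, hy, rfl⟩
  exact h x hx y hy

lemma osc_eq_zero {c : ℝ} (h : ∀ x ∈ D, u x = c) : osc u D = 0 :=
  le_antisymm (osc_le le_rfl fun x hx y hy => by simp [h x hx, h y hy]) (osc_nonneg _ _)

lemma osc_comp {β : Type*} (u : β → ℝ) (f : α → β) (D : Set α) :
    osc (fun x => u (f x)) D = osc u (f '' D) := by
  rw [osc, osc, image_image]

end osc

section metric
variable {X : Type*} [MetricSpace X] [CompactSpace X]

lemma le_osc {u : X → ℝ} (hu : Continuous u) (D : Set X) {x y : X} (hx : x ∈ D) (hy : y ∈ D) :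
    |u x - u y| ≤ osc u D := by
  have hb : Bornology.IsBounded (u '' D) :=
    ((isCompact_univ.image hu).isBounded).subset (image_mono (subset_univ _))
  exact dist_le_diam_of_mem hb ⟨x, hx, rfl⟩ ⟨y, hy, rfl⟩

lemma osc_le_of_le {u v h : X → ℝ} (hu : Continuous u) (hv : Continuous v) {C : ℝ} (hC : 0 ≤ C)
    {D : Set X} (hle : ∀ x ∈ D, ∀ y ∈ D, |h x - h y| ≤ C * (|u x - u y| + |v x - v y|)) :
    osc h D ≤ C * (osc u D + osc v D) := by
  refine osc_le (by have := osc_nonneg u D; have := osc_nonneg v D; positivity) fun x hx y hy => ?_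
  exact (hle x hx y hy).trans
    (mul_le_mul_of_nonneg_left (add_le_add (le_osc hu D hx hy) (le_osc hv D hx hy)) hC)

/-- Square sums of increments of `u` over separated families of points are bounded. -/
def PK (u : X → ℝ) : Prop :=
  ∀ l : ℝ, ∃ K r₀ : ℝ, 0 < r₀ ∧ ∀ (ι : Type) (s : Finset ι) (x v w : ι → X) (r : ι → ℝ),
    (∀ j ∈ s, 0 ≤ r j ∧ r j < r₀) →
    (∀ j ∈ s, ∀ k ∈ s, j ≠ k → Disjoint (ball (x j) (r j)) (ball (x k) (r k))) →
    (∀ j ∈ s, dist (x j) (v j) ≤ l * r j ∧ dist (x j) (w j) ≤ l * r j) →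
    ∑ j ∈ s, (u (v j) - u (w j)) ^ 2 ≤ K

/-- Weak quasisymmetry with all constants. -/
def WQ (f : X → X) : Prop :=
  ∀ l : ℝ, ∃ c : ℝ, ∀ x v w : X, dist x v ≤ l * dist x w → dist (f x) (f v) ≤ c * dist (f x) (f w)

lemma PK.of_le {u v h : X → ℝ} (hu : PK u) (hv : PK v) {C : ℝ}
    (hle : ∀ x y, |h x - h y| ≤ C * (|u x - u y| + |v x - v y|)) : PK h := by
  intro l
  obtain ⟨K₁, r₁, h₁, H₁⟩ := hu l
  obtain ⟨K₂, r₂, h₂, H₂⟩ := hv l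
  refine ⟨2 * C ^ 2 * (K₁ + K₂), min r₁ r₂, lt_min h₁ h₂, fun ι s x a b r hr hd hl => ?_⟩
  have k1 := H₁ ι s x a b r (fun j hj => ⟨(hr j hj).1, (hr j hj).2.trans_le (min_le_left _ _)⟩) hd hl
  have k2 := H₂ ι s x a b r (fun j hj => ⟨(hr j hj).1, (hr j hj).2.trans_le (min_le_right _ _)⟩) hd hl
  calc ∑ j ∈ s, (h (a j) - h (b j)) ^ 2
      ≤ ∑ j ∈ s, 2 * C ^ 2 * ((u (a j) - u (b j)) ^ 2 + (v (a j) - v (b j)) ^ 2) := by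
        refine Finset.sum_le_sum fun j _ => ?_
        have h1 := hle (a j) (b j)
        rw [← sq_abs (h (a j) - h (b j)), ← sq_abs (u (a j) - u (b j)),
          ← sq_abs (v (a j) - v (b j))]
        have h2 := pow_le_pow_left₀ (abs_nonneg _) h1 2
        refine h2.trans ?_
        rw [mul_pow]
        have h3 : (|u (a j) - u (b j)| + |v (a j) - v (b j)|) ^ 2 ≤
            2 * (|u (a j) - u (b j)| ^ 2 + |v (a j) - v (b j)| ^ 2) := by
          nlinarith [sq_nonneg (|u (a j) - u (b j)| - |v (a j) - v (b j)|)]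
        nlinarith [mul_le_mul_of_nonneg_left h3 (sq_nonneg C)]
    _ ≤ 2 * C ^ 2 * (K₁ + K₂) := by
        rw [← Finset.mul_sum, Finset.sum_add_distrib]
        exact mul_le_mul_of_nonneg_left (add_le_add k1 k2) (by positivity)

lemma PK.comp {u : X → ℝ} (hu : PK u) {f : X ≃ₜ X} (hf : WQ f) : PK fun x => u (f x) := by
  intro l
  obtain ⟨c₀, hc₀⟩ := hf (max l 0)
  set c := max c₀ 1 with hc
  have hc1 : 0 < c := lt_of_lt_of_le one_pos (le_max_right _ _)
  obtain ⟨K, r₁, hr₁, H⟩ := hu c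
  obtain ⟨δ, hδ, hδf⟩ := Metric.uniformContinuous_iff.1
    (CompactSpace.uniformContinuous_of_continuous f.continuous) (c * r₁) (by positivity)
  refine ⟨K, δ / (max l 0 + 1), by positivity, fun ι s x a b r hr hd hl => ?_⟩
  set R : ι → ℝ := fun j => max (dist (f (x j)) (f (a j))) (dist (f (x j)) (f (b j))) / c with hR
  have hlr : ∀ j ∈ s, ∀ y, dist (x j) y ≤ l * r j → dist (x j) y < δ := by
    intro j hj y hy
    have h1 := (hr j hj).1
    have h2 := (hr j hj).2
    rw [lt_div_iff₀ (by positivity)] at h2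
    have := mul_le_mul_of_nonneg_right (le_max_left l 0) h1
    rcases h1.eq_or_lt with h0 | h0
    · rw [← h0] at hy; simp only [mul_zero] at hy; linarith
    · nlinarith
  apply H ι s (fun j => f (x j)) (fun j => f (a j)) (fun j => f (b j)) R
  · intro j hj
    refine ⟨by positivity, ?_⟩
    rw [hR, div_lt_iff₀ hc1, mul_comm]
    exact max_lt (hδf (hlr j hj _ (hl j hj).1)) (hδf (hlr j hj _ (hl j hj).2))
  · have key : ∀ j ∈ s, ∀ y, f y ∈ ball (f (x j)) (R j) → y ∈ ball (x j) (r j) := by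
      intro j hj y hy
      rw [mem_ball, dist_comm] at hy ⊢
      by_contra hlt
      rw [not_lt] at hlt
      have aux : ∀ z, dist (x j) z ≤ l * r j → dist (f (x j)) (f z) ≤ c * dist (f (x j)) (f y) := by
        intro z hz
        refine (hc₀ (x j) z y ?_).trans (mul_le_mul_of_nonneg_right (le_max_left _ _) dist_nonneg)
        have h1 := (hr j hj).1
        have h3 : (0 : ℝ) ≤ max l 0 := le_max_right _ _
        calc dist (x j) z ≤ l * r j := hz
          _ ≤ max l 0 * r j := mul_le_mul_of_nonneg_right (le_max_left l 0) h1
          _ ≤ max l 0 * dist (x j) y := mul_le_mul_of_nonneg_left hlt h3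
      have : R j ≤ dist (f (x j)) (f y) := by
        rw [hR, div_le_iff₀ hc1, mul_comm]
        exact max_le (aux _ (hl j hj).1) (aux _ (hl j hj).2)
      linarith
    intro j hj k hk hjk
    rw [Set.disjoint_left]
    intro z hz1 hz2
    obtain ⟨y, rfl⟩ := f.surjective z
    exact Set.disjoint_left.1 (hd j hj k hk hjk) (key j hj y hz1) (key k hk y hz2)
  · intro j hj
    simp only [hR]
    rw [mul_div_cancel₀ _ hc1.ne']
    exact ⟨le_max_left _ _, le_max_right _ _⟩

lemma WQ.comp {f g : X → X} (hg : WQ g) (hf : WQ f) : WQ fun x => g (f x) := by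
  intro l
  obtain ⟨c, hc⟩ := hf l
  obtain ⟨c', hc'⟩ := hg c
  exact ⟨c', fun x v w h => hc' _ _ _ (hc x v w h)⟩

lemma WQ.of_isometry {f : X → X} (hf : Isometry f) : WQ f :=
  fun l => ⟨l, fun x v w h => by rwa [hf.dist_eq, hf.dist_eq]⟩

lemma WQ.of_isQSMap {f : X → X} (hf : IsQSMap f) : WQ f := by
  obtain ⟨η, ⟨-, hmono, -, -⟩, h⟩ := hf
  intro l
  refine ⟨η l, fun x v w hd => ?_⟩
  by_cases hxw : x = w
  · subst hxw
    rw [dist_self, mul_zero] at hd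
    rw [dist_le_zero.1 hd]; simp
  · have hpos : 0 < dist x w := dist_pos.2 hxw
    refine (h x v w hxw).trans (mul_le_mul_of_nonneg_right ?_ dist_nonneg)
    have h1 : dist x v / dist x w ≤ l := (div_le_iff₀ hpos).2 hd
    have h0 : 0 ≤ dist x v / dist x w := by positivity
    exact hmono.monotoneOn h0 (h0.trans h1) h1

lemma WQ.symm_of_isQSMap {f : X ≃ₜ X} (hf : IsQSMap f) : WQ f.symm := by
  obtain ⟨η, ⟨-, hmono, h0, hsurj⟩, h⟩ := hf
  intro l
  set m := max l 1 with hm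
  have hm0 : 0 < m := lt_of_lt_of_le one_pos (le_max_right _ _)
  obtain ⟨t, ht, hte⟩ := hsurj (show 1 / (2 * m) ∈ Ici 0 from by simp; positivity)
  have ht0 : 0 < t := by
    rcases (show (0 : ℝ) ≤ t from ht).eq_or_lt with h1 | h1
    · rw [← h1, h0] at hte
      have : 0 < 1 / (2 * m) := by positivity
      linarith
    · exact h1
  refine ⟨1 / t, fun x' v' w' hd => ?_⟩
  obtain ⟨x, rfl⟩ := f.surjective x'
  obtain ⟨v, rfl⟩ := f.surjective v'
  obtain ⟨w, rfl⟩ := f.surjective w'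
  simp only [f.symm_apply_apply]
  by_contra hlt
  rw [not_le] at hlt
  have hpos : 0 < dist x v := lt_of_le_of_lt (by positivity) hlt
  have h1 : dist x w / dist x v ≤ t := by
    rw [div_le_iff₀ hpos]
    rw [div_mul_eq_mul_div, one_mul, div_lt_iff₀ ht0] at hlt
    linarith
  have h2 := h x w v (dist_pos.1 hpos)
  have h3 : η (dist x w / dist x v) ≤ 1 / (2 * m) := by
    rw [← hte]
    exact hmono.monotoneOn (by simp; positivity) ht h1
  have h4 : dist (f x) (f v) ≤ m * dist (f x) (f w) :=
    hd.trans (mul_le_mul_of_nonneg_right (le_max_left _ _) dist_nonneg)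
  have h5 : dist (f x) (f w) ≤ 1 / (2 * m) * (m * dist (f x) (f w)) :=
    h2.trans ((mul_le_mul_of_nonneg_right h3 dist_nonneg).trans
      (mul_le_mul_of_nonneg_left h4 (by positivity)))
  have h6 : 1 / (2 * m) * (m * dist (f x) (f w)) = dist (f x) (f w) / 2 := by field_simp
  have h7 : dist (f x) (f w) ≤ 0 := by linarith
  have h8 : dist (f x) (f v) ≤ 0 := h4.trans (mul_nonpos_of_nonneg_of_nonpos hm0.le h7)
  exact (dist_pos.1 hpos) (f.injective (dist_le_zero.1 h8))

/-- Homeomorphisms that are weakly quasisymmetric together with their inverses. -/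
def Gam (X : Type*) [MetricSpace X] [CompactSpace X] : Set (X ≃ₜ X) := {f | WQ f ∧ WQ f.symm}

lemma Gam.trans {f g : X ≃ₜ X} (hf : f ∈ Gam X) (hg : g ∈ Gam X) : f.trans g ∈ Gam X :=
  ⟨hg.1.comp hf.1, hf.2.comp hg.2⟩

lemma Gam.symm {f : X ≃ₜ X} (hf : f ∈ Gam X) : f.symm ∈ Gam X := ⟨hf.2, hf.1⟩

lemma Gam.of_isometry {f : X ≃ₜ X} (hf : Isometry f) : f ∈ Gam X := by
  refine ⟨WQ.of_isometry hf, WQ.of_isometry ?_⟩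
  exact hf.right_inv f.right_inv

lemma Gam.of_isQSMap {f : X ≃ₜ X} (hf : IsQSMap f) : f ∈ Gam X :=
  ⟨WQ.of_isQSMap hf, WQ.symm_of_isQSMap hf⟩

end metric

variable {p : ℕ} [OddBase p]

/-- Oscillation on a peripheral circle. -/
def rho (u : sierpinskiCarpet p → ℝ) (i : Option (Word p)) : ℝ := osc u (circX i)

lemma rho_nonneg (u : sierpinskiCarpet p → ℝ) (i : Option (Word p)) : 0 ≤ rho u i := osc_nonneg _ _

/-- The class of finite energy functions. -/
structure IsA (u : sierpinskiCarpet p → ℝ) : Prop where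
  cont : Continuous u
  pk : PK u
  summ : Summable fun i => rho u i ^ 2

/-- The energy carried by the bounded peripheral circles. -/
def En (u : sierpinskiCarpet p → ℝ) : ℝ := ∑' w : Word p, rho u (some w) ^ 2

lemma En_nonneg (u : sierpinskiCarpet p → ℝ) : 0 ≤ En u := tsum_nonneg fun _ => sq_nonneg _

lemma IsA.summ' {u : sierpinskiCarpet p → ℝ} (hu : IsA u) :
    Summable fun w : Word p => rho u (some w) ^ 2 :=
  hu.summ.comp_injective (Option.some_injective _)

lemma tsum_rho {u : sierpinskiCarpet p → ℝ} (hu : IsA u) :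
    ∑' i, rho u i ^ 2 = rho u none ^ 2 + En u := by
  have := (Equiv.optionEquivSumPUnit.{0} (Word p)).symm.tsum_eq fun i => rho u i ^ 2
  rw [← this, Summable.tsum_sum]
  · simp [En, add_comm]
  · exact hu.summ'
  · exact (hasSum_fintype _).summable

lemma rho_le_of_le {u v h : sierpinskiCarpet p → ℝ} (hu : Continuous u) (hv : Continuous v) {C : ℝ}
    (hC : 0 ≤ C) (hle : ∀ x y, |h x - h y| ≤ C * (|u x - u y| + |v x - v y|))
    (i : Option (Word p)) : rho h i ≤ C * (rho u i + rho v i) :=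
  osc_le_of_le hu hv hC fun x _ y _ => hle x y

lemma IsA.of_le {u v h : sierpinskiCarpet p → ℝ} (hu : IsA u) (hv : IsA v) {C : ℝ} (hC : 0 ≤ C)
    (hle : ∀ x y, |h x - h y| ≤ C * (|u x - u y| + |v x - v y|)) : IsA h := by
  refine ⟨?_, hu.pk.of_le hv.pk hle, ?_⟩
  · rw [continuous_iff_continuousAt]
    intro x
    rw [ContinuousAt, tendsto_iff_dist_tendsto_zero]
    have hlim : Filter.Tendsto (fun y => C * (|u y - u x| + |v y - v x|)) (nhds x) (nhds 0) := by
      have : Continuous fun y => C * (|u y - u x| + |v y - v x|) := by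
        have := hu.cont; have := hv.cont; fun_prop
      simpa using this.tendsto x
    exact squeeze_zero (fun _ => dist_nonneg) (fun y => hle y x) hlim
  · refine Summable.of_nonneg_of_le (fun _ => sq_nonneg _) (fun i => ?_)
      ((hu.summ.add hv.summ).mul_left (2 * C ^ 2))
    have h1 := rho_le_of_le hu.cont hv.cont hC hle i
    have h2 := pow_le_pow_left₀ (rho_nonneg h i) h1 2
    refine h2.trans ?_
    have h3 : (rho u i + rho v i) ^ 2 ≤ 2 * (rho u i ^ 2 + rho v i ^ 2) := by
      nlinarith [sq_nonneg (rho u i - rho v i)]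
    rw [mul_pow]
    nlinarith [mul_le_mul_of_nonneg_left h3 (sq_nonneg C)]

lemma IsA.of_le_one {u h : sierpinskiCarpet p → ℝ} (hu : IsA u) {C : ℝ} (hC : 0 ≤ C)
    (hle : ∀ x y, |h x - h y| ≤ C * |u x - u y|) : IsA h :=
  hu.of_le hu hC fun x y => (hle x y).trans
    (mul_le_mul_of_nonneg_left (by linarith [abs_nonneg (u x - u y)]) hC)

lemma IsA.add {u v : sierpinskiCarpet p → ℝ} (hu : IsA u) (hv : IsA v) :
    IsA fun x => u x + v x :=
  hu.of_le hv zero_le_one fun x y => by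
    rw [one_mul, show u x + v x - (u y + v y) = (u x - u y) + (v x - v y) by ring]
    exact abs_add_le _ _

lemma IsA.const_mul {u : sierpinskiCarpet p → ℝ} (hu : IsA u) (c : ℝ) : IsA fun x => c * u x :=
  hu.of_le_one (abs_nonneg c) fun x y => by rw [← mul_sub, abs_mul]

lemma IsA.mul {u v : sierpinskiCarpet p → ℝ} (hu : IsA u) (hv : IsA v) :
    IsA fun x => u x * v x := by
  obtain ⟨C₁, h₁⟩ := (isCompact_univ.image hu.cont).isBounded.exists_norm_le
  obtain ⟨C₂, h₂⟩ := (isCompact_univ.image hv.cont).isBounded.exists_norm_le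
  have k1 : ∀ x, |u x| ≤ max C₁ C₂ := fun x => (h₁ _ ⟨x, trivial, rfl⟩).trans (le_max_left _ _)
  have k2 : ∀ x, |v x| ≤ max C₁ C₂ := fun x => (h₂ _ ⟨x, trivial, rfl⟩).trans (le_max_right _ _)
  have x₀ : sierpinskiCarpet p := (circX_nonempty none).some
  have h0 : 0 ≤ max C₁ C₂ := (abs_nonneg _).trans (k1 x₀)
  refine hu.of_le hv h0 fun x y => ?_
  rw [show u x * v x - u y * v y = (u x - u y) * v x + u y * (v x - v y) by ring]
  refine (abs_add_le _ _).trans ?_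
  rw [abs_mul, abs_mul]
  nlinarith [mul_le_mul_of_nonneg_left (k2 x) (abs_nonneg (u x - u y)),
    mul_le_mul_of_nonneg_right (k1 y) (abs_nonneg (v x - v y))]

lemma rho_comp (u : sierpinskiCarpet p → ℝ) (f : sierpinskiCarpet p ≃ₜ sierpinskiCarpet p)
    (i : Option (Word p)) : rho (fun x => u (f x)) i = rho u (perm f i) := by
  rw [rho, osc_comp, image_circX, rho]

lemma IsA.comp {u : sierpinskiCarpet p → ℝ} (hu : IsA u)
    {f : sierpinskiCarpet p ≃ₜ sierpinskiCarpet p} (hf : f ∈ Gam (sierpinskiCarpet p)) :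
    IsA fun x => u (f x) :=
  ⟨hu.cont.comp f.continuous, hu.pk.comp hf.1, by
    simp only [rho_comp]
    exact hu.summ.comp_injective (permEquiv f).injective⟩

lemma tsum_rho_comp (u : sierpinskiCarpet p → ℝ)
    (f : sierpinskiCarpet p ≃ₜ sierpinskiCarpet p) :
    ∑' i, rho (fun x => u (f x)) i ^ 2 = ∑' i, rho u i ^ 2 := by
  simp only [rho_comp]
  exact (permEquiv f).tsum_eq fun i => rho u i ^ 2

end

end Carpet

namespace Carpet

open MeasureTheory

noncomputable section

variable {p : ℕ} [OddBase p]

open scoped Classical in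
/-- Disjointness of holes along a horizontal line. -/
lemma row_sum_le (y a b : ℝ) :
    ∑' w : Word p, (if (hy w < y ∧ y < hy w + hs w) ∧ a ≤ hx w ∧ hx w + hs w ≤ b
      then ENNReal.ofReal (hs w) else 0) ≤ ENNReal.ofReal (b - a) := by
  set I : Word p → Set ℝ := fun w =>
    if (hy w < y ∧ y < hy w + hs w) ∧ a ≤ hx w ∧ hx w + hs w ≤ b
      then Ioo (hx w) (hx w + hs w) else ∅ with hI
  have h1 : ∀ w, (if (hy w < y ∧ y < hy w + hs w) ∧ a ≤ hx w ∧ hx w + hs w ≤ b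
      then ENNReal.ofReal (hs w) else 0) = volume (I w) := by
    intro w
    simp only [hI]
    split_ifs <;> simp
  simp only [h1]
  have hm : ∀ w, MeasurableSet (I w) := by
    intro w; simp only [hI]; split_ifs
    · exact measurableSet_Ioo
    · exact MeasurableSet.empty
  have hd : Pairwise (Function.onFun Disjoint I) := by
    intro v w hvw
    rw [Function.onFun, Set.disjoint_left]
    intro t ht ht'
    simp only [hI] at ht ht'
    split_ifs at ht ht' with c1 c2
    · have k1 : (⟨t, y⟩ : ℂ) ∈ hole v := ⟨ht, c1.1⟩
      have k2 : (⟨t, y⟩ : ℂ) ∈ hole w := ⟨ht', c2.1⟩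
      exact Set.disjoint_left.1 (chole_disjoint hvw) (hole_subset_chole _ k1)
        (hole_subset_chole _ k2)
    all_goals simp_all
  rw [← measure_iUnion hd hm]
  refine (measure_mono (t := Icc a b) ?_).trans_eq Real.volume_Icc
  intro t ht
  obtain ⟨w, hw⟩ := mem_iUnion.1 ht
  simp only [hI] at hw
  split_ifs at hw with c
  · exact ⟨c.2.1.trans hw.1.le, hw.2.le.trans c.2.2⟩
  · simp at hw

lemma lintegral_ite_Ioo (c d C : ℝ) :
    ∫⁻ y, (if c < y ∧ y < d then ENNReal.ofReal C else 0) =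
      ENNReal.ofReal (d - c) * ENNReal.ofReal C := by
  have : (fun y => if c < y ∧ y < d then ENNReal.ofReal C else 0) =
      (Ioo c d).indicator fun _ => ENNReal.ofReal C := by
    ext y
    simp [indicator, mem_Ioo]
  rw [this, lintegral_indicator measurableSet_Ioo, setLIntegral_const, Real.volume_Ioo, mul_comm]

lemma measurable_ite_Ioo (c d C : ℝ) :
    Measurable fun y : ℝ => if c < y ∧ y < d then ENNReal.ofReal C else 0 :=
  Measurable.ite measurableSet_Ioo measurable_const measurable_const

open scoped Classical in
lemma box_sum_le {a b c d : ℝ} (hab : a ≤ b) (hcd : c ≤ d) (W : Finset (Word p))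
    (hW : ∀ w ∈ W, a ≤ hx w ∧ hx w + hs w ≤ b ∧ c ≤ hy w ∧ hy w + hs w ≤ d) :
    ∑ w ∈ W, hs w ^ 2 ≤ (b - a) * (d - c) := by
  have h1 : ∑ w ∈ W, ENNReal.ofReal (hs w ^ 2) = ∫⁻ y in Icc c d, ∑ w ∈ W,
      (if hy w < y ∧ y < hy w + hs w then ENNReal.ofReal (hs w) else 0) := by
    rw [lintegral_finsetSum _ fun w _ => measurable_ite_Ioo _ _ _]
    refine Finset.sum_congr rfl fun w hw => ?_
    have h := lintegral_ite_Ioo (hy w) (hy w + hs w) (hs w)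
    rw [add_sub_cancel_left, ← ENNReal.ofReal_mul (hs_pos w).le, ← sq] at h
    rw [← h, setLIntegral_eq_of_support_subset]
    intro y hy'
    simp only [Function.mem_support, ne_eq, ite_eq_right_iff, not_forall] at hy'
    obtain ⟨⟨h2, h3⟩, -⟩ := hy'
    exact ⟨(hW w hw).2.2.1.trans h2.le, h3.le.trans (hW w hw).2.2.2⟩
  have h2 : ∑ w ∈ W, ENNReal.ofReal (hs w ^ 2) ≤ ENNReal.ofReal (b - a) * ENNReal.ofReal (d - c) := by
    rw [h1]
    calc _ ≤ ∫⁻ _ in Icc c d, ENNReal.ofReal (b - a) := by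
          refine lintegral_mono fun y => ?_
          refine le_trans ?_ (row_sum_le (p := p) y a b)
          refine le_trans (Finset.sum_le_sum fun w hw => ?_) (ENNReal.sum_le_tsum W)
          have := hW w hw
          by_cases hyw : hy w < y ∧ y < hy w + hs w
          · rw [if_pos hyw, if_pos ⟨hyw, this.1, this.2.1⟩]
          · rw [if_neg hyw]; exact zero_le
      _ = _ := by rw [setLIntegral_const, Real.volume_Icc]
  rw [← ENNReal.ofReal_sum_of_nonneg fun _ _ => sq_nonneg _,
    ← ENNReal.ofReal_mul (by linarith)] at h2
  exact (ENNReal.ofReal_le_ofReal_iff (mul_nonneg (by linarith) (by linarith))).1 h2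

lemma sum_hs_sq_le (W : Finset (Word p)) : ∑ w ∈ W, hs w ^ 2 ≤ 1 := by
  have := box_sum_le (a := 0) (b := 1) (c := 0) (d := 1) zero_le_one zero_le_one W fun w _ => by
    have := hole_range w
    exact ⟨this.1.le, this.2.1.le, this.2.2.1.le, this.2.2.2.le⟩
  simpa using this

lemma summable_hs_sq : Summable fun w : Word p => hs w ^ 2 :=
  summable_of_sum_le (fun _ => sq_nonneg _) sum_hs_sq_le

lemma tsum_hs_sq_le : ∑' w : Word p, hs w ^ 2 ≤ 1 :=
  Real.tsum_le_of_sum_le (fun _ => sq_nonneg _) sum_hs_sq_le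

lemma dist_le_of_mem_csq {a b s : ℝ} {z z' : ℂ} (hz : z ∈ csq a b s) (hz' : z' ∈ csq a b s) :
    |z.re - z'.re| ≤ s ∧ |z.im - z'.im| ≤ s := by
  obtain ⟨⟨h1, h2⟩, h3, h4⟩ := hz
  obtain ⟨⟨k1, k2⟩, k3, k4⟩ := hz'
  constructor <;> rw [abs_le] <;> constructor <;> linarith

lemma dist_le_two_mul {a b s : ℝ} {z z' : ℂ} (hz : z ∈ csq a b s) (hz' : z' ∈ csq a b s) :
    dist z z' ≤ 2 * s := by
  have := dist_le_of_mem_csq hz hz'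
  rw [Complex.dist_eq]
  refine (Complex.norm_le_abs_re_add_abs_im _).trans ?_
  rw [Complex.sub_re, Complex.sub_im]
  linarith

lemma rho_le_of_lipschitz {u : sierpinskiCarpet p → ℝ} {C : ℝ} (hC : 0 ≤ C)
    (hu : ∀ x y, |u x - u y| ≤ C * dist x y) (w : Word p) : rho u (some w) ≤ 2 * C * hs w := by
  refine osc_le (by have := hs_pos w; positivity) fun x hx y hy => (hu x y).trans ?_
  have : dist (x : ℂ) y ≤ 2 * hs w :=
    dist_le_two_mul (circ_some_subset_chole _ hx) (circ_some_subset_chole _ hy)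
  calc C * dist x y ≤ C * (2 * hs w) := mul_le_mul_of_nonneg_left this hC
    _ = _ := by ring

/-- Area bound for separated families of balls of the carpet. -/
lemma sum_radii_sq_le {ι : Type} (s : Finset ι) (x : ι → sierpinskiCarpet p) (r : ι → ℝ)
    (hr : ∀ j ∈ s, 0 ≤ r j ∧ r j < 1)
    (hd : ∀ j ∈ s, ∀ k ∈ s, j ≠ k → Disjoint (ball (x j) (r j)) (ball (x k) (r k))) :
    ∑ j ∈ s, r j ^ 2 ≤ 64 := by
  have hdis : (s : Set ι).PairwiseDisjoint fun j => ball (x j : ℂ) (r j / 2) := by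
    have aux : ∀ j ∈ s, ∀ k ∈ s, j ≠ k → r k ≤ r j → Disjoint (ball (x j : ℂ) (r j / 2))
        (ball (x k : ℂ) (r k / 2)) := by
      intro j hj k hk hjk hle
      rw [Set.disjoint_left]
      intro z hz hz'
      rw [mem_ball] at hz hz'
      have hk0 : 0 < r k := by linarith [dist_nonneg (x := z) (y := (x k : ℂ))]
      have hmem : x k ∈ ball (x j) (r j) := by
        rw [mem_ball, Subtype.dist_eq]
        have := dist_triangle_left (x k : ℂ) (x j) z
        linarith
      exact Set.disjoint_left.1 (hd j hj k hk hjk) hmem (mem_ball_self hk0)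
    intro j hj k hk hjk
    rcases le_total (r k) (r j) with h | h
    · exact aux j hj k hk hjk h
    · exact (aux k hk j hj hjk.symm h).symm
  have hvol : ∑ j ∈ s, volume (ball (x j : ℂ) (r j / 2)) ≤ volume (ball (0 : ℂ) 4) := by
    rw [← measure_biUnion_finset hdis fun j _ => measurableSet_ball]
    refine measure_mono ?_
    intro z hz
    simp only [mem_iUnion, exists_prop] at hz
    obtain ⟨j, hj, hz⟩ := hz
    have h1 := (hr j hj).2
    have h0 : (0 : ℂ) ∈ csq 0 0 1 := by simp [csq]
    have h2 := dist_le_two_mul (carpet_subset_unit (x j).2) h0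
    rw [mem_ball] at hz ⊢
    have := dist_triangle z (x j : ℂ) 0
    linarith
  simp only [Complex.volume_ball] at hvol
  rw [← Finset.sum_mul, ENNReal.mul_le_mul_iff_left (by simp [Real.pi_ne_zero, NNReal.pi_ne_zero]) (by simp)] at hvol
  simp only [← ENNReal.ofReal_pow (show (0 : ℝ) ≤ 4 by norm_num)] at hvol
  have h1 : ∑ j ∈ s, ENNReal.ofReal (r j / 2) ^ 2 = ENNReal.ofReal (∑ j ∈ s, (r j / 2) ^ 2) := by
    rw [ENNReal.ofReal_sum_of_nonneg fun _ _ => sq_nonneg _]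
    refine Finset.sum_congr rfl fun j hj => ?_
    rw [ENNReal.ofReal_pow (by linarith [(hr j hj).1])]
  rw [h1, ENNReal.ofReal_le_ofReal_iff (by positivity)] at hvol
  have h2 : ∑ j ∈ s, (r j / 2) ^ 2 = (∑ j ∈ s, r j ^ 2) / 4 := by
    rw [Finset.sum_div]
    exact Finset.sum_congr rfl fun j _ => by ring
  rw [h2] at hvol
  linarith

lemma IsA.of_lipschitz {u : sierpinskiCarpet p → ℝ} {C : ℝ} (hC : 0 ≤ C)
    (hu : ∀ x y, |u x - u y| ≤ C * dist x y) : IsA u := by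
  refine ⟨?_, ?_, ?_⟩
  · exact (LipschitzWith.of_dist_le_mul (K := ⟨C, hC⟩) hu).continuous
  · intro l
    refine ⟨(2 * C * l) ^ 2 * 64, 1, one_pos, fun ι s x a b r hr hd hl => ?_⟩
    calc ∑ j ∈ s, (u (a j) - u (b j)) ^ 2 ≤ ∑ j ∈ s, (2 * C * l) ^ 2 * r j ^ 2 := by
          refine Finset.sum_le_sum fun j hj => ?_
          rw [← mul_pow]
          refine sq_le_sq' ?_ ?_
          all_goals
            have h1 := hu (a j) (b j)
            have h2 := dist_triangle_left (a j) (b j) (x j)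
            have h3 := (hl j hj).1
            have h4 := (hl j hj).2
            have h5 : C * dist (a j) (b j) ≤ C * (2 * (l * r j)) :=
              mul_le_mul_of_nonneg_left (by linarith) hC
            rw [abs_le] at h1
            nlinarith
      _ ≤ _ := by
          rw [← Finset.mul_sum]
          exact mul_le_mul_of_nonneg_left (sum_radii_sq_le s x r hr hd) (sq_nonneg _)
  · have h1 : Summable fun w : Word p => rho u (some w) ^ 2 := by
      refine Summable.of_nonneg_of_le (fun _ => sq_nonneg _) (fun w => ?_)
        (summable_hs_sq.mul_left ((2 * C) ^ 2))
      rw [← mul_pow]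
      exact pow_le_pow_left₀ (rho_nonneg _ _) (rho_le_of_lipschitz hC hu w) 2
    rw [← (Equiv.optionEquivSumPUnit.{0} (Word p)).symm.summable_iff]
    exact Summable.sum _ h1 (hasSum_fintype _).summable

end

end Carpet

namespace Carpet

open MeasureTheory

noncomputable section

variable {p : ℕ}

/-- The words of length `n`. -/
def lvl (p n : ℕ) : Finset (Word p) := (List.finite_length_eq (Dig p) n).toFinset

lemma mem_lvl {n : ℕ} {w : Word p} : w ∈ lvl p n ↔ w.length = n := by
  simp [lvl]

variable [OddBase p]

/-- Cells as subsets of the carpet. -/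
def cellX (w : Word p) : Set (sierpinskiCarpet p) := (↑) ⁻¹' cell w

lemma isCompact_cellX (w : Word p) : IsCompact (cellX w) :=
  ((isClosed_csq _ _ _).preimage continuous_subtype_val).isCompact

lemma zero_mem_carpet : (0 : ℂ) ∈ sierpinskiCarpet p :=
  circ_subset_carpet none (by simp [circ_none, csq, osq])

/-- The lower left corner of a cell. -/
def corner (w : Word p) : sierpinskiCarpet p :=
  ⟨emb w 0, (emb_mem_carpet (by simp [csq])).2 zero_mem_carpet⟩

lemma corner_mem (w : Word p) : corner w ∈ cellX w := emb_mem_cell.2 (by simp [csq])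

lemma card_lvl_succ (n : ℕ) : (lvl p (n + 1)).card ≤ (p ^ 2 - 1) * (lvl p n).card := by
  classical
  have h1 : lvl p (n + 1) ⊆ ((Finset.univ : Finset (Dig p)) ×ˢ lvl p n).image
      fun q => q.1 :: q.2 := by
    intro w hw
    rw [mem_lvl] at hw
    cases w with
    | nil => simp at hw
    | cons d w =>
      rw [Finset.mem_image]
      exact ⟨(d, w), by simpa [mem_lvl] using hw, rfl⟩
  refine (Finset.card_le_card h1).trans (Finset.card_image_le.trans ?_)
  rw [Finset.card_product]
  refine Nat.mul_le_mul_right _ ?_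
  have h3 := (OddBase.three_le : 3 ≤ p)
  have hm : (p - 1) / 2 < p := by omega
  have : Fintype.card (Dig p) < Fintype.card (Fin p × Fin p) :=
    Fintype.card_subtype_lt (x := (⟨⟨(p - 1) / 2, hm⟩, ⟨(p - 1) / 2, hm⟩⟩ : Fin p × Fin p))
      (by simp)
  rw [Fintype.card_prod, Fintype.card_fin, ← sq] at this
  rw [Finset.card_univ]
  omega

lemma card_lvl (n : ℕ) : ((lvl p n).card : ℝ) ≤ ((p : ℝ) ^ 2 - 1) ^ n := by
  have h3 := (OddBase.three_le : 3 ≤ p)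
  have hc : ((p ^ 2 - 1 : ℕ) : ℝ) = (p : ℝ) ^ 2 - 1 := by
    rw [Nat.cast_sub (by nlinarith)]; push_cast; ring
  rw [← hc]
  have : (lvl p n).card ≤ (p ^ 2 - 1) ^ n := by
    induction n with
    | zero =>
      have : lvl p 0 ⊆ {[]} := by
        intro w hw; rw [mem_lvl, List.length_eq_zero_iff] at hw; simp [hw]
      simpa using Finset.card_le_card this
    | succ n ih =>
      rw [pow_succ, mul_comm]
      exact (card_lvl_succ n).trans (Nat.mul_le_mul_left _ ih)
  exact_mod_cast this

lemma corner_dist {v w : Word p} (hvw : v ≠ w) (hl : v.length = w.length) :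
    sc w / 2 ≤ dist (corner v) (corner w) := by
  have hs' : sc v = sc w := by simp [sc, hl]
  have hnp : ¬ w <+: v := fun h => hvw (h.eq_of_length hl.symm).symm
  have h1 := chole_disjoint_ocell hnp (hole_subset_chole _ (hctr_mem_hole v))
  by_contra hlt
  rw [not_le, Subtype.dist_eq, Complex.dist_eq] at hlt
  have hre := (Complex.abs_re_le_norm _).trans_lt hlt
  have him := (Complex.abs_im_le_norm _).trans_lt hlt
  simp only [corner, emb, Complex.sub_re, Complex.sub_im, Complex.zero_re, Complex.zero_im,
    mul_zero, add_zero] at hre him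
  rw [abs_lt] at hre him
  have k1 := two_hx v; have k2 := two_hy v
  apply h1
  simp only [hctr, sqCtr]
  refine ⟨⟨?_, ?_⟩, ?_, ?_⟩ <;> simp only <;> linarith

lemma exists_osc_eq {u : sierpinskiCarpet p → ℝ} (hu : Continuous u) (w : Word p) :
    ∃ a ∈ cellX w, ∃ b ∈ cellX w, osc u (cellX w) ≤ u a - u b := by
  obtain ⟨a, ha, hmax⟩ := (isCompact_cellX w).exists_isMaxOn ⟨_, corner_mem w⟩ hu.continuousOn
  obtain ⟨b, hb, hmin⟩ := (isCompact_cellX w).exists_isMinOn ⟨_, corner_mem w⟩ hu.continuousOn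
  refine ⟨a, ha, b, hb, osc_le (sub_nonneg.2 (hmax hb)) fun x hx y hy => ?_⟩
  have h1 : u x ≤ u a := hmax hx
  have h2 : u y ≤ u a := hmax hy
  have h3 : u b ≤ u x := hmin hx
  have h4 : u b ≤ u y := hmin hy
  rw [abs_le]; constructor <;> linarith

/-- The mean oscillation over cells of level `n` becomes arbitrarily small. -/
lemma exists_sum_osc_le {u : sierpinskiCarpet p → ℝ} (hu : IsA u) {ε : ℝ} (hε : 0 < ε) :
    ∃ n, ∑ w ∈ lvl p n, sc w * osc u (cellX w) ≤ ε := by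
  have hp := three_le_real (p := p)
  obtain ⟨K, r₀, hr₀, H⟩ := hu.pk 8
  choose a ha b hb hab using fun w => exists_osc_eq hu.cont w
  have hq0 : 0 ≤ ((p : ℝ) ^ 2 - 1) / p ^ 2 := div_nonneg (by nlinarith) (by positivity)
  have hq1 : ((p : ℝ) ^ 2 - 1) / p ^ 2 < 1 := by
    rw [div_lt_one (by positivity)]; linarith
  have ht1 : Filter.Tendsto (fun n : ℕ => (((p : ℝ) ^ 2 - 1) / p ^ 2) ^ n * |K|) Filter.atTop
      (nhds 0) := by
    simpa using (tendsto_pow_atTop_nhds_zero_of_lt_one hq0 hq1).mul_const |K|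
  have ht2 : Filter.Tendsto (fun n : ℕ => ((p : ℝ) ^ n)⁻¹) Filter.atTop (nhds 0) := by
    simpa using tendsto_pow_atTop_nhds_zero_of_lt_one (r := (p : ℝ)⁻¹) (by positivity)
      (inv_lt_one_of_one_lt₀ (by linarith))
  obtain ⟨n, hn1, hn2⟩ := ((ht1.eventually (gt_mem_nhds (by positivity : 0 < ε ^ 2))).and
    (ht2.eventually (gt_mem_nhds hr₀))).exists
  refine ⟨n, ?_⟩
  have hsc : ∀ w ∈ lvl p n, sc w = ((p : ℝ) ^ n)⁻¹ := fun w hw => by rw [sc, mem_lvl.1 hw]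
  have h1 : ∑ w ∈ lvl p n, osc u (cellX w) ^ 2 ≤ |K| := by
    refine le_trans (Finset.sum_le_sum fun w _ =>
      pow_le_pow_left₀ (osc_nonneg _ _) (hab w) 2) (le_trans ?_ (le_abs_self K))
    refine H (Word p) (lvl p n) corner a b (fun w => sc w / 4) ?_ ?_ ?_
    · intro w hw
      have := sc_pos w
      refine ⟨by positivity, ?_⟩
      rw [← hsc w hw] at hn2; linarith
    · intro v hv w hw hvw
      have h := corner_dist hvw (by rw [mem_lvl.1 hv, mem_lvl.1 hw])
      rw [hsc v hv, hsc w hw]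
      rw [hsc w hw] at h
      exact ball_disjoint_ball (by linarith)
    · intro w _
      have k1 : dist (corner w : ℂ) (a w) ≤ 2 * sc w := dist_le_two_mul (corner_mem w) (ha w)
      have k2 : dist (corner w : ℂ) (b w) ≤ 2 * sc w := dist_le_two_mul (corner_mem w) (hb w)
      rw [Subtype.dist_eq, Subtype.dist_eq]
      constructor <;> linarith
  have h2 : ∑ w ∈ lvl p n, sc w ^ 2 ≤ (((p : ℝ) ^ 2 - 1) / p ^ 2) ^ n := by
    rw [Finset.sum_congr rfl fun w hw => by rw [hsc w hw], Finset.sum_const, nsmul_eq_mul, div_pow,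
      div_eq_mul_inv, inv_pow, ← pow_mul, ← pow_mul, mul_comm n 2]
    exact mul_le_mul_of_nonneg_right (card_lvl n) (by positivity)
  have h3 := Finset.sum_mul_sq_le_sq_mul_sq (lvl p n) (fun w => sc w) fun w => osc u (cellX w)
  have h4 : (∑ w ∈ lvl p n, sc w * osc u (cellX w)) ^ 2 ≤ ε ^ 2 :=
    h3.trans ((mul_le_mul h2 h1 (Finset.sum_nonneg fun _ _ => sq_nonneg _)
      (pow_nonneg hq0 n)).trans hn1.le)
  exact (abs_le_of_sq_le_sq' h4 hε.le).2

open scoped Classical in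
/-- Total oscillation of the level `n` cells met by the horizontal line at height `y`. -/
def cellVar (u : sierpinskiCarpet p → ℝ) (n : ℕ) (y : ℝ) : ENNReal :=
  ∑ w ∈ lvl p n, if cy w ≤ y ∧ y ≤ cy w + sc w then ENNReal.ofReal (osc u (cellX w)) else 0

lemma measurable_cellVar (u : sierpinskiCarpet p → ℝ) (n : ℕ) : Measurable (cellVar u n) := by
  unfold cellVar
  exact Finset.measurable_fun_sum _ fun w _ =>
    Measurable.ite measurableSet_Icc measurable_const measurable_const

lemma lintegral_cellVar (u : sierpinskiCarpet p → ℝ) (n : ℕ) :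
    ∫⁻ y, cellVar u n y = ENNReal.ofReal (∑ w ∈ lvl p n, sc w * osc u (cellX w)) := by
  classical
  unfold cellVar
  rw [lintegral_finsetSum _ fun w _ =>
    Measurable.ite measurableSet_Icc measurable_const measurable_const,
    ENNReal.ofReal_sum_of_nonneg fun w _ => mul_nonneg (sc_pos w).le (osc_nonneg _ _)]
  refine Finset.sum_congr rfl fun w _ => ?_
  have : (fun y => if cy w ≤ y ∧ y ≤ cy w + sc w then ENNReal.ofReal (osc u (cellX w)) else 0) =
      (Icc (cy w) (cy w + sc w)).indicator fun _ => ENNReal.ofReal (osc u (cellX w)) := by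
    ext y
    simp [indicator, mem_Icc]
  rw [this, lintegral_indicator measurableSet_Icc, setLIntegral_const, Real.volume_Icc,
    add_sub_cancel_left, mul_comm, ENNReal.ofReal_mul (sc_pos w).le]

lemma volume_image_le {u : sierpinskiCarpet p → ℝ} (hu : Continuous u)
    (D : Set (sierpinskiCarpet p)) : volume (u '' D) ≤ ENNReal.ofReal (osc u D) := by
  have hb : Bornology.IsBounded (u '' D) :=
    ((isCompact_univ.image hu).isBounded).subset (image_mono (subset_univ _))
  rw [osc, Metric.diam, ENNReal.ofReal_toReal hb.ediam_ne_top]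
  exact Real.volume_le_diam _

open scoped Classical in
/-- The length estimate along a horizontal line. -/
lemma line_estimate {u : sierpinskiCarpet p → ℝ} (hu : Continuous u) (n : ℕ) {y : ℝ} {R : Set ℝ}
    (hR : R.OrdConnected) {z z' : sierpinskiCarpet p} (hz : (z : ℂ) ∈ line p y R)
    (hz' : (z' : ℂ) ∈ line p y R) :
    ENNReal.ofReal |u z - u z'| ≤
      ∑' w : Word p, (if (hy w < y ∧ y < hy w + hs w) ∧ Icc (hx w) (hx w + hs w) ⊆ R
        then ENNReal.ofReal (rho u (some w)) else 0) + cellVar u n y := by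
  set L : Set (sierpinskiCarpet p) := (↑) ⁻¹' line p y R with hL
  have hLc : IsPreconnected L := by
    apply Topology.IsInducing.subtypeVal.isPreconnected_image.1
    rw [hL, Subtype.image_preimage_coe, inter_eq_right.2 (line_subset_carpet y R)]
    exact isPreconnected_line y hR
  have h1 : uIcc (u z') (u z) ⊆ u '' L :=
    (hLc.image u hu.continuousOn).ordConnected.uIcc_subset ⟨z', hz', rfl⟩ ⟨z, hz, rfl⟩
  set A : Word p → Set ℝ := fun w =>
    if (hy w < y ∧ y < hy w + hs w) ∧ Icc (hx w) (hx w + hs w) ⊆ R then u '' circX (some w) else ∅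
    with hA
  set B : Word p → Set ℝ := fun w =>
    if cy w ≤ y ∧ y ≤ cy w + sc w then u '' cellX w else ∅ with hB
  have h2 : u '' L ⊆ (⋃ w, A w) ∪ ⋃ w ∈ lvl p n, B w := by
    rintro _ ⟨x, hx', rfl⟩
    rcases hx' with ⟨hxS, hxy, hxR⟩ | ⟨w, hw, hwR, hxw⟩
    · right
      obtain ⟨w, hw, hxw⟩ := exists_cell n hxS
      simp only [mem_iUnion]
      refine ⟨w, mem_lvl.2 hw, ?_⟩
      have : cy w ≤ y ∧ y ≤ cy w + sc w := by rw [← hxy]; exact hxw.2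
      simp only [hB, if_pos this]
      exact ⟨x, hxw, rfl⟩
    · left
      rw [mem_iUnion]
      refine ⟨w, ?_⟩
      simp only [hA, if_pos (And.intro hw hwR)]
      exact ⟨x, hxw, rfl⟩
  calc ENNReal.ofReal |u z - u z'| = volume (uIcc (u z') (u z)) := by rw [Real.volume_interval]
    _ ≤ volume ((⋃ w, A w) ∪ ⋃ w ∈ lvl p n, B w) := measure_mono (h1.trans h2)
    _ ≤ volume (⋃ w, A w) + volume (⋃ w ∈ lvl p n, B w) := measure_union_le _ _
    _ ≤ _ := by
      refine add_le_add ((measure_iUnion_le _).trans (ENNReal.tsum_le_tsum fun w => ?_))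
        ((measure_biUnion_finset_le _ _).trans (Finset.sum_le_sum fun w _ => ?_))
      · simp only [hA]; split_ifs
        · exact volume_image_le hu _
        · simp
      · simp only [hB]; split_ifs
        · exact volume_image_le hu _
        · simp

lemma exists_cellVar_le {u : sierpinskiCarpet p → ℝ} (hu : IsA u) {c d ε : ℝ} (hcd : c < d)
    (hε : 0 < ε) : ∃ y ∈ Ioo c d, ∃ n, cellVar u n y ≤ ENNReal.ofReal ε := by
  by_contra! h
  obtain ⟨n, hn⟩ := exists_sum_osc_le hu (show 0 < ε * (d - c) / 2 by
    have := sub_pos.2 hcd; positivity)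
  have h1 : ∫⁻ _ in Ioo c d, ENNReal.ofReal ε ≤ ∫⁻ y, cellVar u n y :=
    (setLIntegral_mono (measurable_cellVar u n) fun y hy' => (h y hy' n).le).trans
      (setLIntegral_le_lintegral _ _)
  rw [setLIntegral_const, Real.volume_Ioo, lintegral_cellVar, ← ENNReal.ofReal_mul hε.le] at h1
  have h2 := h1.trans (ENNReal.ofReal_le_ofReal hn)
  have h3 : 0 < ε * (d - c) := mul_pos hε (sub_pos.2 hcd)
  rw [ENNReal.ofReal_le_ofReal_iff (by positivity)] at h2
  linarith

lemma summable_hs_mul_rho {u : sierpinskiCarpet p → ℝ} (hu : IsA u) :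
    Summable fun w : Word p => hs w * rho u (some w) := by
  refine Summable.of_nonneg_of_le (fun w => mul_nonneg (hs_pos w).le (rho_nonneg _ _)) (fun w => ?_)
    (summable_hs_sq.add hu.summ')
  nlinarith [sq_nonneg (hs w - rho u (some w)), sq_nonneg (hs w), sq_nonneg (rho u (some w))]

/-- The length-area inequality. -/
lemma length_area {u : sierpinskiCarpet p → ℝ} (hu : IsA u) {c d C : ℝ} (hC : 0 ≤ C)
    (h : ∀ y ∈ Ioo c d, ∃ z z' : sierpinskiCarpet p, (z : ℂ) ∈ line p y univ ∧
      (z' : ℂ) ∈ line p y univ ∧ C ≤ |u z - u z'|) :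
    C * (d - c) ≤ ∑' w : Word p, hs w * rho u (some w) := by
  classical
  refine le_of_forall_pos_le_add fun ε hε => ?_
  obtain ⟨n, hn⟩ := exists_sum_osc_le hu hε
  have hmeas : ∀ w : Word p, Measurable fun y : ℝ =>
      if hy w < y ∧ y < hy w + hs w then ENNReal.ofReal (rho u (some w)) else 0 :=
    fun w => measurable_ite_Ioo _ _ _
  have h1 : ∫⁻ _ in Ioo c d, ENNReal.ofReal C ≤ ∫⁻ y, (∑' w : Word p,
      (if hy w < y ∧ y < hy w + hs w then ENNReal.ofReal (rho u (some w)) else 0)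
        + cellVar u n y) := by
    refine (setLIntegral_mono ((Measurable.ennreal_tsum hmeas).add (measurable_cellVar u n))
      fun y hy' => ?_).trans (setLIntegral_le_lintegral _ _)
    obtain ⟨z, z', hz, hz', hC'⟩ := h y hy'
    have := line_estimate hu.cont n ordConnected_univ hz hz'
    simp only [subset_univ, and_true] at this
    exact (ENNReal.ofReal_le_ofReal hC').trans this
  rw [setLIntegral_const, Real.volume_Ioo, lintegral_add_right _ (measurable_cellVar u n),
    lintegral_cellVar, lintegral_tsum fun w => (hmeas w).aemeasurable,
    ← ENNReal.ofReal_mul hC] at h1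
  have h2 : ∀ w : Word p, ∫⁻ y, (if hy w < y ∧ y < hy w + hs w
      then ENNReal.ofReal (rho u (some w)) else 0) = ENNReal.ofReal (hs w * rho u (some w)) := by
    intro w
    rw [lintegral_ite_Ioo, add_sub_cancel_left, ENNReal.ofReal_mul (hs_pos w).le]
  simp only [h2] at h1
  have hnn : ∀ w : Word p, 0 ≤ hs w * rho u (some w) :=
    fun w => mul_nonneg (hs_pos w).le (rho_nonneg _ _)
  rw [← ENNReal.ofReal_tsum_of_nonneg hnn (summable_hs_mul_rho hu),
    ← ENNReal.ofReal_add (tsum_nonneg hnn)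
      (Finset.sum_nonneg fun w _ => mul_nonneg (sc_pos w).le (osc_nonneg _ _)),
    ENNReal.ofReal_le_ofReal_iff (add_nonneg (tsum_nonneg hnn)
      (Finset.sum_nonneg fun w _ => mul_nonneg (sc_pos w).le (osc_nonneg _ _)))] at h1
  linarith

end

end Carpet

namespace Carpet

open MeasureTheory

noncomputable section

variable {p : ℕ} [OddBase p]

lemma summable_mul_of_sq {ι : Type*} {a b : ι → ℝ} (ha0 : ∀ i, 0 ≤ a i) (hb0 : ∀ i, 0 ≤ b i)
    (ha : Summable fun i => a i ^ 2) (hb : Summable fun i => b i ^ 2) :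
    Summable fun i => a i * b i :=
  Summable.of_nonneg_of_le (fun i => mul_nonneg (ha0 i) (hb0 i))
    (fun i => by nlinarith [sq_nonneg (a i - b i), sq_nonneg (a i), sq_nonneg (b i)]) (ha.add hb)

lemma En_le_of_le {u h : sierpinskiCarpet p → ℝ} (hu : IsA u) {C : ℝ} (hC : 0 ≤ C)
    (hle : ∀ x y, |h x - h y| ≤ C * |u x - u y|) : En h ≤ C ^ 2 * En u := by
  have hh := hu.of_le_one hC hle
  rw [En, En, ← tsum_mul_left]
  refine hh.summ'.tsum_le_tsum (fun w => ?_) (hu.summ'.mul_left _)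
  rw [← mul_pow]
  refine pow_le_pow_left₀ (rho_nonneg _ _) (osc_le (mul_nonneg hC (rho_nonneg _ _)) ?_) 2
  intro x hx y hy
  exact (hle x y).trans (mul_le_mul_of_nonneg_left (le_osc hu.cont _ hx hy) hC)

lemma sq_le_En {u : sierpinskiCarpet p → ℝ} (hu : IsA u) {L : ℝ} (hL : 0 ≤ L)
    (h : L ≤ ∑' w : Word p, hs w * rho u (some w)) : L ^ 2 ≤ En u := by
  rcases hL.eq_or_lt with rfl | hL
  · simpa using En_nonneg u
  have h1 : ∑' w : Word p, hs w * rho u (some w) ≤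
      ∑' w : Word p, (L / 2 * hs w ^ 2 + 1 / (2 * L) * rho u (some w) ^ 2) := by
    refine (summable_hs_mul_rho hu).tsum_le_tsum (fun w => ?_)
      ((summable_hs_sq.mul_left _).add (hu.summ'.mul_left _))
    have : L / 2 * hs w ^ 2 + 1 / (2 * L) * rho u (some w) ^ 2 - hs w * rho u (some w) =
        (L * hs w - rho u (some w)) ^ 2 / (2 * L) := by field_simp; ring
    have h2 : 0 ≤ (L * hs w - rho u (some w)) ^ 2 / (2 * L) := by positivity
    linarith
  rw [Summable.tsum_add (summable_hs_sq.mul_left _) (hu.summ'.mul_left _), tsum_mul_left,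
    tsum_mul_left] at h1
  have h2 : L / 2 * ∑' w : Word p, hs w ^ 2 ≤ L / 2 * 1 :=
    mul_le_mul_of_nonneg_left tsum_hs_sq_le (by positivity)
  have h3 : L / 2 ≤ 1 / (2 * L) * En u := by rw [En]; linarith
  rw [div_mul_eq_mul_div, one_mul, le_div_iff₀ (by positivity)] at h3
  nlinarith

/-- Distance to the boundary of the unit square. -/
def bd (z : ℂ) : ℝ := min (min z.re (1 - z.re)) (min z.im (1 - z.im))

lemma abs_bd_sub_le (z z' : ℂ) : |bd z - bd z'| ≤ dist z z' := by
  have hre : |z.re - z'.re| ≤ dist z z' := by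
    rw [Complex.dist_eq, ← Complex.sub_re]; exact Complex.abs_re_le_norm _
  have him : |z.im - z'.im| ≤ dist z z' := by
    rw [Complex.dist_eq, ← Complex.sub_im]; exact Complex.abs_im_le_norm _
  refine (abs_min_sub_min_le_max _ _ _ _).trans (max_le ?_ ?_) <;>
    refine (abs_min_sub_min_le_max _ _ _ _).trans (max_le (by assumption) ?_)
  · rwa [show 1 - z.re - (1 - z'.re) = -(z.re - z'.re) by ring, abs_neg]
  · rwa [show 1 - z.im - (1 - z'.im) = -(z.im - z'.im) by ring, abs_neg]

lemma bd_nonneg {z : ℂ} (hz : z ∈ csq 0 0 1) : 0 ≤ bd z := by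
  obtain ⟨⟨h1, h2⟩, h3, h4⟩ := hz
  exact le_min (le_min h1 (by linarith)) (le_min h3 (by linarith))

lemma mem_circ_none_iff {z : ℂ} (hz : z ∈ csq 0 0 1) :
    z ∈ circ (none : Option (Word p)) ↔ bd z = 0 := by
  have h0 := bd_nonneg hz
  have h1 : z ∈ osq 0 0 1 ↔ 0 < bd z := by
    simp only [bd, lt_min_iff, osq, Set.mem_ofPred_eq]
    constructor
    · rintro ⟨⟨a, b⟩, c, d⟩; exact ⟨⟨a, by linarith⟩, c, by linarith⟩
    · rintro ⟨⟨a, b⟩, c, d⟩; exact ⟨⟨a, by linarith⟩, c, by linarith⟩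
  constructor
  · rintro ⟨-, h2⟩
    rw [h1, not_lt] at h2
    exact le_antisymm h2 h0
  · intro h2
    exact ⟨hz, fun h3 => absurd (h1.1 h3) (by rw [h2]; exact lt_irrefl _)⟩

lemma third_le_hx_nil : 1 / 3 ≤ hx ([] : Word p) ∧ hx ([] : Word p) + hs ([] : Word p) ≤ 2 / 3 ∧
    1 / 3 ≤ hy ([] : Word p) ∧ hy ([] : Word p) + hs ([] : Word p) ≤ 2 / 3 := by
  have h1 := two_hx ([] : Word p)
  have h2 := two_hy ([] : Word p)
  have h3 := hs_le ([] : Word p)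
  simp only [sc_nil, cx_nil, cy_nil] at h1 h2 h3
  refine ⟨?_, ?_, ?_, ?_⟩ <;> linarith

lemma bd_ge_of_mem {z : ℂ} (hz : z ∈ circ (some ([] : Word p))) : 1 / 3 ≤ bd z := by
  obtain ⟨⟨h1, h2⟩, h3, h4⟩ := circ_some_subset_chole _ hz
  obtain ⟨k1, k2, k3, k4⟩ := third_le_hx_nil (p := p)
  refine le_min (le_min ?_ ?_) (le_min ?_ ?_) <;> linarith

/-- Competitors for the modulus of the family of curves joining the outer and middle squares. -/
structure IsComp (u : sierpinskiCarpet p → ℝ) : Prop where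
  isA : IsA u
  zero : ∀ x ∈ circX none, u x = 0
  one : ∀ x ∈ circX (some []), u x = 1

/-- The cutoff function equal to `1` at distance at least `δ` from the outer square. -/
def cutoff (δ : ℝ) (x : sierpinskiCarpet p) : ℝ := min 1 (bd x / δ)

lemma abs_cutoff_sub_le {δ : ℝ} (hδ : 0 < δ) (x y : sierpinskiCarpet p) :
    |cutoff δ x - cutoff δ y| ≤ 1 / δ * dist x y := by
  refine (abs_min_sub_min_le_max _ _ _ _).trans (max_le ?_ ?_)
  · rw [sub_self, abs_zero]; positivity
  · rw [← sub_div, abs_div, abs_of_pos hδ, div_mul_eq_mul_div, one_mul]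
    exact div_le_div_of_nonneg_right (abs_bd_sub_le _ _) hδ.le

lemma isComp_cutoff {δ : ℝ} (hδ : 0 < δ) (hδ' : δ ≤ 1 / 3) :
    IsComp (cutoff δ : sierpinskiCarpet p → ℝ) := by
  refine ⟨IsA.of_lipschitz (by positivity) (abs_cutoff_sub_le hδ), fun x hx => ?_, fun x hx => ?_⟩
  · rw [cutoff, (mem_circ_none_iff (p := p) (carpet_subset_unit x.2)).1 hx]; simp
  · rw [cutoff, min_eq_left]
    rw [le_div_iff₀ hδ, one_mul]
    exact hδ'.trans (bd_ge_of_mem hx)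

variable (p) in
/-- The transboundary modulus of the family of curves joining the outer and middle squares. -/
def md : ℝ := sInf (En '' {u : sierpinskiCarpet p → ℝ | IsComp u})

lemma md_le {u : sierpinskiCarpet p → ℝ} (hu : IsComp u) : md p ≤ En u :=
  csInf_le ⟨0, by rintro _ ⟨v, -, rfl⟩; exact En_nonneg v⟩ ⟨u, hu, rfl⟩

lemma exists_mem_line_none {y : ℝ} (hy' : y ∈ Icc (0 : ℝ) 1) :
    ∃ z : sierpinskiCarpet p, z ∈ circX none ∧ (z : ℂ) ∈ line p y univ ∧ (z : ℂ).re = 0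
      ∧ (z : ℂ).im = y := by
  have h0 : (⟨0, y⟩ : ℂ) ∈ circ (none : Option (Word p)) := by
    rw [mem_circ_none_iff]
    · have := hy'.1; have := hy'.2
      simp only [bd]
      rw [min_eq_left (a := (0 : ℝ)) (by norm_num), min_eq_left]
      exact le_min hy'.1 (by linarith)
    · exact ⟨⟨le_rfl, by norm_num⟩, hy'.1, by simpa using hy'.2⟩
  exact ⟨⟨_, circ_subset_carpet none h0⟩, h0, Or.inl ⟨circ_subset_carpet none h0, rfl, trivial⟩,
    rfl, rfl⟩

lemma inv_sq_le_En {u : sierpinskiCarpet p → ℝ} (hu : IsComp u) : (1 / (p : ℝ)) ^ 2 ≤ En u := by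
  have hp := p_pos (p := p)
  refine sq_le_En hu.isA (by positivity) ?_
  have h := length_area hu.isA (c := hy ([] : Word p)) (d := hy ([] : Word p) + hs ([] : Word p))
    zero_le_one ?_
  · rw [add_sub_cancel_left, one_mul] at h
    refine le_trans (le_of_eq ?_) h
    simp [hs]
  · intro y hy'
    have hr := hole_range ([] : Word p)
    obtain ⟨z, hz, hzl, -⟩ := exists_mem_line_none (p := p) (y := y)
      ⟨by linarith [hy'.1], by linarith [hy'.2]⟩
    obtain ⟨z', hz'⟩ := circX_nonempty (p := p) (some [])
    refine ⟨z, z', hzl, Or.inr ⟨[], hy', subset_univ _, hz'⟩, ?_⟩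
    rw [hu.zero z hz, hu.one z' hz']; norm_num

lemma md_pos : 0 < md p := by
  have hp := p_pos (p := p)
  refine lt_of_lt_of_le (show 0 < (1 / (p : ℝ)) ^ 2 by positivity) (le_csInf ?_ ?_)
  · exact ⟨_, _, isComp_cutoff (by norm_num) le_rfl, rfl⟩
  · rintro _ ⟨v, hv, rfl⟩; exact inv_sq_le_En hv

lemma exists_bd_of_isOpen {V : Set (sierpinskiCarpet p)} (hV : IsOpen V) (h : circX none ⊆ V) :
    ∃ δ > 0, ∀ x : sierpinskiCarpet p, bd x < δ → x ∈ V := by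
  have hbc : Continuous fun x : sierpinskiCarpet p => bd x :=
    (LipschitzWith.of_dist_le_mul (K := 1) fun x y => by
      rw [NNReal.coe_one, one_mul]; exact abs_bd_sub_le x y).continuous
  rcases Vᶜ.eq_empty_or_nonempty with he | hne
  · refine ⟨1, one_pos, fun x _ => ?_⟩
    rw [compl_empty_iff] at he; rw [he]; trivial
  · obtain ⟨x₀, hx₀, hmin⟩ := hV.isClosed_compl.isCompact.exists_isMinOn hne hbc.continuousOn
    refine ⟨bd x₀, ?_, fun x hx => ?_⟩
    · refine lt_of_le_of_ne (bd_nonneg (carpet_subset_unit x₀.2)) fun h0 => hx₀ (h ?_)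
      exact (mem_circ_none_iff (p := p) (carpet_subset_unit x₀.2)).2 h0.symm
    · by_contra hxV
      exact absurd (hmin hxV) (not_le.2 hx)

/-- Almost minimal competitors with values in `[0, 1]` vanishing near the outer square. -/
structure IsGood (u : sierpinskiCarpet p → ℝ) : Prop extends IsComp u where
  nonneg : ∀ x, 0 ≤ u x
  le_one : ∀ x, u x ≤ 1
  near : ∃ δ > 0, ∀ x : sierpinskiCarpet p, bd x < δ → u x = 0

lemma exists_good {ε : ℝ} (hε : 0 < ε) :
    ∃ u : sierpinskiCarpet p → ℝ, IsGood u ∧ En u ≤ md p + ε := by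
  obtain ⟨_, ⟨u, hu, rfl⟩, hlt⟩ := exists_lt_of_csInf_lt
    (show (En '' {u : sierpinskiCarpet p → ℝ | IsComp u}).Nonempty from
      ⟨_, _, isComp_cutoff (by norm_num) le_rfl, rfl⟩)
    (show sInf (En '' {u : sierpinskiCarpet p → ℝ | IsComp u}) < md p + ε / 2 by
      unfold md; linarith)
  have hcont : Filter.Tendsto (fun a : ℝ => (1 / (1 - a)) ^ 2 * (md p + ε / 2))
      (nhdsWithin 0 (Ioi 0)) (nhds ((1 / (1 - 0)) ^ 2 * (md p + ε / 2))) := by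
    refine Filter.Tendsto.mono_left (ContinuousAt.tendsto ?_) nhdsWithin_le_nhds
    have : ContinuousAt (fun a : ℝ => 1 / (1 - a)) 0 :=
      continuousAt_const.div (by fun_prop) (by norm_num)
    fun_prop
  have h1 : ∀ᶠ a in nhdsWithin (0 : ℝ) (Ioi 0), (1 / (1 - a)) ^ 2 * (md p + ε / 2) < md p + ε :=
    hcont.eventually_lt_const (by norm_num; linarith)
  have h2 : ∀ᶠ a in nhdsWithin (0 : ℝ) (Ioi 0), a ∈ Ioo (0 : ℝ) 1 := Ioo_mem_nhdsGT one_pos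
  obtain ⟨a, ha, ha0, ha1⟩ := (h1.and h2).exists
  have hpos : 0 < 1 - a := by linarith
  set v : sierpinskiCarpet p → ℝ := fun x => min 1 (max 0 (1 / (1 - a) * (u x - a))) with hv
  have hlip : ∀ x y, |v x - v y| ≤ 1 / (1 - a) * |u x - u y| := by
    intro x y
    refine (abs_min_sub_min_le_max _ _ _ _).trans (max_le (by simp; positivity) ?_)
    refine (abs_max_sub_max_le_max _ _ _ _).trans (max_le (by simp; positivity) ?_)
    rw [← mul_sub, abs_mul, abs_of_pos (show 0 < 1 / (1 - a) by positivity),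
      show u x - a - (u y - a) = u x - u y by ring]
  have hC : 0 ≤ 1 / (1 - a) := by positivity
  have hneg : ∀ x, u x < a → v x = 0 := by
    intro x hx
    rw [hv]; simp only
    rw [max_eq_left (mul_nonpos_of_nonneg_of_nonpos hC (by linarith))]; norm_num
  refine ⟨v, ⟨⟨hu.isA.of_le_one hC hlip, fun x hx => hneg x ?_, fun x hx => ?_⟩, fun x => ?_,
    fun x => min_le_left _ _, ?_⟩, ?_⟩
  · rw [hu.zero x hx]; exact ha0
  · simp only [hv, hu.one x hx]
    rw [one_div, inv_mul_cancel₀ hpos.ne']; norm_num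
  · exact le_min zero_le_one (le_max_left _ _)
  · obtain ⟨δ, hδ, h⟩ := exists_bd_of_isOpen (V := {x | u x < a})
      (isOpen_lt hu.isA.cont continuous_const) fun x hx => by
        rw [Set.mem_ofPred_eq, hu.zero x hx]; exact ha0
    exact ⟨δ, hδ, fun x hx => hneg x (h x hx)⟩
  · refine (En_le_of_le hu.isA hC hlip).trans (le_trans ?_ ha.le)
    exact mul_le_mul_of_nonneg_left hlt.le (sq_nonneg _)

lemma rho_comb_le {u g : sierpinskiCarpet p → ℝ} (hu : Continuous u) (hg : Continuous g) {s t : ℝ}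
    (hs' : 0 ≤ s) (ht : 0 ≤ t) (i : Option (Word p)) :
    rho (fun x => s * u x + t * g x) i ≤ s * rho u i + t * rho g i := by
  refine osc_le (add_nonneg (mul_nonneg hs' (rho_nonneg _ _)) (mul_nonneg ht (rho_nonneg _ _))) ?_
  intro x hx y hy
  rw [show s * u x + t * g x - (s * u y + t * g y) = s * (u x - u y) + t * (g x - g y) by ring]
  refine (abs_add_le _ _).trans ?_
  rw [abs_mul, abs_mul, abs_of_nonneg hs', abs_of_nonneg ht]
  exact add_le_add (mul_le_mul_of_nonneg_left (le_osc hu _ hx hy) hs')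
    (mul_le_mul_of_nonneg_left (le_osc hg _ hx hy) ht)

lemma En_comb_le {u g : sierpinskiCarpet p → ℝ} (hu : IsA u) (hg : IsA g) {s t : ℝ}
    (hs' : 0 ≤ s) (ht : 0 ≤ t) : En (fun x => s * u x + t * g x) ≤
      s ^ 2 * En u + 2 * s * t * ∑' w : Word p, rho u (some w) * rho g (some w) + t ^ 2 * En g := by
  have hsm : Summable fun w : Word p => rho u (some w) * rho g (some w) :=
    summable_mul_of_sq (fun _ => rho_nonneg _ _) (fun _ => rho_nonneg _ _) hu.summ' hg.summ'
  rw [En, En, En, ← tsum_mul_left, ← tsum_mul_left, ← tsum_mul_left,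
    ← Summable.tsum_add (hu.summ'.mul_left _) (hsm.mul_left _),
    ← Summable.tsum_add ((hu.summ'.mul_left _).add (hsm.mul_left _)) (hg.summ'.mul_left _)]
  refine ((hu.const_mul s).add (hg.const_mul t)).summ'.tsum_le_tsum (fun w => ?_)
    (((hu.summ'.mul_left _).add (hsm.mul_left _)).add (hg.summ'.mul_left _))
  refine (pow_le_pow_left₀ (rho_nonneg _ _) (rho_comb_le hu.cont hg.cont hs' ht _) 2).trans
    (le_of_eq ?_)
  ring

lemma IsComp.comb {u g : sierpinskiCarpet p → ℝ} (hu : IsComp u) (hg : IsComp g) (t : ℝ) :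
    IsComp fun x => (1 - t) * u x + t * g x :=
  ⟨(hu.isA.const_mul _).add (hg.isA.const_mul _), fun x hx => by
    rw [hu.zero x hx, hg.zero x hx]; ring, fun x hx => by rw [hu.one x hx, hg.one x hx]; ring⟩

/-- The approximate Euler-Lagrange inequality. -/
lemma euler_lagrange {u g : sierpinskiCarpet p → ℝ} (hu : IsComp u) (hg : IsComp g) {ε t : ℝ}
    (hε : En u ≤ md p + ε) (ht : 0 < t) (ht1 : t ≤ 1) :
    md p - ε / (2 * t) - t * (md p + ε + En g) / 2 ≤
      ∑' w : Word p, rho u (some w) * rho g (some w) := by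
  have h1 := (md_le (hu.comb hg t)).trans
    (En_comb_le hu.isA hg.isA (by linarith : 0 ≤ 1 - t) ht.le)
  set S := ∑' w : Word p, rho u (some w) * rho g (some w) with hS
  have hS0 : 0 ≤ S := tsum_nonneg fun w => mul_nonneg (rho_nonneg _ _) (rho_nonneg _ _)
  have h2 : (1 - t) ^ 2 * En u ≤ (1 - t) ^ 2 * (md p + ε) :=
    mul_le_mul_of_nonneg_left hε (sq_nonneg _)
  have h3 : 2 * t * (md p - ε / (2 * t) - t * (md p + ε + En g) / 2) ≤ 2 * t * S := by
    have : 2 * t * (md p - ε / (2 * t) - t * (md p + ε + En g) / 2) =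
      2 * t * md p - ε - t ^ 2 * (md p + ε + En g) := by field_simp
    rw [this]
    have h5 : 0 ≤ t * (md p + ε - En u) := mul_nonneg ht.le (by linarith)
    have h6 := md_le hu
    have h7 : 0 ≤ t * t * S := by positivity
    nlinarith
  exact le_of_mul_le_mul_left h3 (by positivity)

/-- Small oscillations carry little weight. -/
lemma exists_small_weight {K η : ℝ} (hη : 0 < η) :
    ∃ s > 0, ∀ ρ : Word p → ℝ, (∀ w, 0 ≤ ρ w) → (Summable fun w => ρ w ^ 2) →
      ∑' w, ρ w ^ 2 ≤ K → ∀ a : Word p → ℝ, (∀ w, 0 ≤ a w ∧ a w ≤ ρ w ∧ a w ≤ s) →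
        ∑' w, a w * hs w ≤ η := by
  set β : ℝ := η / (2 * (|K| + 1)) with hβ
  have hK : 0 < |K| + 1 := by positivity
  have hβ0 : 0 < β := by positivity
  obtain ⟨F, hF⟩ := (summable_hs_sq (p := p)).vanishing (Metric.ball_mem_nhds 0
    (show 0 < β * η / 2 by positivity))
  have htail : ∑' w : ((F : Set (Word p))ᶜ : Set (Word p)), hs (w : Word p) ^ 2 ≤ β * η / 2 := by
    refine Real.tsum_le_of_sum_le (fun _ => sq_nonneg _) fun T => ?_
    have := hF (T.map ⟨Subtype.val, Subtype.val_injective⟩) ?_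
    · rw [Finset.sum_map, mem_ball_zero_iff, Real.norm_eq_abs] at this
      exact (le_abs_self _).trans this.le
    · rw [Finset.disjoint_left]
      intro w hw hwF
      simp only [Finset.mem_map, Function.Embedding.coeFn_mk] at hw
      obtain ⟨x, -, rfl⟩ := hw
      exact x.2 hwF
  set S : ℝ := ∑ w ∈ F, hs w with hS
  have hS0 : 0 ≤ S := Finset.sum_nonneg fun w _ => (hs_pos w).le
  refine ⟨η / (2 * (S + 1)), by positivity, fun ρ hρ0 hρs hρK a ha => ?_⟩
  have hsum : Summable fun w => a w * hs w := by
    refine Summable.of_nonneg_of_le (fun w => mul_nonneg (ha w).1 (hs_pos w).le) (fun w => ?_)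
      (summable_mul_of_sq hρ0 (fun w => (hs_pos w).le) hρs summable_hs_sq)
    exact mul_le_mul_of_nonneg_right (ha w).2.1 (hs_pos w).le
  rw [← hsum.sum_add_tsum_compl (s := F)]
  have h1 : ∑ w ∈ F, a w * hs w ≤ η / 2 := by
    calc ∑ w ∈ F, a w * hs w ≤ ∑ w ∈ F, η / (2 * (S + 1)) * hs w :=
          Finset.sum_le_sum fun w _ => mul_le_mul_of_nonneg_right (ha w).2.2 (hs_pos w).le
      _ = η / 2 * (S / (S + 1)) := by rw [← Finset.mul_sum, ← hS]; field_simp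
      _ ≤ η / 2 * 1 := mul_le_mul_of_nonneg_left (by rw [div_le_one (by positivity)]; linarith)
          (by positivity)
      _ = _ := mul_one _
  have hs1 : Summable fun w : ((F : Set (Word p))ᶜ : Set (Word p)) => ρ w ^ 2 := hρs.subtype _
  have hs2 : Summable fun w : ((F : Set (Word p))ᶜ : Set (Word p)) => hs (w : Word p) ^ 2 :=
    summable_hs_sq.subtype _
  have h2 : ∑' w : ((F : Set (Word p))ᶜ : Set (Word p)), a w * hs (w : Word p) ≤ η / 2 := by
    calc ∑' w : ((F : Set (Word p))ᶜ : Set (Word p)), a w * hs (w : Word p)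
        ≤ ∑' w : ((F : Set (Word p))ᶜ : Set (Word p)),
          (β / 2 * ρ w ^ 2 + 1 / (2 * β) * hs (w : Word p) ^ 2) := by
          refine (hsum.subtype _).tsum_le_tsum (fun w => ?_)
            ((hs1.mul_left _).add (hs2.mul_left _))
          refine (mul_le_mul_of_nonneg_right (ha w).2.1 (hs_pos _).le).trans ?_
          have : β / 2 * ρ w ^ 2 + 1 / (2 * β) * hs (w : Word p) ^ 2 - ρ w * hs (w : Word p) =
            (β * ρ w - hs (w : Word p)) ^ 2 / (2 * β) := by field_simp; ring
          have h2 : 0 ≤ (β * ρ w - hs (w : Word p)) ^ 2 / (2 * β) := by positivity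
          linarith
      _ = β / 2 * ∑' w : ((F : Set (Word p))ᶜ : Set (Word p)), ρ w ^ 2 + 1 / (2 * β) *
          ∑' w : ((F : Set (Word p))ᶜ : Set (Word p)), hs (w : Word p) ^ 2 := by
          rw [Summable.tsum_add (hs1.mul_left _) (hs2.mul_left _), tsum_mul_left, tsum_mul_left]
      _ ≤ β / 2 * (|K| + 1) + 1 / (2 * β) * (β * η / 2) := by
          refine add_le_add (mul_le_mul_of_nonneg_left ?_ (by positivity))
            (mul_le_mul_of_nonneg_left htail (by positivity))
          have := hρs.tsum_subtype_le (fun w => ρ w ^ 2) ((F : Set (Word p))ᶜ)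
            (fun _ => sq_nonneg _)
          have h3 := le_abs_self K
          linarith
      _ = η / 2 := by rw [hβ]; field_simp; ring
  linarith

end

end Carpet

namespace Carpet

open MeasureTheory

noncomputable section

variable {p : ℕ} [OddBase p]

/-- The pointwise estimate behind `rho_perturb_le`. -/
lemma perturb_aux {s t c τ ux uy uM um ψx ψy e : ℝ} (ht : 0 ≤ t) (hc : 0 ≤ c) (hτ : 0 ≤ τ)
    (htc : t * τ + t * c ≤ 1) (ht1 : t ≤ 1) (hcx : c ≤ ψx) (hcy : c ≤ ψy) (hy1 : ψy ≤ 1)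
    (hψ : |ψx - ψy| ≤ τ)
    (h1 : um ≤ uy) (h2 : uy ≤ ux) (h3 : ux ≤ uM) (h0 : 0 ≤ um) (he : 0 ≤ e)
    (hs0 : 0 ≤ s) (hcase : uM - um < s → e = t * s * τ) :
    |ux + t * (ψx * max 0 (s - ux)) - (uy + t * (ψy * max 0 (s - uy)))| ≤
      (uM - um) - t * c * (max 0 (s - um) - max 0 (s - uM)) + e := by
  have lip : ∀ a b : ℝ, a ≤ b → max 0 (s - b) ≤ max 0 (s - a) ∧
      max 0 (s - a) - max 0 (s - b) ≤ b - a := by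
    intro a b hab
    refine ⟨max_le_max le_rfl (by linarith), ?_⟩
    rcases le_total 0 (s - b) with h | h
    · rw [max_eq_right h, max_eq_right (by linarith)]; linarith
    · rw [max_eq_left h]
      rcases le_total 0 (s - a) with h' | h'
      · rw [max_eq_right h']; linarith
      · rw [max_eq_left h']; linarith
  obtain ⟨l1, l1'⟩ := lip _ _ h1
  obtain ⟨l2, l2'⟩ := lip _ _ h2
  obtain ⟨l3, l3'⟩ := lip _ _ h3
  have has : max 0 (s - ux) ≤ s := max_le hs0 (by linarith)
  have haM : 0 ≤ max 0 (s - uM) := le_max_left _ _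
  have ha0 : 0 ≤ max 0 (s - ux) := le_max_left _ _
  have hMs : s ≤ uM → max 0 (s - uM) = 0 := fun h => max_eq_left (by linarith)
  generalize max 0 (s - ux) = a at *
  generalize max 0 (s - uy) = b at *
  generalize max 0 (s - uM) = aM at *
  generalize max 0 (s - um) = bm at *
  have htc0 : 0 ≤ t * c := mul_nonneg ht hc
  have htτ0 : 0 ≤ t * τ := mul_nonneg ht hτ
  have herr : t * a * τ ≤ (1 - t * c) * (a - aM) + e := by
    by_cases hlt : uM - um < s
    · rw [hcase hlt]
      have : t * τ * a ≤ t * τ * s := mul_le_mul_of_nonneg_left has htτ0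
      have : 0 ≤ (1 - t * c) * (a - aM) := mul_nonneg (by linarith) (by linarith)
      nlinarith
    · rw [hMs (by linarith)]
      have : t * τ * a ≤ (1 - t * c) * a := mul_le_mul_of_nonneg_right (by linarith) ha0
      nlinarith
  rw [abs_le] at hψ ⊢
  have k1 : a * (ψx - ψy) ≤ a * τ := mul_le_mul_of_nonneg_left hψ.2 ha0
  have k2 : a * (ψy - ψx) ≤ a * τ := mul_le_mul_of_nonneg_left (by linarith) ha0
  have k3 : c * (b - a) ≤ ψy * (b - a) := mul_le_mul_of_nonneg_right hcy (by linarith)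
  have k4 : t * ψy * (b - a) ≤ 1 * (b - a) :=
    mul_le_mul_of_nonneg_right (by nlinarith) (by linarith)
  have k5 : t * c * (bm - b) ≤ 1 * (bm - b) :=
    mul_le_mul_of_nonneg_right (by linarith) (by linarith)
  have k6 : t * c * (b - a) ≤ 1 * (b - a) :=
    mul_le_mul_of_nonneg_right (by linarith) (by linarith)
  have k7 : t * (a * (ψx - ψy)) ≤ t * (a * τ) := mul_le_mul_of_nonneg_left k1 ht
  have k8 : t * (a * (ψy - ψx)) ≤ t * (a * τ) := mul_le_mul_of_nonneg_left k2 ht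
  have k9 : t * (c * (b - a)) ≤ t * (ψy * (b - a)) := mul_le_mul_of_nonneg_left k3 ht
  constructor
  · nlinarith
  · nlinarith

lemma exists_extremes {u : sierpinskiCarpet p → ℝ} (hu : Continuous u) (i : Option (Word p)) :
    ∃ xM ∈ circX i, ∃ xm ∈ circX i, (∀ x ∈ circX i, u x ≤ u xM) ∧ (∀ x ∈ circX i, u xm ≤ u x) ∧
      rho u i = u xM - u xm := by
  have hc : IsCompact (circX (p := p) i) := by
    rw [Topology.IsEmbedding.subtypeVal.isCompact_iff, coe_circX]
    exact isCompact_circ i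
  obtain ⟨xM, hM, hM'⟩ := hc.exists_isMaxOn (circX_nonempty i) hu.continuousOn
  obtain ⟨xm, hm, hm'⟩ := hc.exists_isMinOn (circX_nonempty i) hu.continuousOn
  refine ⟨xM, hM, xm, hm, fun x hx => hM' hx, fun x hx => hm' hx, le_antisymm ?_ ?_⟩
  · refine osc_le (sub_nonneg.2 (hm' hM)) fun x hx y hy => ?_
    have h1 : u x ≤ u xM := hM' hx
    have h2 : u y ≤ u xM := hM' hy
    have h3 : u xm ≤ u x := hm' hx
    have h4 : u xm ≤ u y := hm' hy
    rw [abs_le]; constructor <;> linarith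
  · exact (le_abs_self _).trans (le_osc hu _ hM hm)

/-- The perturbation of `u` towards the level `s`, weighted by `ψ`. -/
def perturb (u ψ : sierpinskiCarpet p → ℝ) (s t : ℝ) (x : sierpinskiCarpet p) : ℝ :=
  u x + t * (ψ x * max 0 (s - u x))

lemma isA_perturb {u ψ : sierpinskiCarpet p → ℝ} (hu : IsA u) (hψ : IsA ψ) (s t : ℝ) :
    IsA (perturb u ψ s t) := by
  have h1 : IsA fun x => max 0 (s - u x) := hu.of_le_one zero_le_one fun x y => by
    refine (abs_max_sub_max_le_max _ _ _ _).trans (max_le (by simp) ?_)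
    rw [show s - u x - (s - u y) = -(u x - u y) by ring, abs_neg, one_mul]
  exact hu.add ((hψ.mul h1).const_mul t)

open scoped Classical in
lemma rho_perturb_le {u ψ : sierpinskiCarpet p → ℝ} (hu : Continuous u) (hu0 : ∀ x, 0 ≤ u x)
    {i : Option (Word p)} {s t c τ : ℝ} (hs0 : 0 ≤ s) (ht : 0 ≤ t) (ht' : t ≤ 1 / 2) (hc : 0 ≤ c)
    (hc1 : c ≤ 1) (hτ : 0 ≤ τ) (hτ1 : τ ≤ 1) (hcψ : ∀ x ∈ circX i, c ≤ ψ x ∧ ψ x ≤ 1)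
    (hψ : ∀ x ∈ circX i, ∀ y ∈ circX i, |ψ x - ψ y| ≤ τ) :
    rho (perturb u ψ s t) i ≤ rho u i - t * c * rho (fun x => min (u x) s) i +
      if rho u i < s then t * s * τ else 0 := by
  obtain ⟨xM, hM, xm, hm, hM', hm', hρ⟩ := exists_extremes hu i
  have hmin : ∀ a : ℝ, min a s = s - max 0 (s - a) := by
    intro a
    rcases le_total a s with h | h
    · rw [min_eq_left h, max_eq_right (by linarith)]; ring
    · rw [min_eq_right h, max_eq_left (by linarith)]; ring
  have hθ : rho (fun x => min (u x) s) i ≤ max 0 (s - u xm) - max 0 (s - u xM) := by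
    have key : ∀ x ∈ circX i, max 0 (s - u xM) ≤ max 0 (s - u x) ∧
        max 0 (s - u x) ≤ max 0 (s - u xm) := fun x hx =>
      ⟨max_le_max le_rfl (by linarith [hM' x hx]), max_le_max le_rfl (by linarith [hm' x hx])⟩
    refine osc_le (by linarith [(key xm hm).1]) fun x hx y hy => ?_
    simp only [hmin]
    have := key x hx; have := key y hy
    rw [abs_le]; constructor <;> linarith
  have htc0 : 0 ≤ t * c := mul_nonneg ht hc
  have htc : t * τ + t * c ≤ 1 := by nlinarith
  have main : ∀ x ∈ circX i, ∀ y ∈ circX i, |perturb u ψ s t x - perturb u ψ s t y| ≤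
      rho u i - t * c * (max 0 (s - u xm) - max 0 (s - u xM)) +
      if rho u i < s then t * s * τ else 0 := by
    have aux : ∀ x ∈ circX i, ∀ y ∈ circX i, u y ≤ u x →
      |perturb u ψ s t x - perturb u ψ s t y| ≤
      rho u i - t * c * (max 0 (s - u xm) - max 0 (s - u xM)) +
      if rho u i < s then t * s * τ else 0 := by
      intro x hx y hy hxy
      rw [hρ]
      refine perturb_aux ht hc hτ htc (by linarith) (hcψ x hx).1 (hcψ y hy).1 (hcψ y hy).2
        (hψ x hx y hy) (hm' y hy) hxy (hM' x hx) (hu0 xm) ?_ hs0 fun h => if_pos h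
      split_ifs
      · positivity
      · exact le_rfl
    intro x hx y hy
    rcases le_total (u y) (u x) with h | h
    · exact aux x hx y hy h
    · rw [abs_sub_comm]; exact aux y hy x hx h
  refine (osc_le ((abs_nonneg _).trans (main xm hm xm hm)) main).trans ?_
  have := mul_le_mul_of_nonneg_left hθ htc0
  linarith

lemma summable_of_le_sq {a b : Word p → ℝ} {v : sierpinskiCarpet p → ℝ} (hv : IsA v)
    (ha : ∀ w, 0 ≤ a w ∧ a w ≤ rho v (some w)) (hb : ∀ w, 0 ≤ b w ∧ b w ≤ hs w) :
    Summable fun w => a w * b w :=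
  Summable.of_nonneg_of_le (fun w => mul_nonneg (ha w).1 (hb w).1)
    (fun w => mul_le_mul (ha w).2 (hb w).2 (hb w).1 (rho_nonneg _ _))
    (summable_mul_of_sq (fun _ => rho_nonneg _ _) (fun w => (hs_pos w).le) hv.summ' summable_hs_sq)

lemma rho_min_le {u : sierpinskiCarpet p → ℝ} (hu : Continuous u) (s : ℝ) (i : Option (Word p)) :
    rho (fun x => min (u x) s) i ≤ rho u i := by
  refine osc_le (rho_nonneg _ _) fun x hx y hy => ?_
  refine (abs_min_sub_min_le_max _ _ _ _).trans (max_le (le_osc hu _ hx hy) ?_)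
  rw [sub_self, abs_zero]; exact rho_nonneg _ _

lemma isA_min {u : sierpinskiCarpet p → ℝ} (hu : IsA u) (s : ℝ) : IsA fun x => min (u x) s :=
  hu.of_le_one zero_le_one fun x y => by
    refine (abs_min_sub_min_le_max _ _ _ _).trans (max_le (by rw [one_mul]) ?_)
    rw [sub_self, abs_zero]; positivity

lemma hs_le_third (w : Word p) : hs w ≤ 1 / 3 := by
  have := hs_le w; have := sc_le_one w; linarith

open scoped Classical in
lemma En_perturb_le {u ψ : sierpinskiCarpet p → ℝ} (hu : IsA u) (hu0 : ∀ x, 0 ≤ u x) (hψA : IsA ψ)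
    {s t : ℝ} (hs0 : 0 ≤ s) (ht : 0 ≤ t) (ht' : t ≤ 1 / 2) {c : Word p → ℝ}
    (hc : ∀ w, 0 ≤ c w ∧ c w ≤ 1) (hcψ : ∀ w, ∀ x ∈ circX (some w), c w ≤ ψ x ∧ ψ x ≤ 1)
    (hψ : ∀ w, ∀ x ∈ circX (some w), ∀ y ∈ circX (some w), |ψ x - ψ y| ≤ hs w) :
    En (perturb u ψ s t) ≤ (1 + t ^ 2) * En u -
      2 * t * ∑' w, c w * (rho u (some w) * rho (fun x => min (u x) s) (some w)) +
      2 * t * s * ∑' w, (if rho u (some w) < s then rho u (some w) else 0) * hs w +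
      t ^ 2 * s ^ 2 := by
  set ρ : Word p → ℝ := fun w => rho u (some w) with hρ
  set θ : Word p → ℝ := fun w => rho (fun x => min (u x) s) (some w) with hθ
  have hρ0 : ∀ w, 0 ≤ ρ w := fun w => rho_nonneg _ _
  have hθ0 : ∀ w, 0 ≤ θ w := fun w => rho_nonneg _ _
  have hθρ : ∀ w, θ w ≤ ρ w := fun w => rho_min_le hu.cont s _
  have S1 : Summable fun w => ρ w ^ 2 := hu.summ'
  have S2 : Summable fun w => c w * (ρ w * θ w) := by
    refine Summable.of_nonneg_of_le
      (fun w => mul_nonneg (hc w).1 (mul_nonneg (hρ0 w) (hθ0 w))) (fun w => ?_) S1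
    have h1 : ρ w * θ w ≤ ρ w * ρ w := mul_le_mul_of_nonneg_left (hθρ w) (hρ0 w)
    have h2 := mul_le_mul_of_nonneg_right (hc w).2 (mul_nonneg (hρ0 w) (hθ0 w))
    nlinarith
  have S3 : Summable fun w => (if ρ w < s then ρ w else 0) * hs w := by
    refine summable_of_le_sq hu (fun w => ?_) fun w => ⟨(hs_pos w).le, le_rfl⟩
    split_ifs
    · exact ⟨hρ0 w, le_rfl⟩
    · exact ⟨le_rfl, hρ0 w⟩
  have S4 := summable_hs_sq (p := p)
  have hterm : ∀ w, rho (perturb u ψ s t) (some w) ^ 2 ≤ (1 + t ^ 2) * ρ w ^ 2 -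
      2 * t * (c w * (ρ w * θ w)) + 2 * t * s * ((if ρ w < s then ρ w else 0) * hs w) +
      t ^ 2 * s ^ 2 * hs w ^ 2 := by
    intro w
    have hτ := hs_pos w
    have h1 := rho_perturb_le hu.cont hu0 hs0 ht ht' (hc w).1 (hc w).2 hτ.le
      (by linarith [hs_le_third w]) (hcψ w) (hψ w)
    refine (pow_le_pow_left₀ (rho_nonneg _ _) h1 2).trans ?_
    change (ρ w - t * c w * θ w + if ρ w < s then t * s * hs w else 0) ^ 2 ≤ _
    have hA : 0 ≤ t * c w * θ w := mul_nonneg (mul_nonneg ht (hc w).1) (hθ0 w)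
    have hA' : t * c w * θ w ≤ t * ρ w := by
      rw [mul_assoc]
      refine mul_le_mul_of_nonneg_left ?_ ht
      have := mul_le_mul_of_nonneg_right (hc w).2 (hθ0 w)
      linarith [hθρ w]
    have hsq : (t * c w * θ w) ^ 2 ≤ (t * ρ w) ^ 2 := pow_le_pow_left₀ hA hA' 2
    have hst : 0 ≤ t * s * hs w := by positivity
    split_ifs
    · nlinarith [mul_nonneg hA hst]
    · nlinarith [sq_nonneg (t * s * hs w)]
  have S5 := ((S1.mul_left (1 + t ^ 2)).sub (S2.mul_left (2 * t)))
  have S6 := S5.add (S3.mul_left (2 * t * s))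
  have S7 := S6.add (S4.mul_left (t ^ 2 * s ^ 2))
  have h := (isA_perturb hu hψA s t).summ'.tsum_le_tsum hterm S7
  rw [Summable.tsum_add S6 (S4.mul_left _), Summable.tsum_add S5 (S3.mul_left _),
    Summable.tsum_sub (S1.mul_left _) (S2.mul_left _), tsum_mul_left, tsum_mul_left,
    tsum_mul_left, tsum_mul_left] at h
  have h4 : t ^ 2 * s ^ 2 * ∑' w : Word p, hs w ^ 2 ≤ t ^ 2 * s ^ 2 * 1 :=
    mul_le_mul_of_nonneg_left tsum_hs_sq_le (by positivity)
  change _ ≤ (1 + t ^ 2) * ∑' w, ρ w ^ 2 - _ + _ + _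
  unfold En
  linarith

/-- Coordinates of the corners of the unit square. -/
def bv (b : Bool) : ℝ := if b then 1 else 0

/-- The tent function at a corner of the unit square. -/
def tent (e : Bool × Bool) (z : ℂ) : ℝ := 1 - max |z.re - bv e.1| |z.im - bv e.2|

lemma abs_tent_sub_le (e : Bool × Bool) (z z' : ℂ) :
    |tent e z - tent e z'| ≤ max |z.re - z'.re| |z.im - z'.im| := by
  rw [tent, tent, sub_sub_sub_cancel_left, abs_sub_comm]
  refine (abs_max_sub_max_le_max _ _ _ _).trans (max_le_max ?_ ?_)
  · refine (abs_abs_sub_abs_le_abs_sub _ _).trans (le_of_eq ?_); ring_nf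
  · refine (abs_abs_sub_abs_le_abs_sub _ _).trans (le_of_eq ?_); ring_nf

lemma tent_mem {z : ℂ} (hz : z ∈ csq 0 0 1) (e : Bool × Bool) : 0 ≤ tent e z ∧ tent e z ≤ 1 := by
  obtain ⟨⟨h1, h2⟩, h3, h4⟩ := hz
  have hb : ∀ b, 0 ≤ bv b ∧ bv b ≤ 1 := by intro b; cases b <;> simp [bv]
  constructor
  · rw [tent, sub_nonneg]
    refine max_le ?_ ?_ <;> rw [abs_le]
    · have := hb e.1; constructor <;> linarith
    · have := hb e.2; constructor <;> linarith
  · rw [tent]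
    have : 0 ≤ max |z.re - bv e.1| |z.im - bv e.2| := le_max_of_le_left (abs_nonneg _)
    linarith

lemma isA_tent (e : Bool × Bool) : IsA fun x : sierpinskiCarpet p => tent e x :=
  IsA.of_lipschitz zero_le_one fun x y => by
    refine (abs_tent_sub_le e x y).trans ?_
    rw [one_mul, Subtype.dist_eq, Complex.dist_eq, ← Complex.sub_re, ← Complex.sub_im]
    exact max_le (Complex.abs_re_le_norm _) (Complex.abs_im_le_norm _)

lemma exists_tent_ge {w : Word p} (hw : w ≠ []) :
    ∃ e : Bool × Bool, ∀ x ∈ circX (some w), 1 / 4 ≤ tent e x := by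
  have hs9 : hs w ≤ 1 / 9 := by
    obtain ⟨d, v, rfl⟩ := List.exists_cons_of_ne_nil hw
    have h1 := hs_le (d :: v)
    have h2 : sc (d :: v) ≤ 1 / 3 := by
      have h3 := sc_cons d v
      have h4 := sc_le_one v
      have h5 := three_le_real (p := p)
      have h6 := p_pos (p := p)
      rw [h3, div_le_iff₀ h6]
      linarith
    linarith
  have key : ∀ a h : ℝ, 0 ≤ a → a + h ≤ 1 → h ≤ 1 / 9 → ∃ b : Bool, ∀ x, a ≤ x → x ≤ a + h →
      |x - bv b| ≤ 3 / 4 := by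
    intro a h ha ha1 hh
    by_cases h2 : a ≤ 1 / 2
    · refine ⟨false, fun x h3 h4 => ?_⟩
      simp only [bv]; rw [abs_le]
      simp only [Bool.false_eq_true, if_false]
      constructor <;> linarith
    · refine ⟨true, fun x h3 h4 => ?_⟩
      simp only [bv]; rw [abs_le]
      simp only [if_true]
      constructor <;> linarith
  have hr := hole_range w
  obtain ⟨b1, hb1⟩ := key (hx w) (hs w) hr.1.le (by linarith) hs9
  obtain ⟨b2, hb2⟩ := key (hy w) (hs w) hr.2.2.1.le (by linarith) hs9
  refine ⟨(b1, b2), fun x hx' => ?_⟩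
  obtain ⟨⟨h1, h2⟩, h3, h4⟩ := circ_some_subset_chole _ hx'
  have := max_le (hb1 _ h1 h2) (hb2 _ h3 h4)
  rw [tent]; linarith

open scoped Classical in
lemma four_md_le {u : sierpinskiCarpet p → ℝ} (hu : IsGood u) {s t B : ℝ} (hs0 : 0 ≤ s)
    (ht : 0 ≤ t) (ht' : t ≤ 1 / 2)
    (H : ∀ e, md p ≤ En (perturb u (fun x => tent e x) s t) + t ^ 2 * s ^ 2 * B) :
    4 * md p ≤ 4 * (1 + t ^ 2) * En u -
      t / 2 * ∑' w, rho u (some w) * rho (fun x => min (u x) s) (some w) +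
      8 * t * s * ∑' w, (if rho u (some w) < s then rho u (some w) else 0) * hs w +
      4 * (t ^ 2 * s ^ 2 * (1 + B)) := by
  set P : Word p → ℝ := fun w => rho u (some w) * rho (fun x => min (u x) s) (some w) with hP
  set c : Bool × Bool → Word p → ℝ := fun e w =>
    if ∀ x ∈ circX (some w), 1 / 4 ≤ tent e x then 1 / 4 else 0 with hc
  have hc01 : ∀ e w, 0 ≤ c e w ∧ c e w ≤ 1 := by
    intro e w; simp only [hc]; split_ifs <;> norm_num
  have hP0 : ∀ w, 0 ≤ P w := fun w => mul_nonneg (rho_nonneg _ _) (rho_nonneg _ _)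
  have SP : Summable P := summable_mul_of_sq (fun _ => rho_nonneg _ _) (fun _ => rho_nonneg _ _)
    hu.isA.summ' (isA_min hu.isA s).summ'
  have Sc : ∀ e, Summable fun w => c e w * P w := fun e =>
    Summable.of_nonneg_of_le (fun w => mul_nonneg (hc01 e w).1 (hP0 w))
      (fun w => by have := mul_le_mul_of_nonneg_right (hc01 e w).2 (hP0 w); linarith) SP
  have h1 : ∀ e, md p ≤ (1 + t ^ 2) * En u - 2 * t * ∑' w, c e w * P w +
      2 * t * s * ∑' w, (if rho u (some w) < s then rho u (some w) else 0) * hs w +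
      t ^ 2 * s ^ 2 * (1 + B) := by
    intro e
    have := En_perturb_le hu.isA hu.nonneg (isA_tent e) hs0 ht ht' (hc01 e) (fun w x hx => ?_)
      fun w x hx y hy => ?_
    · have := H e; linarith
    · refine ⟨?_, (tent_mem (carpet_subset_unit x.2) e).2⟩
      simp only [hc]; split_ifs with h
      · exact h x hx
      · exact (tent_mem (carpet_subset_unit x.2) e).1
    · have := dist_le_of_mem_csq (circ_some_subset_chole _ hx) (circ_some_subset_chole _ hy)
      exact (abs_tent_sub_le e x y).trans (max_le this.1 this.2)
  have h2 : 1 / 4 * ∑' w, P w ≤ ∑ e, ∑' w, c e w * P w := by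
    rw [← Summable.tsum_finsetSum fun e _ => Sc e, ← tsum_mul_left]
    refine (SP.mul_left _).tsum_le_tsum (fun w => ?_) (summable_sum fun e _ => Sc e)
    rw [← Finset.sum_mul]
    by_cases hw : w = []
    · have : P w = 0 := by
        simp only [hP, hw]
        rw [show rho u (some []) = 0 from osc_eq_zero hu.one, zero_mul]
      rw [this]; simp
    · refine mul_le_mul_of_nonneg_right ?_ (hP0 w)
      obtain ⟨e, he⟩ := exists_tent_ge hw
      refine le_trans (le_of_eq ?_) (Finset.single_le_sum (fun e _ => (hc01 e w).1)
        (Finset.mem_univ e))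
      simp only [hc, if_pos he]
  have h3 := Finset.sum_le_sum fun e (_ : e ∈ (Finset.univ : Finset (Bool × Bool))) => h1 e
  rw [Finset.sum_add_distrib, Finset.sum_add_distrib, Finset.sum_sub_distrib] at h3
  simp only [Finset.sum_const, Finset.card_univ, Fintype.card_prod, Fintype.card_bool,
    nsmul_eq_mul] at h3
  push_cast at h3
  have h4 := mul_le_mul_of_nonneg_left h2 (show 0 ≤ 2 * t by positivity)
  rw [Finset.mul_sum] at h4
  linarith

/-- The perturbations by tent functions decrease the energy too much. -/
lemma tent_contradiction {B : ℝ} (hB : 0 ≤ B)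
    (H : ∀ u : sierpinskiCarpet p → ℝ, IsGood u → ∀ s t : ℝ, 0 < s → s < 1 → 0 ≤ t → t ≤ 1 / 2 →
      ∀ e, md p ≤ En (perturb u (fun x => tent e x) s t) + t ^ 2 * s ^ 2 * B) : False := by
  classical
  set m := md p with hm
  have hm0 : 0 < m := md_pos
  obtain ⟨s₀, hs₀, hw⟩ := exists_small_weight (p := p) (K := m + 1) (show 0 < m / 128 by positivity)
  set s := min s₀ (1 / 2)
  have hs0 : 0 < s := lt_min hs₀ (by norm_num)
  have hs1 : s ≤ 1 / 2 := min_le_right _ _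
  set D := m + 1 + (1 / s) ^ 2 * (m + 1) with hD
  have hD0 : 0 < D := by positivity
  set r := min 1 (m / (2 * D)) with hr
  have hr0 : 0 < r := lt_min one_pos (by positivity)
  have hrD : r * D ≤ m / 2 := by
    have := min_le_right 1 (m / (2 * D))
    rw [← hr, le_div_iff₀ (by positivity)] at this
    linarith
  set t := min (1 / 2) (s * m / (64 * (m + 2 + B))) with ht
  have hmB : 0 < m + 2 + B := by positivity
  have ht0 : 0 < t := lt_min (by norm_num) (by positivity)
  have htD : t * (64 * (m + 2 + B)) ≤ s * m := by
    have := min_le_right (1 / 2) (s * m / (64 * (m + 2 + B)))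
    rwa [← ht, le_div_iff₀ (by positivity)] at this
  set ε := min 1 (min (r * m / 2) (t * s * m / 64)) with hε
  have hε0 : 0 < ε := lt_min one_pos (lt_min (by positivity) (by positivity))
  have hε1 : ε ≤ 1 := min_le_left _ _
  have hε2 : ε ≤ r * m / 2 := (min_le_right _ _).trans (min_le_left _ _)
  have hε3 : ε ≤ t * s * m / 64 := (min_le_right _ _).trans (min_le_right _ _)
  obtain ⟨u, hu, hE⟩ := exists_good (p := p) hε0
  have h1 := four_md_le hu hs0.le ht0.le (min_le_left _ _)
    (H u hu s t hs0 (by linarith) ht0.le (min_le_left _ _))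
  rw [← hm] at h1 hE
  have h2 : ∑' w, (if rho u (some w) < s then rho u (some w) else 0) * hs w ≤ m / 128 := by
    refine hw (fun w => rho u (some w)) (fun w => rho_nonneg _ _) hu.isA.summ'
      (hE.trans (by linarith)) _ fun w => ?_
    split_ifs with h
    · exact ⟨rho_nonneg _ _, le_rfl, h.le.trans (min_le_left _ _)⟩
    · exact ⟨le_rfl, rho_nonneg _ _, hs₀.le⟩
  set g : sierpinskiCarpet p → ℝ := fun x => 1 / s * min (u x) s with hg
  have hlip : ∀ x y, |g x - g y| ≤ 1 / s * |u x - u y| := by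
    intro x y
    rw [hg, ← mul_sub, abs_mul, abs_of_pos (show 0 < 1 / s by positivity)]
    refine mul_le_mul_of_nonneg_left ((abs_min_sub_min_le_max _ _ _ _).trans
      (max_le le_rfl ?_)) (by positivity)
    rw [sub_self, abs_zero]; positivity
  have hgc : IsComp g := by
    refine ⟨(isA_min hu.isA s).const_mul _, fun x hx => ?_, fun x hx => ?_⟩
    · simp only [hg]; rw [hu.zero x hx, min_eq_left hs0.le, mul_zero]
    · simp only [hg]; rw [hu.one x hx, min_eq_right (by linarith)]; field_simp
  have hgE : En g ≤ (1 / s) ^ 2 * (m + 1) :=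
    (En_le_of_le hu.isA (by positivity) hlip).trans
      (mul_le_mul_of_nonneg_left (by linarith) (by positivity))
  have h3 := euler_lagrange hu.toIsComp hgc hE hr0 (min_le_left _ _)
  rw [← hm] at h3
  have hgr : ∀ w : Word p, rho g (some w) ≤ 1 / s * rho (fun x => min (u x) s) (some w) := by
    intro w
    refine osc_le (mul_nonneg (by positivity) (rho_nonneg _ _)) fun x hx y hy => ?_
    simp only [hg]
    rw [← mul_sub, abs_mul, abs_of_pos (show 0 < 1 / s by positivity)]
    exact mul_le_mul_of_nonneg_left (le_osc (isA_min hu.isA s).cont _ hx hy) (by positivity)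
  have h4 : ∑' w : Word p, rho u (some w) * rho g (some w) ≤
      1 / s * ∑' w, rho u (some w) * rho (fun x => min (u x) s) (some w) := by
    rw [← tsum_mul_left]
    refine (summable_mul_of_sq (fun _ => rho_nonneg _ _) (fun _ => rho_nonneg _ _)
      hu.isA.summ' hgc.isA.summ').tsum_le_tsum (fun w => ?_)
      ((summable_mul_of_sq (fun _ => rho_nonneg _ _) (fun _ => rho_nonneg _ _)
      hu.isA.summ' (isA_min hu.isA s).summ').mul_left _)
    have := mul_le_mul_of_nonneg_left (hgr w) (rho_nonneg u (some w))
    linarith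
  set Q := ∑' w, rho u (some w) * rho (fun x => min (u x) s) (some w) with hQ
  have h5 : m / 2 ≤ 1 / s * Q := by
    have e1 : ε / (2 * r) ≤ m / 4 := by
      rw [div_le_iff₀ (by positivity)]; linarith
    have e2 : r * (m + ε + En g) / 2 ≤ m / 4 := by
      have : r * (m + ε + En g) ≤ r * D := mul_le_mul_of_nonneg_left (by linarith) hr0.le
      linarith
    linarith
  have h6 : s * m / 2 ≤ Q := by
    have := mul_le_mul_of_nonneg_left h5 hs0.le
    rw [← mul_assoc, mul_one_div_cancel hs0.ne', one_mul] at this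
    linarith
  have h7 : t / 2 * (s * m / 2) ≤ t / 2 * Q := mul_le_mul_of_nonneg_left h6 (by positivity)
  have h8 : 8 * t * s * ∑' w, (if rho u (some w) < s then rho u (some w) else 0) * hs w ≤
      8 * t * s * (m / 128) := mul_le_mul_of_nonneg_left h2 (by positivity)
  have h9 : 4 * (1 + t ^ 2) * En u ≤ 4 * (1 + t ^ 2) * (m + ε) :=
    mul_le_mul_of_nonneg_left hE (by positivity)
  have h10 : t ^ 2 * s ^ 2 * (1 + B) ≤ t ^ 2 * 1 * (1 + B) := by
    have : s ^ 2 ≤ 1 := by nlinarith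
    gcongr
  have h11 : t * (t * (64 * (m + 2 + B))) ≤ t * (s * m) := mul_le_mul_of_nonneg_left htD ht0.le
  have h12 : t ^ 2 * ε ≤ t ^ 2 * 1 := mul_le_mul_of_nonneg_left hε1 (by positivity)
  have h13 : 0 < t * s * m := by positivity
  nlinarith

end

end Carpet

namespace Carpet

open MeasureTheory

noncomputable section

variable {p : ℕ} [OddBase p]

lemma dist_unemb (w : Word p) (z z' : ℂ) : dist (unemb w z) (unemb w z') = dist z z' / sc w := by
  have h := sc_pos w
  have : unemb w z - unemb w z' = (z - z') / (sc w : ℂ) := by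
    apply Complex.ext
    · rw [Complex.div_ofReal_re]; simp only [unemb, Complex.sub_re]; ring
    · rw [Complex.div_ofReal_im]; simp only [unemb, Complex.sub_im]; ring
  rw [Complex.dist_eq, Complex.dist_eq, this, norm_div, Complex.norm_real, Real.norm_eq_abs,
    abs_of_pos h]

lemma dist_emb (w : Word p) (z z' : ℂ) : dist (emb w z) (emb w z') = sc w * dist z z' := by
  have h := sc_pos w
  have := dist_unemb w (emb w z) (emb w z')
  rw [unemb_emb, unemb_emb] at this
  rw [this]; field_simp

lemma bd_pos_iff {z : ℂ} : 0 < bd z ↔ z ∈ osq 0 0 1 := by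
  simp only [bd, lt_min_iff, osq, Set.mem_ofPred_eq]
  constructor
  · rintro ⟨⟨a, b⟩, c, d⟩; exact ⟨⟨a, by linarith⟩, c, by linarith⟩
  · rintro ⟨⟨a, b⟩, c, d⟩; exact ⟨⟨a, by linarith⟩, c, by linarith⟩

lemma bd_unemb_pos_iff {w : Word p} {z : ℂ} : 0 < bd (unemb w z) ↔ z ∈ ocell w := by
  rw [bd_pos_iff]
  have := emb_mem_osq (a := 0) (b := 0) (s := 1) (w := w) (z := unemb w z)
  rw [← this]; simp [ocell]

lemma abs_bd_unemb_sub_le (w : Word p) (z z' : ℂ) :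
    |bd (unemb w z) - bd (unemb w z')| ≤ dist z z' / sc w := by
  rw [← dist_unemb]; exact abs_bd_sub_le _ _

/-- The self-similarity as a map of the carpet. -/
def embX (w : Word p) (x : sierpinskiCarpet p) : sierpinskiCarpet p :=
  ⟨emb w x, (emb_mem_carpet (carpet_subset_unit x.2)).2 x.2⟩

open scoped Classical in
/-- Inverse of `embX` on the cell, extended arbitrarily. -/
def unembX (w : Word p) (x : sierpinskiCarpet p) : sierpinskiCarpet p :=
  if h : (x : ℂ) ∈ cell w then ⟨unemb w x, (unemb_mem_carpet h).2 x.2⟩ else x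

lemma coe_unembX {w : Word p} {x : sierpinskiCarpet p} (h : (x : ℂ) ∈ cell w) :
    (unembX w x : ℂ) = unemb w x := by
  simp [unembX, h]

lemma embX_mem_cell (w : Word p) (x : sierpinskiCarpet p) : (embX w x : ℂ) ∈ cell w :=
  emb_mem_cell.2 (carpet_subset_unit x.2)

lemma unembX_embX (w : Word p) (x : sierpinskiCarpet p) : unembX w (embX w x) = x := by
  apply Subtype.ext
  rw [coe_unembX (embX_mem_cell w x)]
  exact unemb_emb w x

lemma embX_unembX {w : Word p} {x : sierpinskiCarpet p} (h : (x : ℂ) ∈ cell w) :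
    embX w (unembX w x) = x := by
  apply Subtype.ext
  change emb w (unembX w x) = _
  rw [coe_unembX h, emb_unemb]

open scoped Classical in
/-- Transplantation of a function into a cell. -/
def transplant (w : Word p) (u : sierpinskiCarpet p → ℝ) (x : sierpinskiCarpet p) : ℝ :=
  if (x : ℂ) ∈ cell w then u (unembX w x) else 0

lemma transplant_embX (w : Word p) (u : sierpinskiCarpet p → ℝ) (x : sierpinskiCarpet p) :
    transplant w u (embX w x) = u x := by
  rw [transplant, if_pos (embX_mem_cell w x), unembX_embX]

lemma transplant_eq_zero {w : Word p} {u : sierpinskiCarpet p → ℝ} {δ : ℝ}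
    (hδ : ∀ x : sierpinskiCarpet p, bd x < δ → u x = 0) {x : sierpinskiCarpet p}
    (hx : bd (unemb w x) < δ) : transplant w u x = 0 := by
  rw [transplant]
  split_ifs with h
  · exact hδ _ (by rwa [coe_unembX h])
  · rfl

lemma transplant_eq_zero_of_notMem {w : Word p} {u : sierpinskiCarpet p → ℝ} (hu : IsGood u)
    {x : sierpinskiCarpet p} (hx : (x : ℂ) ∉ ocell w) : transplant w u x = 0 := by
  obtain ⟨δ, hδ, h⟩ := hu.near
  refine transplant_eq_zero h ?_
  rw [← bd_unemb_pos_iff, not_lt] at hx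
  linarith

lemma continuous_bd_unemb (w : Word p) :
    Continuous fun x : sierpinskiCarpet p => bd (unemb w x) := by
  have h := sc_pos w
  refine (LipschitzWith.of_dist_le_mul (K := Real.toNNReal (1 / sc w)) fun x y => ?_).continuous
  refine (abs_bd_unemb_sub_le w x y).trans (le_of_eq ?_)
  rw [div_eq_inv_mul, Real.coe_toNNReal _ (by positivity), one_div]; rfl

lemma continuous_transplant {w : Word p} {u : sierpinskiCarpet p → ℝ} (hu : IsGood u) :
    Continuous (transplant w u) := by
  obtain ⟨δ, hδ, h⟩ := hu.near
  rw [continuous_iff_continuousAt]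
  intro x
  by_cases hx : bd (unemb w x) < δ
  · have hV : {y : sierpinskiCarpet p | bd (unemb w y) < δ} ∈ nhds x :=
      (isOpen_lt (continuous_bd_unemb w) continuous_const).mem_nhds hx
    refine continuousAt_const.congr (f := fun _ => (0 : ℝ)) ?_
    filter_upwards [hV] with y hy
    exact (transplant_eq_zero h hy).symm
  · have hV : {y : sierpinskiCarpet p | 0 < bd (unemb w y)} ∈ nhds x :=
      (isOpen_lt continuous_const (continuous_bd_unemb w)).mem_nhds
        (show 0 < bd (unemb w x) by linarith)
    have hc : ContinuousOn (unembX w) {y : sierpinskiCarpet p | 0 < bd (unemb w y)} := by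
      have hs := sc_pos w
      refine (LipschitzOnWith.of_dist_le_mul (K := Real.toNNReal (1 / sc w))
        fun a ha b hb => ?_).continuousOn
      have ha' := ocell_subset_cell w (bd_unemb_pos_iff.1 ha)
      have hb' := ocell_subset_cell w (bd_unemb_pos_iff.1 hb)
      rw [Subtype.dist_eq, coe_unembX ha', coe_unembX hb', dist_unemb,
        Real.coe_toNNReal _ (by positivity),
        div_eq_inv_mul, one_div]
      rfl
    refine ((hu.isA.cont.comp_continuousOn hc).continuousAt hV).congr ?_
    filter_upwards [hV] with y hy
    rw [transplant, if_pos (ocell_subset_cell w (bd_unemb_pos_iff.1 hy))]; rfl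

lemma pk_transplant {w : Word p} {u : sierpinskiCarpet p → ℝ} (hu : IsGood u) :
    PK (transplant w u) := by
  classical
  obtain ⟨δ, hδ, h⟩ := hu.near
  intro l
  obtain ⟨K, r₁, hr₁, H⟩ := hu.isA.pk l
  have hσ := sc_pos w
  have hl : 0 < 2 * |l| + 1 := by positivity
  refine ⟨K, min (r₁ * sc w) (δ * sc w / (2 * |l| + 1)), lt_min (by positivity) (by positivity),
    fun ι s x a b r hr hd hl' => ?_⟩
  set P : ι → Prop := fun j => δ ≤ bd (unemb w (a j)) ∨ δ ≤ bd (unemb w (b j)) with hP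
  have hzero : ∀ j ∈ s, ¬ P j → (transplant w u (a j) - transplant w u (b j)) ^ 2 = 0 := by
    intro j _ hj
    simp only [hP, not_or, not_le] at hj
    rw [transplant_eq_zero h hj.1, transplant_eq_zero h hj.2]; norm_num
  have hpos : ∀ j ∈ s, P j → (x j : ℂ) ∈ cell w ∧ (a j : ℂ) ∈ cell w ∧ (b j : ℂ) ∈ cell w := by
    intro j hj hPj
    have h1 := (hr j hj).1
    have h2 := (hr j hj).2.trans_le (min_le_right _ _)
    rw [lt_div_iff₀ hl] at h2
    have h3 : l * r j ≤ |l| * r j := mul_le_mul_of_nonneg_right (le_abs_self l) h1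
    have h4 : dist (x j : ℂ) (a j) ≤ |l| * r j := ((hl' j hj).1).trans h3
    have h5 : dist (x j : ℂ) (b j) ≤ |l| * r j := ((hl' j hj).2).trans h3
    have h6 : dist (a j : ℂ) (b j) ≤ 2 * (|l| * r j) := by
      have := dist_triangle_left (a j : ℂ) (b j) (x j); linarith
    have h0 : 0 ≤ |l| * r j := by positivity
    have h7 : 2 * (|l| * r j) < δ * sc w := by nlinarith
    have key : ∀ z z' : ℂ, dist z z' ≤ 2 * (|l| * r j) → δ ≤ bd (unemb w z') → z ∈ cell w := by
      intro z z' hzz hz'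
      apply ocell_subset_cell w
      rw [← bd_unemb_pos_iff]
      have h8 := (abs_le.1 (abs_bd_unemb_sub_le w z z')).1
      have h9 : dist z z' / sc w < δ := by rw [div_lt_iff₀ hσ]; linarith
      linarith
    rcases hPj with hj' | hj'
    · exact ⟨key _ _ (by linarith) hj', key _ _ (by rw [dist_self]; linarith) hj',
        key _ _ (by rwa [dist_comm]) hj'⟩
    · exact ⟨key _ _ (by linarith) hj', key _ _ h6 hj', key _ _ (by rw [dist_self]; linarith) hj'⟩
  have hsum : ∑ j ∈ s, (transplant w u (a j) - transplant w u (b j)) ^ 2 =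
      ∑ j ∈ s.filter P, (u (unembX w (a j)) - u (unembX w (b j))) ^ 2 := by
    rw [Finset.sum_filter]
    refine Finset.sum_congr rfl fun j hj => ?_
    split_ifs with hPj
    · obtain ⟨-, h1, h2⟩ := hpos j hj hPj
      rw [transplant, transplant, if_pos h1, if_pos h2]
    · exact hzero j hj hPj
  rw [hsum]
  refine H ι (s.filter P) (fun j => unembX w (x j)) _ _ (fun j => r j / sc w) ?_ ?_ ?_
  · intro j hj
    have hj := (Finset.mem_filter.1 hj).1
    refine ⟨div_nonneg (hr j hj).1 hσ.le, ?_⟩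
    rw [div_lt_iff₀ hσ]
    exact (hr j hj).2.trans_le (min_le_left _ _)
  · intro j hj k hk hjk
    have hj' := Finset.mem_filter.1 hj
    have hk' := Finset.mem_filter.1 hk
    have key : ∀ j, j ∈ s → P j → ∀ y, y ∈ ball (unembX w (x j)) (r j / sc w) →
        embX w y ∈ ball (x j) (r j) := by
      intro j hj hPj y hy
      have hxj := (hpos j hj hPj).1
      rw [mem_ball, lt_div_iff₀ hσ, Subtype.dist_eq] at hy
      rw [mem_ball, ← embX_unembX hxj, Subtype.dist_eq]
      change dist (emb w y) (emb w (unembX w (x j))) < _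
      rw [dist_emb]; linarith
    rw [Set.disjoint_left]
    intro y hy hy'
    exact Set.disjoint_left.1 (hd j hj'.1 k hk'.1 hjk) (key j hj'.1 hj'.2 y hy)
      (key k hk'.1 hk'.2 y hy')
  · intro j hj
    have hj' := Finset.mem_filter.1 hj
    obtain ⟨h1, h2, h3⟩ := hpos j hj'.1 hj'.2
    rw [Subtype.dist_eq, Subtype.dist_eq, coe_unembX h1, coe_unembX h2, coe_unembX h3, dist_unemb,
      dist_unemb, ← mul_div_assoc]
    exact ⟨div_le_div_of_nonneg_right (hl' j hj'.1).1 hσ.le,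
      div_le_div_of_nonneg_right (hl' j hj'.1).2 hσ.le⟩

lemma exists_of_circ_inter_ocell {w : Word p} {i : Option (Word p)}
    (hi : ∀ v, i ≠ some (w ++ v)) {x : sierpinskiCarpet p} (hx : x ∈ circX i) :
    (x : ℂ) ∉ ocell w := by
  cases i with
  | none =>
    intro h
    exact hx.2 (ocell_subset_ounit w h)
  | some v =>
    refine chole_disjoint_ocell (fun hwv => ?_) (circ_some_subset_chole v hx)
    obtain ⟨t, rfl⟩ := hwv
    exact hi t rfl

lemma exists_embX {w v : Word p} {x : sierpinskiCarpet p} (hx : x ∈ circX (some (w ++ v))) :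
    ∃ y ∈ circX (some v), x = embX w y := by
  have h1 : unemb w x ∈ circ (some v) := by
    rw [← emb_mem_circ (w := w), emb_unemb]; exact hx
  refine ⟨⟨unemb w x, circ_subset_carpet _ h1⟩, h1, ?_⟩
  apply Subtype.ext
  exact (emb_unemb w x).symm

lemma rho_le_of_embX {w v : Word p} {U h : sierpinskiCarpet p → ℝ} (hh : Continuous h)
    (hU : ∀ x, U (embX w x) = h x) : rho U (some (w ++ v)) ≤ rho h (some v) := by
  refine osc_le (rho_nonneg _ _) fun x hx y hy => ?_
  obtain ⟨x', hx', rfl⟩ := exists_embX hx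
  obtain ⟨y', hy', rfl⟩ := exists_embX hy
  rw [hU, hU]
  exact le_osc hh _ hx' hy'

lemma append_injective (w : Word p) : Function.Injective fun v : Word p => some (w ++ v) := by
  intro a b hab
  simpa using hab

/-- Energy comparison for a function modelled on `h` inside a cell and on `g` outside. -/
lemma summable_and_tsum_le {w : Word p} {U h g : sierpinskiCarpet p → ℝ} (hh : IsA h) (hg : IsA g)
    {C : ℝ} (hC : 0 ≤ C) (hU : ∀ x, U (embX w x) = h x)
    (hUg : ∀ x : sierpinskiCarpet p, (x : ℂ) ∉ ocell w → U x = C * g x) :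
    (Summable fun i => rho U i ^ 2) ∧
      ∑' i, rho U i ^ 2 ≤ En h + C ^ 2 * ∑' i, rho g i ^ 2 := by
  set F := Function.extend (fun v : Word p => some (w ++ v)) (fun v => rho h (some v) ^ 2) 0
    with hF
  have SF : Summable F := (summable_extend_zero (append_injective w)).2 hh.summ'
  have hF0 : ∀ i, 0 ≤ F i := by
    intro i
    by_cases hi : ∃ v, some (w ++ v) = i
    · obtain ⟨v, rfl⟩ := hi
      rw [hF, (append_injective w).extend_apply]
      positivity
    · rw [hF, Function.extend_apply' _ _ _ hi]; simp
  have hle : ∀ i, rho U i ^ 2 ≤ F i + C ^ 2 * rho g i ^ 2 := by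
    intro i
    by_cases hi : ∃ v, some (w ++ v) = i
    · obtain ⟨v, rfl⟩ := hi
      rw [hF, (append_injective w).extend_apply]
      have := pow_le_pow_left₀ (rho_nonneg _ _) (rho_le_of_embX (v := v) hh.cont hU) 2
      have h2 : 0 ≤ C ^ 2 * rho g (some (w ++ v)) ^ 2 := by positivity
      linarith
    · push Not at hi
      have h1 : rho U i ≤ C * rho g i := by
        refine osc_le (mul_nonneg hC (rho_nonneg _ _)) fun x hx y hy => ?_
        rw [hUg x (exists_of_circ_inter_ocell (fun v => (hi v).symm) hx),
          hUg y (exists_of_circ_inter_ocell (fun v => (hi v).symm) hy), ← mul_sub, abs_mul,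
          abs_of_nonneg hC]
        exact mul_le_mul_of_nonneg_left (le_osc hg.cont _ hx hy) hC
      have h2 := pow_le_pow_left₀ (rho_nonneg _ _) h1 2
      rw [mul_pow] at h2
      linarith [hF0 i]
  have S := SF.add (hg.summ.mul_left (C ^ 2))
  have hS : Summable fun i => rho U i ^ 2 := Summable.of_nonneg_of_le (fun _ => sq_nonneg _) hle S
  refine ⟨hS, (hS.tsum_le_tsum hle S).trans (le_of_eq ?_)⟩
  rw [Summable.tsum_add SF (hg.summ.mul_left _), tsum_mul_left, hF,
    tsum_extend_zero (append_injective w)]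
  rfl

lemma isA_transplant {w : Word p} {u : sierpinskiCarpet p → ℝ} (hu : IsGood u) :
    IsA (transplant w u) := by
  refine ⟨continuous_transplant hu, pk_transplant hu, ?_⟩
  exact (summable_and_tsum_le hu.isA hu.isA le_rfl (transplant_embX w u) fun x hx => by
    rw [transplant_eq_zero_of_notMem hu hx, zero_mul]).1

/-- The tent function at a corner of a cell. -/
def ctent (w : Word p) (e : Bool × Bool) (x : sierpinskiCarpet p) : ℝ := max 0 (tent e (unemb w x))

lemma isA_ctent (w : Word p) (e : Bool × Bool) : IsA (ctent w e) := by
  have h := sc_pos w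
  refine IsA.of_lipschitz (C := 1 / sc w) (by positivity) fun x y => ?_
  refine (abs_max_sub_max_le_max _ _ _ _).trans (max_le (by simp; positivity) ?_)
  refine (abs_tent_sub_le e _ _).trans ?_
  have : (1 / sc w) * dist x y = dist (unemb w x) (unemb w y) := by
    rw [dist_unemb, Subtype.dist_eq]; ring
  rw [this, Complex.dist_eq, ← Complex.sub_re, ← Complex.sub_im]
  exact max_le (Complex.abs_re_le_norm _) (Complex.abs_im_le_norm _)

lemma ctent_embX (w : Word p) (e : Bool × Bool) (x : sierpinskiCarpet p) :
    ctent w e (embX w x) = tent e x := by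
  rw [ctent, show ((embX w x : sierpinskiCarpet p) : ℂ) = emb w x from rfl, unemb_emb,
    max_eq_right (tent_mem (carpet_subset_unit x.2) e).1]

/-- The transplanted perturbation is a competitor for another pair of circles. -/
lemma md_le_of_transplant {w : Word p} {k : Option (Word p)} {e : Bool × Bool}
    (hk : ∀ x ∈ circX k, (x : ℂ) ∉ ocell w ∧ ctent w e x = 0)
    (H : ∀ U : sierpinskiCarpet p → ℝ, IsA U → (∀ x ∈ circX k, U x = 0) →
      (∀ x ∈ circX (some w), U x = 1) → md p ≤ ∑' i, rho U i ^ 2)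
    {u : sierpinskiCarpet p → ℝ} (hu : IsGood u) {s t : ℝ} (hs0 : 0 < s) (hs1 : s < 1)
    (ht : 0 ≤ t) :
    md p ≤ En (perturb u (fun x => tent e x) s t) + t ^ 2 * s ^ 2 * ∑' i, rho (ctent w e) i ^ 2 := by
  set U := perturb (transplant w u) (ctent w e) s t with hU
  have hUA : IsA U := isA_perturb (isA_transplant hu) (isA_ctent w e) s t
  have hout : ∀ x : sierpinskiCarpet p, (x : ℂ) ∉ ocell w → U x = t * s * ctent w e x := by
    intro x hx
    rw [hU, perturb, transplant_eq_zero_of_notMem hu hx, sub_zero, max_eq_right hs0.le]; ring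
  refine (H U hUA (fun x hx => ?_) fun x hx => ?_).trans ?_
  · rw [hout x (hk x hx).1, (hk x hx).2, mul_zero]
  · obtain ⟨y, hy, rfl⟩ := exists_embX (w := w) (v := []) (by simpa using hx)
    rw [hU, perturb, transplant_embX, hu.one y hy, max_eq_left (by linarith)]; ring
  · rw [← mul_pow]
    refine (summable_and_tsum_le (isA_perturb hu.isA (isA_tent e) s t) (isA_ctent w e)
      (mul_nonneg ht hs0.le) (fun x => ?_) hout).2
    rw [hU, perturb, perturb, transplant_embX, ctent_embX]

end

end Carpet

namespace Carpet

open MeasureTheory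

noncomputable section

variable {p : ℕ} [OddBase p]

lemma perm_swX (i : Option (Word p)) : perm (swX (p := p)) i = i.map wSw := by
  refine perm_eq ?_
  ext z
  constructor
  · rintro ⟨y, hy', rfl⟩
    exact sw_mem_circ.2 hy'
  · intro hz
    refine ⟨swX z, ?_, by ext1; simp⟩
    have : sw (sw (z : ℂ)) ∈ circ (i.map wSw) := by rwa [sw_sw]
    exact sw_mem_circ.1 this

lemma perm_flX (i : Option (Word p)) : perm (flX (p := p)) i = i.map wFl := by
  refine perm_eq ?_
  ext z
  constructor
  · rintro ⟨y, hy', rfl⟩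
    exact fl_mem_circ.2 hy'
  · intro hz
    refine ⟨flX z, ?_, by ext1; simp⟩
    have : fl (fl (z : ℂ)) ∈ circ (i.map wFl) := by rwa [fl_fl]
    exact fl_mem_circ.1 this

variable (p) in
/-- The admissible homeomorphisms that fix the outer and the middle peripheral circles. -/
def Gam0 : Set (sierpinskiCarpet p ≃ₜ sierpinskiCarpet p) :=
  {f | f ∈ Gam (sierpinskiCarpet p) ∧ perm f none = none ∧ perm f (some []) = some []}

lemma Gam0.trans {f g : sierpinskiCarpet p ≃ₜ sierpinskiCarpet p} (hf : f ∈ Gam0 p)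
    (hg : g ∈ Gam0 p) : f.trans g ∈ Gam0 p :=
  ⟨Gam.trans hf.1 hg.1, by rw [perm_trans, hf.2.1, hg.2.1], by rw [perm_trans, hf.2.2, hg.2.2]⟩

lemma Gam0.symm {f : sierpinskiCarpet p ≃ₜ sierpinskiCarpet p} (hf : f ∈ Gam0 p) :
    f.symm ∈ Gam0 p := by
  refine ⟨Gam.symm hf.1, ?_, ?_⟩
  · have := perm_symm_perm f none
    rwa [hf.2.1] at this
  · have := perm_symm_perm f (some [])
    rwa [hf.2.2] at this

lemma swX_mem_Gam0 : swX ∈ Gam0 p := ⟨Gam.of_isometry isometry_swX, perm_swX _, perm_swX _⟩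

lemma flX_mem_Gam0 : flX ∈ Gam0 p := ⟨Gam.of_isometry isometry_flX, perm_flX _, perm_flX _⟩

lemma En_comp {u : sierpinskiCarpet p → ℝ} (hu : IsA u)
    {f : sierpinskiCarpet p ≃ₜ sierpinskiCarpet p} (hf : f ∈ Gam0 p) :
    En (fun x => u (f x)) = En u := by
  have h := tsum_rho_comp u f
  rw [tsum_rho hu, tsum_rho (hu.comp hf.1), rho_comp, hf.2.1] at h
  linarith

lemma IsComp.comp {u : sierpinskiCarpet p → ℝ} (hu : IsComp u)
    {f : sierpinskiCarpet p ≃ₜ sierpinskiCarpet p} (hf : f ∈ Gam0 p) :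
    IsComp fun x => u (f x) :=
  ⟨hu.isA.comp hf.1, fun x hx => hu.zero _ (by rw [← hf.2.1]; exact (mem_circX_perm f).2 hx),
    fun x hx => hu.one _ (by rw [← hf.2.2]; exact (mem_circX_perm f).2 hx)⟩

lemma IsGood.comp {u : sierpinskiCarpet p → ℝ} (hu : IsGood u)
    {f : sierpinskiCarpet p ≃ₜ sierpinskiCarpet p} (hf : f ∈ Gam0 p)
    (hbd : ∀ x, bd (f x : ℂ) = bd x) : IsGood fun x => u (f x) := by
  refine ⟨hu.toIsComp.comp hf, fun x => hu.nonneg _, fun x => hu.le_one _, ?_⟩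
  obtain ⟨δ, hδ, h⟩ := hu.near
  exact ⟨δ, hδ, fun x hx => h _ (by rwa [hbd])⟩

lemma bd_sw (z : ℂ) : bd (sw z) = bd z := by simp [bd, min_comm]

lemma bd_fl (z : ℂ) : bd (fl z) = bd z := by simp [bd, min_comm]

lemma tent_sw (e : Bool × Bool) (z : ℂ) : tent e (sw z) = tent e.swap z := by
  simp [tent, max_comm]

lemma tent_fl (e : Bool × Bool) (z : ℂ) : tent e (fl z) = tent (!e.1, e.2) z := by
  simp only [tent, fl_re, fl_im]
  congr 2
  cases e.1 <;> simp [bv, abs_sub_comm]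

/-- If one corner perturbation is never profitable, then none of them is. -/
lemma corner_symmetry {B : ℝ} {e : Bool × Bool}
    (H : ∀ u : sierpinskiCarpet p → ℝ, IsGood u → ∀ s t : ℝ, 0 < s → s < 1 → 0 ≤ t →
      md p ≤ En (perturb u (fun x => tent e x) s t) + t ^ 2 * s ^ 2 * B) (e' : Bool × Bool) :
    ∀ u : sierpinskiCarpet p → ℝ, IsGood u → ∀ s t : ℝ, 0 < s → s < 1 → 0 ≤ t →
      md p ≤ En (perturb u (fun x => tent e' x) s t) + t ^ 2 * s ^ 2 * B := by
  have hsw : ∀ e : Bool × Bool, (∀ u : sierpinskiCarpet p → ℝ, IsGood u → ∀ s t : ℝ, 0 < s →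
      s < 1 → 0 ≤ t → md p ≤ En (perturb u (fun x => tent e x) s t) + t ^ 2 * s ^ 2 * B) →
      ∀ u : sierpinskiCarpet p → ℝ, IsGood u → ∀ s t : ℝ, 0 < s →
      s < 1 → 0 ≤ t → md p ≤ En (perturb u (fun x => tent e.swap x) s t) + t ^ 2 * s ^ 2 * B := by
    intro e H u hu s t h0 h1 ht
    have h := H _ (hu.comp swX_mem_Gam0 fun x => bd_sw _) s t h0 h1 ht
    rwa [← En_comp (isA_perturb (hu.comp swX_mem_Gam0 fun x => bd_sw _).isA (isA_tent e) s t)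
      swX_mem_Gam0, show (fun x => perturb (fun x => u (swX x)) (fun x => tent e x) s t (swX x))
        = perturb u (fun x => tent e.swap x) s t from ?_] at h
    funext x
    have : swX (swX x) = x := by ext1; simp
    simp only [perturb, this, coe_swX, tent_sw]
  have hfl : ∀ e : Bool × Bool, (∀ u : sierpinskiCarpet p → ℝ, IsGood u → ∀ s t : ℝ, 0 < s →
      s < 1 → 0 ≤ t → md p ≤ En (perturb u (fun x => tent e x) s t) + t ^ 2 * s ^ 2 * B) →
      ∀ u : sierpinskiCarpet p → ℝ, IsGood u → ∀ s t : ℝ, 0 < s → s < 1 → 0 ≤ t →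
      md p ≤ En (perturb u (fun x => tent (!e.1, e.2) x) s t) + t ^ 2 * s ^ 2 * B := by
    intro e H u hu s t h0 h1 ht
    have h := H _ (hu.comp flX_mem_Gam0 fun x => bd_fl _) s t h0 h1 ht
    rwa [← En_comp (isA_perturb (hu.comp flX_mem_Gam0 fun x => bd_fl _).isA (isA_tent e) s t)
      flX_mem_Gam0, show (fun x => perturb (fun x => u (flX x)) (fun x => tent e x) s t (flX x))
        = perturb u (fun x => tent (!e.1, e.2) x) s t from ?_] at h
    funext x
    have : flX (flX x) = x := by ext1; simp
    simp only [perturb, this, coe_flX, tent_fl]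
  obtain ⟨a, b⟩ := e
  obtain ⟨c, d⟩ := e'
  have hfl' := fun e h => hsw _ (hfl _ (hsw e h))
  have h1 := hfl _ H
  have h2 := hfl' _ H
  have h3 := hfl' _ h1
  revert H h1 h2 h3
  cases a <;> cases b <;> cases c <;> cases d <;> intro H h1 h2 h3 <;>
    first | exact H | exact h1 | exact h2 | exact h3

lemma sc_le_third {w : Word p} (hw : w ≠ []) : sc w ≤ 1 / 3 := by
  obtain ⟨d, v, rfl⟩ := List.exists_cons_of_ne_nil hw
  have h3 := sc_cons d v
  have h4 := sc_le_one v
  have h5 := three_le_real (p := p)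
  rw [h3, div_le_iff₀ (by linarith)]
  linarith

lemma ctent_eq_zero {w : Word p} {e : Bool × Bool} {x : sierpinskiCarpet p}
    (h : sc w ≤ |(x : ℂ).re - (cx w + bv e.1 * sc w)| ∨
      sc w ≤ |(x : ℂ).im - (cy w + bv e.2 * sc w)|) : ctent w e x = 0 := by
  have hσ := sc_pos w
  rw [ctent, max_eq_left]
  rw [tent, sub_nonpos, le_max_iff]
  have aux : ∀ a b c : ℝ, (a - b) / sc w - c = (a - (b + c * sc w)) / sc w := by
    intro a b c; field_simp; ring
  refine h.imp (fun h => ?_) fun h => ?_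
  · rw [unemb, aux, abs_div, abs_of_pos hσ, le_div_iff₀ hσ, one_mul]; exact h
  · rw [unemb, aux, abs_div, abs_of_pos hσ, le_div_iff₀ hσ, one_mul]; exact h

lemma exists_corner {w : Word p} (hw : w ≠ []) {k : Option (Word p)}
    (hk : k = none ∨ ∃ v, k = some v ∧ v ≠ w ∧ v.length ≤ w.length) :
    ∃ e, ∀ x ∈ circX k, (x : ℂ) ∉ ocell w ∧ ctent w e x = 0 := by
  have hσ := sc_pos w
  have h3 := sc_le_third hw
  have out : ∀ x ∈ circX k, (x : ℂ) ∉ ocell w := by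
    intro x hx
    refine exists_of_circ_inter_ocell (fun u hu => ?_) hx
    obtain rfl | ⟨v, rfl, hv, hl⟩ := hk
    · cases hu
    · cases hu
      rw [List.length_append] at hl
      exact hv (by rw [List.eq_nil_of_length_eq_zero (show u.length = 0 by omega), List.append_nil])
  suffices h : ∃ e : Bool × Bool, ∀ x ∈ circX k, sc w ≤ |(x : ℂ).re - (cx w + bv e.1 * sc w)| ∨
      sc w ≤ |(x : ℂ).im - (cy w + bv e.2 * sc w)| from
    h.imp fun e he x hx => ⟨out x hx, ctent_eq_zero (he x hx)⟩
  obtain rfl | ⟨v, rfl, hv, hl⟩ := hk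
  · have aux : ∀ c : ℝ, 0 ≤ c → c + sc w ≤ 1 → ∃ b : Bool,
        sc w ≤ c + bv b * sc w ∧ c + bv b * sc w ≤ 1 - sc w := by
      intro c h0 h1
      by_cases hc : c + 2 * sc w ≤ 1
      · exact ⟨true, by simp [bv]; constructor <;> linarith⟩
      · exact ⟨false, by simp [bv]; constructor <;> linarith⟩
    obtain ⟨b, hb⟩ := aux (cx w) (cx_nonneg w) (cx_add_le w)
    obtain ⟨b', hb'⟩ := aux (cy w) (cy_nonneg w) (cy_add_le w)
    refine ⟨(b, b'), fun x hx => ?_⟩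
    have h1 := carpet_subset_unit x.2
    have h2 := (mem_circ_none_iff (p := p) h1).1 hx
    simp only [le_abs]
    rw [bd] at h2
    rcases min_choice (min (x : ℂ).re (1 - (x : ℂ).re)) (min (x : ℂ).im (1 - (x : ℂ).im)) with h | h
    · rw [h] at h2
      left
      rcases min_choice (x : ℂ).re (1 - (x : ℂ).re) with h | h <;> rw [h] at h2
      · right; linarith
      · left; linarith
    · rw [h] at h2
      right
      rcases min_choice (x : ℂ).im (1 - (x : ℂ).im) with h | h <;> rw [h] at h2
      · right; linarith
      · left; linarith
  · have hnp : ¬ w <+: v := fun h => hv (h.eq_of_length (le_antisymm h.length_le hl)).symm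
    have hhs := hs_pos v
    have hsep : hx v + hs v ≤ cx w ∨ cx w + sc w ≤ hx v ∨ hy v + hs v ≤ cy w ∨
        cy w + sc w ≤ hy v := by
      by_contra! h
      obtain ⟨h1, h2, h3, h4⟩ := h
      have key : ∀ a s c l : ℝ, 0 < s → 0 < l → c < a + s → a < c + l →
          ∃ z, (a ≤ z ∧ z ≤ a + s) ∧ (c < z ∧ z < c + l) := by
        intro a s c l hs0 hl0 h1 h2
        obtain h | h := le_or_gt a c
        · refine ⟨(c + min (a + s) (c + l)) / 2, ?_⟩
          have e1 := min_le_left (a + s) (c + l)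
          have e2 := min_le_right (a + s) (c + l)
          have e3 : c < min (a + s) (c + l) := lt_min h1 (by linarith)
          refine ⟨⟨?_, ?_⟩, ?_, ?_⟩ <;> linarith
        · exact ⟨a, ⟨le_rfl, by linarith⟩, h, h2⟩
      obtain ⟨a, ha, ha'⟩ := key _ _ _ _ hhs hσ h1 h2
      obtain ⟨b, hb, hb'⟩ := key _ _ _ _ hhs hσ h3 h4
      exact chole_disjoint_ocell hnp (z := ⟨a, b⟩) ⟨ha, hb⟩ ⟨ha', hb'⟩
    have hmem : ∀ x ∈ circX (some v), (x : ℂ) ∈ chole v := fun x hx => circ_some_subset_chole v hx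
    simp only [le_abs]
    rcases hsep with h | h | h | h
    · refine ⟨(true, true), fun x hx => Or.inl (Or.inr ?_)⟩
      have := (hmem x hx).1.2
      simp [bv]; linarith
    · refine ⟨(false, true), fun x hx => Or.inl (Or.inl ?_)⟩
      have := (hmem x hx).1.1
      simp [bv]; linarith
    · refine ⟨(true, true), fun x hx => Or.inr (Or.inr ?_)⟩
      have := (hmem x hx).2.2
      simp [bv]; linarith
    · refine ⟨(true, false), fun x hx => Or.inr (Or.inl ?_)⟩
      have := (hmem x hx).2.1
      simp [bv]; linarith

lemma not_minimal {w : Word p} (hw : w ≠ []) {k : Option (Word p)}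
    (hk : k = none ∨ ∃ v, k = some v ∧ v ≠ w ∧ v.length ≤ w.length)
    (H : ∀ U : sierpinskiCarpet p → ℝ, IsA U → (∀ x ∈ circX k, U x = 0) →
      (∀ x ∈ circX (some w), U x = 1) → md p ≤ ∑' i, rho U i ^ 2) : False := by
  obtain ⟨e, he⟩ := exists_corner hw hk
  refine tent_contradiction (p := p) (B := ∑' i, rho (ctent w e) i ^ 2)
    (tsum_nonneg fun _ => sq_nonneg _) fun u hu s t h0 h1 ht _ e' => ?_
  exact corner_symmetry (fun u hu s t h0 h1 ht => md_le_of_transplant he H hu h0 h1 ht) e' u hu s t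
    h0 h1 ht

lemma md_le_of_pair {f : sierpinskiCarpet p ≃ₜ sierpinskiCarpet p}
    (hf : f ∈ Gam (sierpinskiCarpet p)) {k l : Option (Word p)}
    (h : (perm f none = k ∧ perm f (some []) = l) ∨ (perm f none = l ∧ perm f (some []) = k))
    {U : sierpinskiCarpet p → ℝ} (hU : IsA U) (h0 : ∀ x ∈ circX k, U x = 0)
    (h1 : ∀ x ∈ circX l, U x = 1) : md p ≤ ∑' i, rho U i ^ 2 := by
  have hA := hU.comp hf
  rw [← tsum_rho_comp U f]
  obtain ⟨rfl, rfl⟩ | ⟨rfl, rfl⟩ := h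
  · have hc : IsComp fun x => U (f x) :=
      ⟨hA, fun x hx => h0 _ ((mem_circX_perm f).2 hx), fun x hx => h1 _ ((mem_circX_perm f).2 hx)⟩
    rw [tsum_rho hA]
    have := md_le hc
    nlinarith [sq_nonneg (rho (fun x => U (f x)) none)]
  · have hle : ∀ x y, |(1 - U (f x)) - (1 - U (f y))| ≤ 1 * |U (f x) - U (f y)| := fun x y => by
      rw [sub_sub_sub_cancel_left, abs_sub_comm, one_mul]
    have hc : IsComp fun x => 1 - U (f x) :=
      ⟨hA.of_le_one zero_le_one hle, fun x hx => by rw [h1 _ ((mem_circX_perm f).2 hx), sub_self],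
        fun x hx => by rw [h0 _ ((mem_circX_perm f).2 hx), sub_zero]⟩
    rw [tsum_rho hA]
    have := md_le hc
    have h2 := En_le_of_le hA zero_le_one hle
    nlinarith [sq_nonneg (rho (fun x => U (f x)) none)]

/-- Admissible homeomorphisms preserve the pair formed by the outer and the middle circles. -/
theorem perm_pair {f : sierpinskiCarpet p ≃ₜ sierpinskiCarpet p}
    (hf : f ∈ Gam (sierpinskiCarpet p)) :
    (perm f none = none ∧ perm f (some []) = some []) ∨
      (perm f none = some [] ∧ perm f (some []) = none) := by
  by_contra hcon
  have hne : perm f none ≠ perm f (some []) := fun h => by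
    have := (permEquiv f).injective h
    cases this
  rcases hi : perm f none with _ | a <;> rcases hj : perm f (some []) with _ | b
  · exact hne (hi.trans hj.symm)
  · have hb : b ≠ [] := by rintro rfl; exact hcon (Or.inl ⟨hi, hj⟩)
    exact not_minimal hb (Or.inl rfl) fun U => md_le_of_pair hf (Or.inl ⟨hi, hj⟩)
  · have ha : a ≠ [] := by rintro rfl; exact hcon (Or.inr ⟨hi, hj⟩)
    exact not_minimal ha (Or.inl rfl) fun U => md_le_of_pair hf (Or.inr ⟨hi, hj⟩)
  · have hab : a ≠ b := by rintro rfl; exact hne (hi.trans hj.symm)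
    have hnil : ∀ {v w : Word p}, v ≠ w → v.length ≤ w.length → w ≠ [] := by
      rintro v _ hvw hl rfl
      exact hvw (List.eq_nil_of_length_eq_zero (by simpa using hl))
    obtain hl | hl := le_total a.length b.length
    · exact not_minimal (hnil hab hl) (Or.inr ⟨a, rfl, hab, hl⟩)
        fun U => md_le_of_pair hf (Or.inl ⟨hi, hj⟩)
    · exact not_minimal (hnil hab.symm hl) (Or.inr ⟨b, rfl, hab.symm, hl⟩)
        fun U => md_le_of_pair hf (Or.inr ⟨hi, hj⟩)

end

end Carpet

namespace Carpet

open MeasureTheory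

noncomputable section

variable {p : ℕ} [OddBase p]

/-! ### Local connectivity -/

lemma isPreconnected_carpet : IsPreconnected (sierpinskiCarpet p) := by
  refine isPreconnected_of_forall (x := 0) fun z hz => ?_
  have hu := carpet_subset_unit hz
  obtain ⟨⟨h1, h2⟩, h3, h4⟩ := hu
  rw [zero_add] at h2 h4
  refine ⟨line p z.im univ ∪ vline p 0 univ, union_subset (line_subset_carpet _ _)
    (vline_subset_carpet _ _), Or.inr (mem_vline.2 (Or.inl ⟨zero_mem_carpet, rfl, trivial⟩)),
    Or.inl (Or.inl ⟨hz, rfl, trivial⟩), ?_⟩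
  exact (isPreconnected_line _ ordConnected_univ).union'
    (line_inter_vline ⟨le_rfl, zero_le_one⟩ ⟨h3, h4⟩ trivial trivial (subset_univ _)
      (subset_univ _)) (isPreconnected_vline _ ordConnected_univ)

instance : PreconnectedSpace (sierpinskiCarpet p) :=
  Subtype.preconnectedSpace isPreconnected_carpet

lemma continuous_embX (w : Word p) : Continuous (embX w) := by
  refine Continuous.subtype_mk (f := fun x : sierpinskiCarpet p => emb w x) ?_ _
  have h1 : Continuous fun x : sierpinskiCarpet p => (x : ℂ).re :=
    Complex.continuous_re.comp continuous_subtype_val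
  have h2 : Continuous fun x : sierpinskiCarpet p => (x : ℂ).im :=
    Complex.continuous_im.comp continuous_subtype_val
  exact Complex.equivRealProdCLM.symm.continuous.comp
    ((continuous_const.add (continuous_const.mul h1)).prodMk
      (continuous_const.add (continuous_const.mul h2)))

lemma exists_cx_eq (w : Word p) : ∃ k : ℕ, cx w = k * sc w := by
  induction w with
  | nil => exact ⟨0, by simp⟩
  | cons d w ih =>
    obtain ⟨k, hk⟩ := ih
    refine ⟨d.1.1 * p ^ w.length + k, ?_⟩
    have hp : (p : ℝ) ≠ 0 := (p_pos (p := p)).ne'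
    rw [cx_cons, sc_cons, hk, sc]
    push_cast
    field_simp

lemma exists_cy_eq (w : Word p) : ∃ k : ℕ, cy w = k * sc w := by
  obtain ⟨k, hk⟩ := exists_cx_eq (wSw w)
  exact ⟨k, by simpa using hk⟩

lemma exists_common_end {k k' : ℕ} {σ a b : ℝ} (hσ : 0 < σ) (ha : k * σ ≤ a ∧ a ≤ k * σ + σ)
    (hb : k' * σ ≤ b ∧ b ≤ k' * σ + σ) (hab : |a - b| < σ) :
    ∃ e e' : Bool, k * σ + σ * bv e = k' * σ + σ * bv e' := by
  rw [abs_lt] at hab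
  have h1 : (k : ℝ) < k' + 2 := by
    by_contra! h
    nlinarith [mul_le_mul_of_nonneg_right h hσ.le]
  have h2 : (k' : ℝ) < k + 2 := by
    by_contra! h
    nlinarith [mul_le_mul_of_nonneg_right h hσ.le]
  have h1' : k < k' + 2 := by exact_mod_cast h1
  have h2' : k' < k + 2 := by exact_mod_cast h2
  obtain h | h | h : k = k' ∨ k = k' + 1 ∨ k' = k + 1 := by omega
  · exact ⟨false, false, by simp [h]⟩
  · exact ⟨false, true, by simp [h, bv]; ring⟩
  · exact ⟨true, false, by simp [h, bv]; ring⟩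

lemma bv_corner_mem (e : Bool × Bool) : (⟨bv e.1, bv e.2⟩ : ℂ) ∈ sierpinskiCarpet p := by
  refine circ_subset_carpet none ?_
  rw [circ_none]
  obtain ⟨a, b⟩ := e
  cases a <;> cases b <;> simp [csq, osq, sqb, bv]

lemma exists_small_connected {n : ℕ} {x y : sierpinskiCarpet p}
    (h : dist x y < ((p : ℝ) ^ n)⁻¹) :
    ∃ K : Set (sierpinskiCarpet p), IsPreconnected K ∧ x ∈ K ∧ y ∈ K ∧
      ∀ z ∈ K, dist z x ≤ 4 * ((p : ℝ) ^ n)⁻¹ := by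
  obtain ⟨w, hw, hxw⟩ := exists_cell n x.2
  obtain ⟨w', hw', hyw⟩ := exists_cell n y.2
  have hs1 : sc w = ((p : ℝ) ^ n)⁻¹ := by rw [sc, hw]
  have hs2 : sc w' = ((p : ℝ) ^ n)⁻¹ := by rw [sc, hw']
  rw [← hs1] at h ⊢
  have hσ := sc_pos w
  obtain ⟨k, hk⟩ := exists_cx_eq w
  obtain ⟨l, hl⟩ := exists_cy_eq w
  obtain ⟨k', hk'⟩ := exists_cx_eq w'
  obtain ⟨l', hl'⟩ := exists_cy_eq w'
  rw [hs2, ← hs1] at hk' hl'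
  have hd : dist (x : ℂ) y < sc w := h
  have hre : |(x : ℂ).re - (y : ℂ).re| < sc w := by
    refine lt_of_le_of_lt ?_ hd
    rw [Complex.dist_eq, ← Complex.sub_re]; exact Complex.abs_re_le_norm _
  have him : |(x : ℂ).im - (y : ℂ).im| < sc w := by
    refine lt_of_le_of_lt ?_ hd
    rw [Complex.dist_eq, ← Complex.sub_im]; exact Complex.abs_im_le_norm _
  have hxw' := hxw
  have hyw' := hyw
  simp only [cell, csq, Set.mem_ofPred_eq, hk, hl, hk', hl', hs2.trans hs1.symm] at hxw' hyw'
  obtain ⟨e1, e1', he1⟩ := exists_common_end hσ hxw'.1 hyw'.1 hre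
  obtain ⟨e2, e2', he2⟩ := exists_common_end hσ hxw'.2 hyw'.2 him
  have hc : embX w ⟨_, bv_corner_mem (p := p) (e1, e2)⟩ =
      embX w' ⟨_, bv_corner_mem (p := p) (e1', e2')⟩ := by
    ext1
    simp only [embX, emb, hk, hl, hk', hl', hs2.trans hs1.symm, he1, he2]
  have hsub : ∀ v : Word p, ∀ z ∈ range (embX v), (z : ℂ) ∈ cell v := by
    rintro v _ ⟨z, rfl⟩; exact embX_mem_cell v z
  refine ⟨range (embX w) ∪ range (embX w'), ?_, Or.inl ⟨_, embX_unembX hxw⟩,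
    Or.inr ⟨_, embX_unembX hyw⟩, ?_⟩
  · exact (isPreconnected_range (continuous_embX w)).union _ ⟨_, rfl⟩ ⟨_, hc.symm⟩
      (isPreconnected_range (continuous_embX w'))
  · rintro z (hz | hz)
    · have := dist_le_two_mul (hsub _ z hz) hxw
      rw [Subtype.dist_eq]; linarith
    · have := dist_le_two_mul (hsub _ z hz) hyw
      have h3 := dist_triangle (z : ℂ) y x
      rw [dist_comm (y : ℂ)] at h3
      rw [Subtype.dist_eq]; linarith [hs2.trans hs1.symm]

/-! ### Logarithmic cutoff functions at the outer square -/

/-- The annular cutoff of radius `r` at `x`. -/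
def annular (x : sierpinskiCarpet p) (r : ℝ) (z : sierpinskiCarpet p) : ℝ :=
  max 0 (min 1 (2 - dist z x / r))

lemma abs_annular_sub_le (x : sierpinskiCarpet p) {r : ℝ} (hr : 0 < r) (z z' : sierpinskiCarpet p) :
    |annular x r z - annular x r z'| ≤ 1 / r * dist z z' := by
  have h0 : 0 ≤ 1 / r * dist z z' := by positivity
  refine (abs_max_sub_max_le_max _ _ _ _).trans (max_le (by simpa using h0) ?_)
  refine (abs_min_sub_min_le_max _ _ _ _).trans (max_le (by simpa using h0) ?_)
  rw [show 2 - dist z x / r - (2 - dist z' x / r) = 1 / r * (dist z' x - dist z x) by ring, abs_mul,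
    abs_of_pos (by positivity : (0 : ℝ) < 1 / r)]
  refine mul_le_mul_of_nonneg_left ?_ (by positivity)
  rw [dist_comm z z']
  exact abs_dist_sub_le _ _ _

lemma annular_eq_one {x z : sierpinskiCarpet p} {r : ℝ} (hr : 0 < r) (h : dist z x ≤ r) :
    annular x r z = 1 := by
  have : dist z x / r ≤ 1 := (div_le_one hr).2 h
  rw [annular, min_eq_left (by linarith), max_eq_right zero_le_one]

lemma annular_eq_zero {x z : sierpinskiCarpet p} {r : ℝ} (hr : 0 < r) (h : 2 * r ≤ dist z x) :
    annular x r z = 0 := by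
  have : 2 ≤ dist z x / r := (le_div_iff₀ hr).2 h
  rw [annular, max_eq_left]
  exact (min_le_right _ _).trans (by linarith)

lemma hs_le_dist {x z : sierpinskiCarpet p} (hx : x ∈ circX none) {w : Word p}
    (hz : (z : ℂ) ∈ chole w) : hs w ≤ dist z x := by
  have h1 := (mem_circ_none_iff (p := p) (carpet_subset_unit x.2)).1 hx
  have h2 := abs_bd_sub_le (z : ℂ) x
  obtain ⟨a, b, c, d⟩ := chole_dist_outer hz
  have h3 : hs w ≤ bd (z : ℂ) := le_min (le_min a (by linarith)) (le_min c (by linarith))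
  rw [h1, sub_zero] at h2
  exact h3.trans ((le_abs_self _).trans h2)

lemma rho_annular_ne_zero {x : sierpinskiCarpet p} (hx : x ∈ circX none) {r : ℝ} (hr : 0 < r)
    {w : Word p} (h : rho (annular x r) (some w) ≠ 0) {z : sierpinskiCarpet p}
    (hz : z ∈ circX (some w)) : r < 3 * dist z x ∧ dist z x < 6 * r := by
  have h1 : ∃ a ∈ circX (some w), r < dist a x := by
    by_contra! hc
    exact h (osc_eq_zero fun a ha => annular_eq_one hr (hc a ha))
  have h2 : ∃ b ∈ circX (some w), dist b x < 2 * r := by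
    by_contra! hc
    exact h (osc_eq_zero fun a ha => annular_eq_zero hr (hc a ha))
  obtain ⟨a, ha, ha'⟩ := h1
  obtain ⟨b, hb, hb'⟩ := h2
  have hch : ∀ c ∈ circX (some w), (c : ℂ) ∈ chole w := fun c hc => circ_some_subset_chole w hc
  have e1 : dist a z ≤ 2 * hs w := dist_le_two_mul (hch a ha) (hch z hz)
  have e2 : dist z b ≤ 2 * hs w := dist_le_two_mul (hch z hz) (hch b hb)
  have e3 := hs_le_dist hx (hch z hz)
  have e4 := hs_le_dist hx (hch b hb)
  have e5 := dist_triangle a z x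
  have e6 := dist_triangle z b x
  constructor <;> linarith

lemma En_annular_le {x : sierpinskiCarpet p} (hx : x ∈ circX none) {r : ℝ} (hr : 0 < r) :
    En (annular x r) ≤ 576 := by
  classical
  have hA : IsA (annular x r) := IsA.of_lipschitz (by positivity) (abs_annular_sub_le x hr)
  refine hA.summ'.tsum_le_of_sum_le fun W => ?_
  set W' := W.filter fun w => rho (annular x r) (some w) ≠ 0
  have h1 : ∑ w ∈ W, rho (annular x r) (some w) ^ 2 = ∑ w ∈ W', rho (annular x r) (some w) ^ 2 := by
    rw [Finset.sum_filter]
    refine Finset.sum_congr rfl fun w _ => ?_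
    split_ifs with h
    · rfl
    · push Not at h; rw [h]; norm_num
  have h2 : ∑ w ∈ W', hs w ^ 2 ≤ (((x : ℂ).re + 6 * r) - ((x : ℂ).re - 6 * r)) *
      (((x : ℂ).im + 6 * r) - ((x : ℂ).im - 6 * r)) := by
    refine box_sum_le (by linarith) (by linarith) W' fun w hw => ?_
    have hw' := (Finset.mem_filter.1 hw).2
    have hc : ∀ c : ℂ, c ∈ circ (some w) → |c.re - (x : ℂ).re| < 6 * r ∧
        |c.im - (x : ℂ).im| < 6 * r := by
      intro c hc
      have h3 := (rho_annular_ne_zero hx hr hw' (z := ⟨c, circ_subset_carpet _ hc⟩) hc).2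
      have h4 : dist c x < 6 * r := h3
      rw [Complex.dist_eq] at h4
      exact ⟨(Complex.sub_re c x ▸ Complex.abs_re_le_norm (c - x)).trans_lt h4,
        (Complex.sub_im c x ▸ Complex.abs_im_le_norm (c - x)).trans_lt h4⟩
    have hh := hs_pos w
    have c1 := hc _ (chole_corner (w := w))
    have c2 := hc ⟨Carpet.hx w + hs w, hy w + hs w⟩ (by
      rw [circ_some]; simp [chole, hole, csq, osq, hh.le])
    simp only [abs_lt] at c1 c2
    obtain ⟨⟨c11, c12⟩, c13, c14⟩ := c1
    obtain ⟨⟨c21, c22⟩, c23, c24⟩ := c2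
    refine ⟨?_, ?_, ?_, ?_⟩ <;> linarith
  rw [h1]
  calc ∑ w ∈ W', rho (annular x r) (some w) ^ 2 ≤ ∑ w ∈ W', (2 * (1 / r)) ^ 2 * hs w ^ 2 := by
        refine Finset.sum_le_sum fun w _ => ?_
        rw [← mul_pow]
        exact pow_le_pow_left₀ (rho_nonneg _ _)
          (rho_le_of_lipschitz (by positivity) (abs_annular_sub_le x hr) w) 2
    _ = (2 * (1 / r)) ^ 2 * ∑ w ∈ W', hs w ^ 2 := by rw [Finset.mul_sum]
    _ ≤ (2 * (1 / r)) ^ 2 * _ := mul_le_mul_of_nonneg_left h2 (by positivity)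
    _ = 576 := by field_simp; ring

lemma sq_sum_of_disjoint {ι : Type*} (s : Finset ι) (a : ι → ℝ)
    (h : ∀ i ∈ s, ∀ j ∈ s, i ≠ j → a i * a j = 0) : (∑ i ∈ s, a i) ^ 2 = ∑ i ∈ s, a i ^ 2 := by
  rw [sq, Finset.sum_mul_sum]
  refine Finset.sum_congr rfl fun i hi => ?_
  rw [Finset.sum_eq_single i (fun j hj hji => h i hi j hj hji.symm) fun hn => absurd hi hn, sq]

/-- Cutoffs at points of the outer square with small energy. -/
lemma exists_log_cutoff {η : ℝ} (hη : 0 < η) : ∃ ρ > 0, ∀ x : sierpinskiCarpet p, x ∈ circX none →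
    ∃ v : sierpinskiCarpet p → ℝ, IsA v ∧ (∀ z, dist z x ≤ ρ → v z = 1) ∧
      (∀ z ∈ circX (some []), v z = 0) ∧ En v ≤ η := by
  classical
  obtain ⟨N, hN⟩ := exists_nat_gt (576 / η)
  have hN0 : (0 : ℝ) < N := lt_trans (by positivity) hN
  set r : ℕ → ℝ := fun k => 1 / 6 * (1 / 20) ^ k with hr
  have hr0 : ∀ k, 0 < r k := fun k => by positivity
  refine ⟨r N, hr0 N, fun x hx => ?_⟩
  set v : sierpinskiCarpet p → ℝ := fun z => (1 / N : ℝ) * ∑ k ∈ Finset.range N, annular x (r k) z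
    with hv
  have hanti : ∀ k l, k < l → 20 * r l ≤ r k := by
    intro k l hkl
    obtain ⟨m, rfl⟩ := Nat.exists_eq_add_of_lt hkl
    have h1 : ((1 : ℝ) / 20) ^ m ≤ 1 := pow_le_one₀ (by norm_num) (by norm_num)
    have h2 : (0 : ℝ) < (1 / 20) ^ k := by positivity
    simp only [hr]
    rw [pow_succ, pow_add]
    nlinarith [mul_le_mul_of_nonneg_left h1 h2.le]
  have hle : ∀ a b, |v a - v b| ≤ (1 / N : ℝ) *
      ∑ k ∈ Finset.range N, |annular x (r k) a - annular x (r k) b| := by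
    intro a b
    rw [hv, ← mul_sub, ← Finset.sum_sub_distrib, abs_mul, abs_of_pos (by positivity)]
    exact mul_le_mul_of_nonneg_left (Finset.abs_sum_le_sum_abs _ _) (by positivity)
  have hak : ∀ k, IsA (annular x (r k)) := fun k =>
    IsA.of_lipschitz (one_div_pos.2 (hr0 k)).le (abs_annular_sub_le x (hr0 k))
  have hA : IsA v := by
    refine IsA.of_lipschitz (C := (1 / N : ℝ) * ∑ k ∈ Finset.range N, 1 / r k) ?_ fun a b => ?_
    · exact mul_nonneg (by positivity) (Finset.sum_nonneg fun k _ => (one_div_pos.2 (hr0 k)).le)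
    · refine (hle a b).trans ?_
      rw [mul_assoc, Finset.sum_mul]
      exact mul_le_mul_of_nonneg_left (Finset.sum_le_sum fun k _ =>
        abs_annular_sub_le x (hr0 k) a b) (by positivity)
  refine ⟨v, hA, fun z hz => ?_, fun z hz => ?_, ?_⟩
  · rw [hv]
    simp only
    rw [Finset.sum_congr rfl (g := fun _ => (1 : ℝ)) fun k hk => annular_eq_one (hr0 k) ?_]
    · simp; field_simp
    · have := hanti k N (Finset.mem_range.1 hk)
      have := hr0 N
      linarith
  · rw [hv]
    simp only
    rw [Finset.sum_eq_zero, mul_zero]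
    intro k _
    refine annular_eq_zero (hr0 k) ?_
    have h1 := bd_ge_of_mem (p := p) (z := (z : ℂ)) hz
    have h2 := (mem_circ_none_iff (p := p) (carpet_subset_unit x.2)).1 hx
    have h3 := abs_bd_sub_le (z : ℂ) x
    rw [h2, sub_zero] at h3
    have h4 : r k ≤ 1 / 6 := by
      have : ((1 : ℝ) / 20) ^ k ≤ 1 := pow_le_one₀ (by norm_num) (by norm_num)
      simp only [hr]; linarith
    have h5 : bd (z : ℂ) ≤ dist (z : ℂ) x := (le_abs_self _).trans h3
    rw [Subtype.dist_eq]; linarith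
  · have hrho : ∀ w, rho v (some w) ^ 2 ≤
        (1 / N : ℝ) ^ 2 * ∑ k ∈ Finset.range N, rho (annular x (r k)) (some w) ^ 2 := by
      intro w
      rw [← sq_sum_of_disjoint, ← mul_pow]
      · refine pow_le_pow_left₀ (rho_nonneg _ _) (osc_le ?_ fun a ha b hb => (hle a b).trans ?_) 2
        · exact mul_nonneg (by positivity) (Finset.sum_nonneg fun k _ => rho_nonneg _ _)
        · exact mul_le_mul_of_nonneg_left (Finset.sum_le_sum fun k _ =>
            le_osc (hak k).cont _ ha hb) (by positivity)
      · intro k _ l _ hkl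
        by_contra hne
        have hk := left_ne_zero_of_mul hne
        have hl := right_ne_zero_of_mul hne
        obtain ⟨z, hz⟩ := circX_nonempty (some w)
        obtain ⟨a1, a2⟩ := rho_annular_ne_zero hx (hr0 k) hk hz
        obtain ⟨b1, b2⟩ := rho_annular_ne_zero hx (hr0 l) hl hz
        have := hr0 k
        have := hr0 l
        obtain h | h := lt_or_gt_of_ne hkl
        · have := hanti k l h; linarith
        · have := hanti l k h; linarith
    have hsum : Summable fun w : Word p => (1 / N : ℝ) ^ 2 *
        ∑ k ∈ Finset.range N, rho (annular x (r k)) (some w) ^ 2 :=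
      (summable_sum fun k _ => (hak k).summ').mul_left _
    calc En v ≤ ∑' w : Word p, (1 / N : ℝ) ^ 2 *
          ∑ k ∈ Finset.range N, rho (annular x (r k)) (some w) ^ 2 :=
          hA.summ'.tsum_le_tsum hrho hsum
      _ = (1 / N : ℝ) ^ 2 * ∑ k ∈ Finset.range N, En (annular x (r k)) := by
          rw [tsum_mul_left, Summable.tsum_finsetSum fun k _ => (hak k).summ']; rfl
      _ ≤ (1 / N : ℝ) ^ 2 * ∑ k ∈ Finset.range N, (576 : ℝ) :=
          mul_le_mul_of_nonneg_left (Finset.sum_le_sum fun k _ => En_annular_le hx (hr0 k))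
            (by positivity)
      _ = 576 / N := by simp; field_simp
      _ ≤ η := by
          rw [div_lt_iff₀ hη] at hN
          rw [div_le_iff₀ hN0]; linarith

end

end Carpet

namespace Carpet

open MeasureTheory

noncomputable section

variable {p : ℕ} [OddBase p]

lemma swX_swX (x : sierpinskiCarpet p) : swX (swX x) = x := by ext1; simp

lemma exists_quiet_line {u : sierpinskiCarpet p → ℝ} (hu : IsA u) {c d C : ℝ} (hC : 0 ≤ C)
    (hcd : c ≤ d) (h : En u < (C * (d - c)) ^ 2) : ∃ y ∈ Ioo c d, ∀ z z' : sierpinskiCarpet p,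
      (z : ℂ) ∈ line p y univ → (z' : ℂ) ∈ line p y univ → |u z - u z'| < C := by
  by_contra! hcon
  have h1 := length_area hu hC hcon
  exact absurd (sq_le_En hu (mul_nonneg hC (by linarith)) h1) (not_le.2 h)

lemma energy_lower_re {u : sierpinskiCarpet p → ℝ} (hu : IsA u) {K : Set (sierpinskiCarpet p)}
    (hK : IsPreconnected K) (h1 : ∀ x ∈ K, u x = 1) (h0 : ∀ x ∈ circX (some []), u x = 0)
    {a b : sierpinskiCarpet p} (ha : a ∈ K) (hb : b ∈ K) {d : ℝ} (hd : 0 ≤ d)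
    (hab : (a : ℂ).re + d ≤ (b : ℂ).re) :
    min ((1 / 3 * hs ([] : Word p)) ^ 2) ((1 / 3 * d) ^ 2) ≤ En u := by
  by_contra! hlt
  rw [lt_min_iff] at hlt
  have hh := hs_pos ([] : Word p)
  obtain ⟨y, hy', hrow⟩ := exists_quiet_line hu (c := hy ([] : Word p))
    (d := hy ([] : Word p) + hs ([] : Word p)) (C := 1 / 3) (by norm_num) (by linarith)
    (by rw [add_sub_cancel_left]; exact hlt.1)
  have hEn : En (fun x => u (swX x)) = En u := En_comp hu swX_mem_Gam0
  obtain ⟨x, hx', hcol⟩ := exists_quiet_line (hu.comp swX_mem_Gam0.1) (c := (a : ℂ).re)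
    (d := (b : ℂ).re) (C := 1 / 3) (by norm_num) (by linarith) (by
      rw [hEn]
      refine hlt.2.trans_le (pow_le_pow_left₀ (by positivity) ?_ 2)
      linarith)
  have hr := hole_range ([] : Word p)
  have hua := carpet_subset_unit a.2
  have hub := carpet_subset_unit b.2
  obtain ⟨q, hq1, hq2⟩ := line_inter_vline (p := p) (x := x) (y := y) (R := univ) (R' := univ)
    ⟨hua.1.1.trans hx'.1.le, hx'.2.le.trans (by linarith [hub.1.2])⟩
    ⟨by linarith [hy'.1, hr.2.2.1], by linarith [hy'.2, hr.2.2.2]⟩ trivial trivial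
    (subset_univ _) (subset_univ _)
  have hcx : Continuous fun z : sierpinskiCarpet p => (z : ℂ).re :=
    Complex.continuous_re.comp continuous_subtype_val
  obtain ⟨k, hk, hkx⟩ := hK.intermediate_value ha hb hcx.continuousOn ⟨hx'.1.le, hx'.2.le⟩
  obtain ⟨m, hm⟩ := circX_nonempty (some ([] : Word p))
  set Q : sierpinskiCarpet p := ⟨q, line_subset_carpet _ _ hq1⟩
  have e1 := hrow Q m hq1 (Or.inr ⟨[], hy', subset_univ _, hm⟩)
  have hswv : ∀ z ∈ vline p x univ, sw z ∈ line p x univ := by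
    rintro _ ⟨z, hz, rfl⟩; simpa using hz
  have e2 := hcol (swX Q) (swX k) (hswv _ hq2)
    (hswv _ (mem_vline.2 (Or.inl ⟨k.2, hkx, trivial⟩)))
  simp only [swX_swX] at e2
  rw [h1 k hk, abs_lt] at e2
  rw [h0 m hm, abs_lt] at e1
  linarith [e1.2, e2.1]

lemma energy_lower {u : sierpinskiCarpet p → ℝ} (hu : IsA u) {K : Set (sierpinskiCarpet p)}
    (hK : IsPreconnected K) (h1 : ∀ x ∈ K, u x = 1) (h0 : ∀ x ∈ circX (some []), u x = 0)
    {a b : sierpinskiCarpet p} (ha : a ∈ K) (hb : b ∈ K) {d : ℝ} (hd : 0 ≤ d)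
    (hab : 2 * d ≤ dist a b) :
    min ((1 / 3 * hs ([] : Word p)) ^ 2) ((1 / 3 * d) ^ 2) ≤ En u := by
  have h := Complex.norm_le_abs_re_add_abs_im ((a : ℂ) - b)
  rw [← Complex.dist_eq, Complex.sub_re, Complex.sub_im] at h
  rw [Subtype.dist_eq] at hab
  have hre : ∀ (v : sierpinskiCarpet p → ℝ), IsA v → ∀ L : Set (sierpinskiCarpet p),
      IsPreconnected L → (∀ x ∈ L, v x = 1) → (∀ x ∈ circX (some []), v x = 0) →
      ∀ a ∈ L, ∀ b ∈ L, d ≤ |(a : ℂ).re - (b : ℂ).re| →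
      min ((1 / 3 * hs ([] : Word p)) ^ 2) ((1 / 3 * d) ^ 2) ≤ En v := by
    intro v hv L hL h1 h0 a ha b hb hd'
    obtain h | h := le_abs.1 hd'
    · exact energy_lower_re hv hL h1 h0 hb ha hd (by linarith)
    · exact energy_lower_re hv hL h1 h0 ha hb hd (by linarith)
  by_cases hc : d ≤ |(a : ℂ).re - (b : ℂ).re|
  · exact hre u hu K hK h1 h0 a ha b hb hc
  · rw [← En_comp hu swX_mem_Gam0]
    refine hre _ (hu.comp swX_mem_Gam0.1) (swX '' K) (hK.image _ swX.continuous.continuousOn) ?_ ?_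
      _ ⟨a, ha, rfl⟩ _ ⟨b, hb, rfl⟩ ?_
    · rintro _ ⟨x, hx, rfl⟩
      rw [swX_swX]; exact h1 x hx
    · intro x hx
      refine h0 _ ?_
      have := (mem_circX_perm swX).2 hx
      rwa [swX_mem_Gam0.2.2] at this
    · simp only [coe_swX, sw_re]
      linarith

/-- The group fixing the outer and middle circles is equicontinuous at the outer circle. -/
theorem equicontinuous_outer {ε : ℝ} (hε : 0 < ε) : ∃ δ > 0, ∀ f ∈ Gam0 p,
    ∀ x ∈ circX none, ∀ y : sierpinskiCarpet p, dist x y < δ → dist (f x) (f y) < ε := by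
  have hh := hs_pos ([] : Word p)
  set η := min ((1 / 3 * hs ([] : Word p)) ^ 2) ((1 / 3 * (ε / 2)) ^ 2) with hη
  have hη0 : 0 < η := lt_min (by positivity) (by positivity)
  obtain ⟨ρ, hρ, H⟩ := exists_log_cutoff (p := p) (half_pos hη0)
  have hp1 : (1 : ℝ) < p := by linarith [three_le_real (p := p)]
  obtain ⟨n, hn⟩ := exists_pow_lt_of_lt_one (show 0 < ρ / 4 by positivity) (inv_lt_one_of_one_lt₀ hp1)
  rw [inv_pow] at hn
  refine ⟨((p : ℝ) ^ n)⁻¹, by have := p_pos (p := p); positivity, fun f hf x hx y hxy => ?_⟩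
  by_contra! hfar
  obtain ⟨K, hK, hxK, hyK, hKball⟩ := exists_small_connected hxy
  obtain ⟨v, hv, hv1, hv0, hvE⟩ := H x hx
  have hfs := Gam0.symm hf
  have key := energy_lower (hv.comp hfs.1) (hK.image f f.continuous.continuousOn)
    (by rintro _ ⟨z, hz, rfl⟩
        rw [Homeomorph.symm_apply_apply]
        exact hv1 z ((hKball z hz).trans (by linarith)))
    (fun z hz => hv0 _ (by
        have := (mem_circX_perm f.symm).2 hz
        rwa [hfs.2.2] at this))
    (mem_image_of_mem f hxK) (mem_image_of_mem f hyK) (half_pos hε).le (by linarith)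
  rw [En_comp hv hfs] at key
  linarith

end

end Carpet

namespace Carpet

open MeasureTheory

noncomputable section

variable {p : ℕ} [OddBase p]

/-- Almost minimal potentials have non-negligible oscillation on circles close to the outer one. -/
lemma exists_near_circle {δ : ℝ} (hδ : 0 < δ) (hδ' : δ ≤ 1 / 3) :
    ∃ τ > 0, ∃ u : sierpinskiCarpet p → ℝ, IsComp u ∧ En u ≤ md p + τ ^ 2 ∧
      ∃ v : Word p, (∃ x ∈ circX (some v), bd (x : ℂ) < δ) ∧ 4 * τ < rho u (some v) := by
  classical
  set m := md p with hm
  have hm0 : 0 < m := md_pos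
  set g : sierpinskiCarpet p → ℝ := cutoff δ with hg
  have hgC : IsComp g := isComp_cutoff hδ hδ'
  have hg0 := En_nonneg g
  obtain ⟨s, hs0, hsw⟩ := exists_small_weight (p := p) (K := m + 1) (show 0 < δ * m / 16 by positivity)
  set t := min 1 (m / (2 * (m + 1 + En g))) with ht
  have hden : 0 < m + 1 + En g := by positivity
  have ht0 : 0 < t := lt_min one_pos (by positivity)
  have htm : t * (m + 1 + En g) ≤ m / 2 := by
    have : t ≤ m / (2 * (m + 1 + En g)) := min_le_right _ _
    calc t * (m + 1 + En g) ≤ m / (2 * (m + 1 + En g)) * (m + 1 + En g) :=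
          mul_le_mul_of_nonneg_right this hden.le
      _ = m / 2 := by field_simp
  set τ := min (s / 4) (min 1 (t * m / 2)) with hτ
  have hτ0 : 0 < τ := lt_min (by positivity) (lt_min one_pos (by positivity))
  have hτ1 : τ ≤ 1 := (min_le_right _ _).trans (min_le_left _ _)
  have hτt : τ ≤ t * m / 2 := (min_le_right _ _).trans (min_le_right _ _)
  have hτs : 4 * τ ≤ s := by have := min_le_left (s / 4) (min 1 (t * m / 2)); linarith
  have hττ : τ ^ 2 ≤ τ := by nlinarith
  obtain ⟨u, hu, huE⟩ := exists_good (p := p) (pow_pos hτ0 2)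
  refine ⟨τ, hτ0, u, hu.toIsComp, huE, ?_⟩
  by_contra! hcon
  have hEL := euler_lagrange hu.toIsComp hgC huE ht0 (min_le_left _ _)
  set a : Word p → ℝ := fun w => if ∃ x ∈ circX (some w), bd (x : ℂ) < δ then rho u (some w) else 0
    with ha
  have ha' : ∀ w, 0 ≤ a w ∧ a w ≤ rho u (some w) ∧ a w ≤ s := by
    intro w
    simp only [ha]
    split_ifs with h
    · obtain ⟨x, hx, hxδ⟩ := h
      exact ⟨rho_nonneg _ _, le_rfl, (hcon w ⟨x, hx, hxδ⟩).trans hτs⟩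
    · exact ⟨le_rfl, rho_nonneg _ _, hs0.le⟩
  have hsum := hsw (fun w => rho u (some w)) (fun w => rho_nonneg _ _) hu.isA.summ'
    (show En u ≤ m + 1 by linarith) a ha'
  have hle : ∀ w, rho u (some w) * rho g (some w) ≤ 2 * (1 / δ) * (a w * hs w) := by
    intro w
    simp only [ha]
    split_ifs with h
    · have := rho_le_of_lipschitz (by positivity) (abs_cutoff_sub_le (p := p) hδ) w
      have := mul_le_mul_of_nonneg_left this (rho_nonneg u (some w))
      linarith
    · push Not at h
      have : rho g (some w) = 0 := osc_eq_zero (c := 1) fun x hx => by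
        rw [hg, cutoff, min_eq_left]
        rw [le_div_iff₀ hδ, one_mul]
        exact h x hx
      rw [this]; simp
  have hsa : Summable fun w => a w * hs w := by
    refine summable_mul_of_sq (fun w => (ha' w).1) (fun w => (hs_pos w).le) ?_ summable_hs_sq
    exact Summable.of_nonneg_of_le (fun w => sq_nonneg _)
      (fun w => pow_le_pow_left₀ (ha' w).1 (ha' w).2.1 2) hu.isA.summ'
  have hSle : ∑' w : Word p, rho u (some w) * rho g (some w) ≤ m / 8 := by
    calc _ ≤ ∑' w : Word p, 2 * (1 / δ) * (a w * hs w) :=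
          (summable_mul_of_sq (fun w => rho_nonneg _ _) (fun w => rho_nonneg _ _) hu.isA.summ'
            hgC.isA.summ').tsum_le_tsum hle (hsa.mul_left _)
      _ = 2 * (1 / δ) * ∑' w : Word p, a w * hs w := tsum_mul_left
      _ ≤ 2 * (1 / δ) * (δ * m / 16) := mul_le_mul_of_nonneg_left hsum (by positivity)
      _ = m / 8 := by field_simp; norm_num
  have h1 : τ ^ 2 / (2 * t) ≤ m / 4 := by
    rw [div_le_iff₀ (by positivity)]
    linarith
  have h2 : t * (m + τ ^ 2 + En g) ≤ t * (m + 1 + En g) :=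
    mul_le_mul_of_nonneg_left (by linarith) ht0.le
  linarith

/-- Almost minimal potentials have almost the same oscillations as their pullbacks. -/
lemma rho_perm_ge {u : sierpinskiCarpet p → ℝ} (hu : IsComp u) {τ : ℝ} (hτ : 0 ≤ τ)
    (hE : En u ≤ md p + τ ^ 2) {f : sierpinskiCarpet p ≃ₜ sierpinskiCarpet p} (hf : f ∈ Gam0 p)
    (v : Word p) : rho u (some v) - 2 * τ ≤ rho u (perm f (some v)) := by
  have hg := hu.comp hf
  set g : sierpinskiCarpet p → ℝ := fun x => u (f x) with hgdef
  have hEg : En g = En u := En_comp hu.isA hf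
  have h1 := (md_le (hu.comb hg (1 / 2))).trans
    (En_comb_le hu.isA hg.isA (by norm_num : (0 : ℝ) ≤ 1 - 1 / 2) (by norm_num))
  have hab := summable_mul_of_sq (fun w => rho_nonneg u (some w)) (fun w => rho_nonneg g (some w))
    hu.isA.summ' hg.isA.summ'
  have hsum : Summable fun w : Word p => (rho u (some w) - rho g (some w)) ^ 2 := by
    refine ((hu.isA.summ'.add hg.isA.summ').sub (hab.mul_left 2)).congr fun w => ?_
    ring
  have htot : ∑' w : Word p, (rho u (some w) - rho g (some w)) ^ 2 =
      En u + En g - 2 * ∑' w : Word p, rho u (some w) * rho g (some w) := by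
    rw [En, En, ← hu.isA.summ'.tsum_add hg.isA.summ', ← tsum_mul_left,
      ← (hu.isA.summ'.add hg.isA.summ').tsum_sub (hab.mul_left 2)]
    exact tsum_congr fun w => by ring
  have hv := hsum.le_tsum v fun w _ => sq_nonneg _
  rw [htot, hEg] at hv
  rw [hEg] at h1
  have h4 : (rho u (some v) - rho g (some v)) ^ 2 ≤ (2 * τ) ^ 2 := by linarith
  have h5 := (abs_le.1 (abs_le_of_sq_le_sq h4 (by positivity))).2
  rw [hgdef, rho_comp] at h5
  linarith

lemma exists_finite_orbit {δ : ℝ} (hδ : 0 < δ) : ∃ v : Word p,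
    (∃ x ∈ circX (some v), bd (x : ℂ) < δ) ∧
      ((fun f : sierpinskiCarpet p ≃ₜ sierpinskiCarpet p => perm f (some v)) '' Gam0 p).Finite := by
  obtain ⟨τ, hτ, u, hu, hE, v, ⟨x, hx, hxδ⟩, hv⟩ :=
    exists_near_circle (p := p) (lt_min hδ (by norm_num : (0 : ℝ) < 1 / 3)) (min_le_right _ _)
  refine ⟨v, ⟨x, hx, hxδ.trans_le (min_le_left _ _)⟩, ?_⟩
  have hfin : {i | (2 * τ) ^ 2 ≤ rho u i ^ 2}.Finite := by
    have := hu.isA.summ.tendsto_cofinite_zero.eventually_lt_const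
      (show (0 : ℝ) < (2 * τ) ^ 2 by positivity)
    rw [Filter.eventually_cofinite] at this
    simpa using this
  refine hfin.subset ?_
  rintro _ ⟨f, hf, rfl⟩
  have := rho_perm_ge hu hτ.le hE hf v
  show (2 * τ) ^ 2 ≤ rho u (perm f (some v)) ^ 2
  exact pow_le_pow_left₀ (by positivity : (0 : ℝ) ≤ 2 * τ) (by linarith) 2

/-- A point of the carpet at small distance from the boundary is close to the outer circle. -/
lemma exists_outer_near {z : sierpinskiCarpet p} : ∃ x : sierpinskiCarpet p, x ∈ circX none ∧
    dist x z = bd (z : ℂ) := by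
  obtain ⟨⟨h1, h2⟩, h3, h4⟩ := carpet_subset_unit z.2
  rw [zero_add] at h2 h4
  have key : ∀ c : ℂ, c ∈ csq 0 0 1 → bd c = 0 → dist c z = bd (z : ℂ) →
      ∃ x : sierpinskiCarpet p, x ∈ circX none ∧ dist x z = bd (z : ℂ) := by
    intro c hc hb hd
    have hc' := (mem_circ_none_iff (p := p) hc).2 hb
    exact ⟨⟨c, circ_subset_carpet _ hc'⟩, hc', hd⟩
  have hre : ∀ a : ℝ, dist (⟨a, (z : ℂ).im⟩ : ℂ) z = |a - (z : ℂ).re| := by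
    intro a
    exact (Complex.dist_of_im_eq (z := ⟨a, (z : ℂ).im⟩) (w := z) rfl).trans (Real.dist_eq _ _)
  have him : ∀ a : ℝ, dist (⟨(z : ℂ).re, a⟩ : ℂ) z = |a - (z : ℂ).im| := by
    intro a
    exact (Complex.dist_of_re_eq (z := ⟨(z : ℂ).re, a⟩) (w := z) rfl).trans (Real.dist_eq _ _)
  have hre0 : 0 ≤ min (z : ℂ).re (1 - (z : ℂ).re) := le_min h1 (by linarith)
  have him0 : 0 ≤ min (z : ℂ).im (1 - (z : ℂ).im) := le_min h3 (by linarith)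
  rcases min_choice (min (z : ℂ).re (1 - (z : ℂ).re)) (min (z : ℂ).im (1 - (z : ℂ).im)) with h | h
  · rcases min_choice (z : ℂ).re (1 - (z : ℂ).re) with h' | h'
    · refine key ⟨0, (z : ℂ).im⟩ (by simp [csq, h3, h4]) ?_ ?_
      · simp [bd, h3, h4]
      · rw [hre, bd, h, h', zero_sub, abs_neg, abs_of_nonneg h1]
    · refine key ⟨1, (z : ℂ).im⟩ (by simp [csq, h3, h4]) ?_ ?_
      · simp [bd, h3, h4]
      · rw [hre, bd, h, h', abs_of_nonneg (by linarith)]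
  · rcases min_choice (z : ℂ).im (1 - (z : ℂ).im) with h' | h'
    · refine key ⟨(z : ℂ).re, 0⟩ (by simp [csq, h1, h2]) ?_ ?_
      · simp [bd, h1, h2]
      · rw [him, bd, h, h', zero_sub, abs_neg, abs_of_nonneg h3]
    · refine key ⟨(z : ℂ).re, 1⟩ (by simp [csq, h1, h2]) ?_ ?_
      · simp [bd, h1, h2]
      · rw [him, bd, h, h', abs_of_nonneg (by linarith)]

/-- There are circles with finite orbit whose stabilizer almost fixes a point of the outer
circle. -/
lemma exists_almost_fixed {ε : ℝ} (hε : 0 < ε) : ∃ v : Word p, ∃ x : sierpinskiCarpet p,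
    x ∈ circX none ∧
    ((fun f : sierpinskiCarpet p ≃ₜ sierpinskiCarpet p => perm f (some v)) '' Gam0 p).Finite ∧
    ∀ f ∈ Gam0 p, perm f (some v) = some v → dist (f x) x < ε := by
  obtain ⟨δ, hδ, H⟩ := equicontinuous_outer (p := p) (half_pos hε)
  have hδ' : 0 < min δ (ε / 6) := lt_min hδ (by positivity)
  obtain ⟨v, ⟨z, hz, hzδ⟩, hfin⟩ := exists_finite_orbit (p := p) hδ'
  obtain ⟨x, hx, hxz⟩ := exists_outer_near (z := z)
  refine ⟨v, x, hx, hfin, fun f hf hfv => ?_⟩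
  have h1 : dist x z < δ := by rw [hxz]; exact hzδ.trans_le (min_le_left _ _)
  have h2 : dist x z < ε / 6 := by rw [hxz]; exact hzδ.trans_le (min_le_right _ _)
  have h3 := H f hf x hx z h1
  have hfz : f z ∈ circX (some v) := by
    have := (mem_circX_perm f).2 hz
    rwa [hfv] at this
  have h4 : dist (f z) z ≤ 2 * hs v :=
    dist_le_two_mul (circ_some_subset_chole v hfz) (circ_some_subset_chole v hz)
  have h5 := hs_le_dist hx (circ_some_subset_chole v hz)
  rw [dist_comm] at h5
  have h6 := dist_triangle (f x) (f z) x
  have h7 := dist_triangle (f z) z x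
  rw [dist_comm z x] at h7
  linarith

end

end Carpet

namespace Carpet

open MeasureTheory

noncomputable section

/-- A continuous lift of an injective circle map that nearly fixes four equidistributed points
is increasing and close to the identity. -/
lemma lift_bounds {F : ℝ → ℝ} {a : ℝ} (hF : ContinuousOn F (Icc a (a + 3 / 4)))
    (hinj : ∀ s ∈ Icc a (a + 3 / 4), ∀ t ∈ Icc a (a + 3 / 4), ∀ n : ℤ, F s - F t = n → s = t)
    (hk : ∀ k : ℕ, k < 4 → ∃ n : ℤ, |F (a + k / 4) - n - (a + k / 4)| ≤ 1 / 16) :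
    StrictMonoOn F (Icc a (a + 3 / 4)) ∧ ∃ n : ℤ,
      (∀ s ∈ Icc a (a + 3 / 4), |F s - n - s| ≤ 5 / 16) ∧
      ∀ s ∈ Icc (a + 1 / 4) (a + 1 / 2), F s - n ∈ Icc (a + 3 / 16) (a + 9 / 16) := by
  have hI : InjOn F (Icc a (a + 3 / 4)) := fun s hs t ht h => hinj s hs t ht 0 (by simp [h])
  have hlt : ∀ s ∈ Icc a (a + 3 / 4), ∀ t ∈ Icc a (a + 3 / 4), F s - F t < 1 := by
    intro s hs t ht
    by_contra! h
    have hsub : uIcc t s ⊆ Icc a (a + 3 / 4) := ordConnected_Icc.uIcc_subset ht hs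
    obtain ⟨q, hq, hqe⟩ := intermediate_value_uIcc (hF.mono hsub)
      (show F t + 1 ∈ uIcc (F t) (F s) from
        mem_uIcc.2 (Or.inl ⟨by linarith, by linarith⟩))
    have := hinj q (hsub hq) t ht 1 (by rw [hqe]; simp)
    rw [this] at hqe
    linarith
  obtain ⟨n0, h0⟩ := hk 0 (by norm_num)
  obtain ⟨n1, h1⟩ := hk 1 (by norm_num)
  obtain ⟨n2, h2⟩ := hk 2 (by norm_num)
  obtain ⟨n3, h3⟩ := hk 3 (by norm_num)
  have e0 : a + ((0 : ℕ) : ℝ) / 4 = a := by norm_num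
  have e1 : a + ((1 : ℕ) : ℝ) / 4 = a + 1 / 4 := by norm_num
  have e2 : a + ((2 : ℕ) : ℝ) / 4 = a + 1 / 2 := by norm_num
  have e3 : a + ((3 : ℕ) : ℝ) / 4 = a + 3 / 4 := by norm_num
  rw [e0, abs_le] at h0
  rw [e1, abs_le] at h1
  rw [e2, abs_le] at h2
  rw [e3, abs_le] at h3
  have m0 : a ∈ Icc a (a + 3 / 4) := ⟨le_rfl, by linarith⟩
  have m1 : a + 1 / 4 ∈ Icc a (a + 3 / 4) := ⟨by linarith, by linarith⟩
  have m2 : a + 1 / 2 ∈ Icc a (a + 3 / 4) := ⟨by linarith, by linarith⟩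
  have m3 : a + 3 / 4 ∈ Icc a (a + 3 / 4) := ⟨by linarith, by linarith⟩
  rcases hF.strictMonoOn_of_injOn_Icc' (by linarith) hI with hm | hm
  · refine ⟨hm, n0, ?_⟩
    have l1 := hm m0 m1 (by linarith)
    have l2 := hm m1 m2 (by linarith)
    have l3 := hm m2 m3 (by linarith)
    have l4 := hlt _ m3 _ m0
    have i1 : n0 ≤ n1 := by
      have : (n0 : ℝ) < n1 + 1 := by linarith
      exact Int.lt_add_one_iff.1 (by exact_mod_cast this)
    have i2 : n1 ≤ n2 := by
      have : (n1 : ℝ) < n2 + 1 := by linarith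
      exact Int.lt_add_one_iff.1 (by exact_mod_cast this)
    have i3 : n2 ≤ n3 := by
      have : (n2 : ℝ) < n3 + 1 := by linarith
      exact Int.lt_add_one_iff.1 (by exact_mod_cast this)
    have i4 : n3 ≤ n0 := by
      have : (n3 : ℝ) < n0 + 1 := by linarith
      exact Int.lt_add_one_iff.1 (by exact_mod_cast this)
    obtain rfl : n1 = n0 := by omega
    obtain rfl : n2 = n1 := by omega
    obtain rfl : n3 = n2 := by omega
    refine ⟨fun s hs => ?_, fun s hs => ?_⟩
    · rw [abs_le]
      have hs1 := hs.1
      have hs2 := hs.2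
      have a0 := hm.monotoneOn m0 hs hs.1
      have a3 := hm.monotoneOn hs m3 hs.2
      rcases le_total s (a + 1 / 4) with q | q
      · have := hm.monotoneOn hs m1 q
        constructor <;> linarith
      have a1 := hm.monotoneOn m1 hs q
      rcases le_total s (a + 1 / 2) with q' | q'
      · have := hm.monotoneOn hs m2 q'
        constructor <;> linarith
      have a2 := hm.monotoneOn m2 hs q'
      constructor <;> linarith
    · have hsJ : s ∈ Icc a (a + 3 / 4) := ⟨by linarith [hs.1], by linarith [hs.2]⟩
      have a1 := hm.monotoneOn m1 hsJ hs.1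
      have a2 := hm.monotoneOn hsJ m2 hs.2
      constructor <;> linarith
  · exfalso
    have l1 := hm m0 m1 (by linarith)
    have l2 := hm m1 m2 (by linarith)
    have l4 := hlt _ m0 _ m2
    have i1 : n1 + 1 ≤ n0 := by
      have : (n1 : ℝ) < n0 := by linarith
      exact Int.add_one_le_iff.2 (by exact_mod_cast this)
    have i2 : n2 + 1 ≤ n1 := by
      have : (n2 : ℝ) < n1 := by linarith
      exact Int.add_one_le_iff.2 (by exact_mod_cast this)
    have : (n2 : ℝ) + 2 ≤ n0 := by exact_mod_cast (by omega : n2 + 2 ≤ n0)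
    linarith

/-- An equicontinuous group of homeomorphisms of a parametrized circle whose elements have lifts
close to the identity acts trivially. -/
lemma fixed_of_lifts {X : Type*} [MetricSpace X] {Q : ℝ → X} (hQc : Continuous Q)
    (hQ : ∀ s t, Q s = Q t → ∃ n : ℤ, s - t = n) {H : Set (X ≃ₜ X)}
    (hsymm : ∀ g ∈ H, g.symm ∈ H) (htrans : ∀ g ∈ H, ∀ h ∈ H, g.trans h ∈ H)
    (heq : ∀ ε > 0, ∃ δ > 0, ∀ g ∈ H, ∀ s y, dist (Q s) y < δ → dist (g (Q s)) (g y) < ε)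
    {a : ℝ} (hlift : ∀ g ∈ H, ∃ F : ℝ → ℝ, ContinuousOn F (Icc a (a + 3 / 4)) ∧
      StrictMonoOn F (Icc a (a + 3 / 4)) ∧ (∀ s ∈ Icc a (a + 3 / 4), Q (F s) = g (Q s)) ∧
      (∀ s ∈ Icc a (a + 3 / 4), |F s - s| ≤ 5 / 16) ∧
      ∀ s ∈ Icc (a + 1 / 4) (a + 1 / 2), F s ∈ Icc (a + 3 / 16) (a + 9 / 16))
    {t : ℝ} (ht : t ∈ Icc (a + 1 / 4) (a + 1 / 2)) {g : X ≃ₜ X} (hg : g ∈ H) :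
    g (Q t) = Q t := by
  have huniq : ∀ s s', Q s = Q s' → |s - s'| ≤ 15 / 16 → s = s' := by
    intro s s' h h'
    obtain ⟨n, hn⟩ := hQ s s' h
    rw [hn] at h'
    have : |(n : ℝ)| < 1 := by linarith
    have h1 : |n| < 1 := by exact_mod_cast this
    rw [Int.abs_lt_one_iff.1 h1] at hn
    simpa [sub_eq_zero] using hn
  choose! F hFc hFm hFQ hFn hFT using hlift
  have hTJ : Icc (a + 3 / 16) (a + 9 / 16) ⊆ Icc a (a + 3 / 4) :=
    Icc_subset_Icc (by linarith) (by linarith)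
  have htJ : t ∈ Icc a (a + 3 / 4) := ⟨by linarith [ht.1], by linarith [ht.2]⟩
  have hcomp : ∀ f ∈ H, ∀ k ∈ H, ∀ l ∈ H, (∀ x, k (f x) = l x) → F k (F f t) = F l t := by
    intro f hf k hk l hl h
    have hfJ := hTJ (hFT f hf t ht)
    refine huniq _ _ ?_ ?_
    · rw [hFQ k hk _ hfJ, hFQ f hf _ htJ, hFQ l hl _ htJ, h]
    · have h1 := abs_le.1 (hFn k hk _ hfJ)
      have h2 := abs_le.1 (hFn f hf _ htJ)
      have h3 := abs_le.1 (hFn l hl _ htJ)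
      rw [abs_le]
      constructor <;> linarith
  set S : Set ℝ := (fun f => F f t) '' H with hS
  have hST : S ⊆ Icc (a + 3 / 16) (a + 9 / 16) := by
    rintro _ ⟨f, hf, rfl⟩
    exact hFT f hf t ht
  have hSne : S.Nonempty := ⟨_, g, hg, rfl⟩
  have hSb : BddAbove S := ⟨_, fun s hs => (hST hs).2⟩
  set m := sSup S with hm
  have hmcl : m ∈ closure S := csSup_mem_closure hSne hSb
  have hmJ : m ∈ Icc a (a + 3 / 4) := hTJ (closure_minimal hST isClosed_Icc hmcl)
  have hfix : ∀ f ∈ H, F f m = m := by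
    intro f hf
    refine le_antisymm ?_ ?_
    · have : (nhdsWithin m S).NeBot := mem_closure_iff_nhdsWithin_neBot.1 hmcl
      have ht : Filter.Tendsto (F f) (nhdsWithin m S) (nhds (F f m)) :=
        ((hFc f hf) m hmJ).mono (hST.trans hTJ)
      refine le_of_tendsto ht ?_
      filter_upwards [self_mem_nhdsWithin] with s hs
      obtain ⟨k, hk, rfl⟩ := hs
      show F f (F k t) ≤ m
      rw [hcomp k hk f hf (k.trans f) (htrans k hk f hf) fun x => rfl]
      exact le_csSup hSb ⟨_, htrans k hk f hf, rfl⟩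
    · refine csSup_le hSne ?_
      rintro _ ⟨k, hk, rfl⟩
      have hk' := htrans k hk _ (hsymm f hf)
      have h1 := hcomp _ hk' f hf k hk fun x => by simp
      show F k t ≤ F f m
      rw [← h1]
      exact (hFm f hf).monotoneOn (hTJ (hFT _ hk' t ht)) hmJ (le_csSup hSb ⟨_, hk', rfl⟩)
  have hfix' : ∀ f ∈ H, f (Q m) = Q m := fun f hf => by rw [← hFQ f hf m hmJ, hfix f hf]
  have hmt : Q m = Q t := by
    refine dist_le_zero.1 (le_of_forall_pos_lt_add fun ε hε => ?_)
    rw [zero_add]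
    obtain ⟨δ, hδ, hE⟩ := heq ε hε
    have hQm : Filter.Tendsto Q (nhdsWithin m S) (nhds (Q m)) :=
      hQc.continuousAt.mono_left nhdsWithin_le_nhds
    have : (nhdsWithin m S).NeBot := mem_closure_iff_nhdsWithin_neBot.1 hmcl
    obtain ⟨s, hs1, k, hk, rfl⟩ :=
      ((hQm.eventually (ball_mem_nhds (Q m) hδ)).and self_mem_nhdsWithin).exists
    rw [hFQ k hk t htJ, dist_comm] at hs1
    have := hE k.symm (hsymm k hk) m _ hs1
    rwa [hfix' _ (hsymm k hk), k.symm_apply_apply] at this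
  rw [← hmt]
  exact hfix' g hg

variable {p : ℕ} [OddBase p]

lemma mem_circX_none {x : sierpinskiCarpet p} : x ∈ circX none ↔ (x : ℂ) ∈ sqb 0 0 1 := Iff.rfl

variable (p) in
/-- Parametrization of the outer circle with period one. -/
def outQ (s : ℝ) : sierpinskiCarpet p :=
  ⟨sqPar (sqCtr 0 0 1) (1 / 2) (2 * Real.pi * s),
    circ_subset_carpet none (sqPar_mem one_pos _)⟩

lemma outQ_mem (s : ℝ) : outQ p s ∈ circX none := mem_circX_none.2 (sqPar_mem one_pos _)

lemma continuous_outQ : Continuous (outQ p) :=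
  Continuous.subtype_mk ((continuous_sqPar _ _).comp (by fun_prop)) _

lemma outQ_add_int (s : ℝ) (n : ℤ) : outQ p (s + n) = outQ p s := by
  have h : Function.Periodic (outQ p) 1 := by
    intro s
    apply Subtype.ext
    show sqPar _ _ (2 * Real.pi * (s + 1)) = sqPar _ _ (2 * Real.pi * s)
    rw [mul_add, mul_one, sqPar_add_two_pi]
  simpa using h.int_mul n s

lemma outQ_eq {s t : ℝ} (h : outQ p s = outQ p t) : ∃ n : ℤ, s - t = n := by
  have h1 : sqPar (sqCtr 0 0 1) (1 / 2) (2 * Real.pi * s) =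
    sqPar (sqCtr 0 0 1) (1 / 2) (2 * Real.pi * t) := congrArg Subtype.val h
  have h2 : Complex.exp (sqLog (1 / 2) (2 * Real.pi * s)) =
      Complex.exp (sqLog (1 / 2) (2 * Real.pi * t)) := by
    rw [exp_sqLog (sqCtr 0 0 1) (by norm_num), exp_sqLog (sqCtr 0 0 1) (by norm_num), h1]
  obtain ⟨n, hn⟩ := Complex.exp_eq_exp_iff_exists_int.1 h2
  have h3 := congrArg Complex.im hn
  simp [sqLog] at h3
  refine ⟨n, ?_⟩
  have hpi := Real.pi_pos
  have : 2 * Real.pi * (s - t - n) = 0 := by linarith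
  rcases mul_eq_zero.1 this with h | h
  · linarith
  · linarith

lemma outQ_eq_of_angle {x : sierpinskiCarpet p} (hx : x ∈ circX none) {s : ℝ}
    (h : ((2 * Real.pi * s : ℝ) : Real.Angle) =
      (Complex.arg ((x : ℂ) - sqCtr 0 0 1) : Real.Angle)) : outQ p s = x :=
  Subtype.ext (eq_sqPar one_pos (mem_circX_none.1 hx) h).symm

lemma exists_outQ {x : sierpinskiCarpet p} (hx : x ∈ circX none) : ∃ s, outQ p s = x := by
  refine ⟨Complex.arg ((x : ℂ) - sqCtr 0 0 1) / (2 * Real.pi), outQ_eq_of_angle hx ?_⟩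
  congr 1
  have := Real.pi_pos
  field_simp

/-- Points of the outer circle that are close have close parameters. -/
lemma exists_close_param : ∃ ε > 0, ∀ s t : ℝ, dist (outQ p s) (outQ p t) < ε →
    ∃ n : ℤ, |s - n - t| ≤ 1 / 16 := by
  set K : Set (ℝ × ℝ) := (Icc (-1) 2 ×ˢ Icc 0 1) ∩
    {z | 1 / 16 ≤ |z.1 - z.2| ∧ |z.1 - z.2| ≤ 1 / 2} with hK
  have hKc : IsCompact K := by
    have hc : Continuous fun z : ℝ × ℝ => |z.1 - z.2| := by fun_prop
    exact (isCompact_Icc.prod isCompact_Icc).inter_right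
      ((isClosed_le continuous_const hc).inter (isClosed_le hc continuous_const))
  have hc := continuous_outQ (p := p)
  obtain ⟨ε, hε, hmin⟩ := hKc.exists_forall_le' (f := fun z => dist (outQ p z.1) (outQ p z.2))
    (a := 0) (by fun_prop) (by
      rintro ⟨s, t⟩ ⟨-, h1, h2⟩
      refine dist_pos.2 fun h => ?_
      obtain ⟨n, hn⟩ := outQ_eq h
      simp only at h1 h2
      rw [hn] at h1 h2
      have h3 : |(n : ℝ)| < 1 := by linarith
      have h4 : |n| < 1 := by exact_mod_cast h3
      rw [Int.abs_lt_one_iff.1 h4] at h1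
      norm_num at h1)
  refine ⟨ε, hε, fun s t h => ⟨round (s - t), ?_⟩⟩
  by_contra! hcon
  have h1 : |s - round (s - t) - t| ≤ 1 / 2 := by
    have := abs_sub_round (s - t)
    rwa [sub_right_comm]
  have hf0 := Int.fract_nonneg t
  have hf1 := (Int.fract_lt_one t).le
  have e : s - round (s - t) - ⌊t⌋ - Int.fract t = s - round (s - t) - t := by
    rw [Int.fract]; ring
  have hmem : (s - round (s - t) - ⌊t⌋, Int.fract t) ∈ K := by
    have h2 := abs_le.1 h1
    rw [← e] at h2
    refine ⟨⟨⟨?_, ?_⟩, hf0, hf1⟩, ?_, ?_⟩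
    · simp only; linarith
    · simp only; linarith
    · simp only [e]; exact hcon.le
    · simp only [e]; exact h1
  have h3 := hmin _ hmem
  have e1 : outQ p (s - round (s - t) - ⌊t⌋) = outQ p s := by
    rw [← outQ_add_int _ (round (s - t) + ⌊t⌋)]
    congr 1; push_cast; ring
  have e2 : outQ p (Int.fract t) = outQ p t := by
    rw [← outQ_add_int _ ⌊t⌋, Int.fract_add_floor]
  simp only [e1, e2] at h3
  linarith

/-- Continuous lifts along the parametrization of the outer circle. -/
lemma exists_lift {g : sierpinskiCarpet p ≃ₜ sierpinskiCarpet p} (hg : g ∈ Gam0 p) (a b : ℝ) :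
    ∃ F : ℝ → ℝ, ContinuousOn F (Icc a b) ∧ ∀ s ∈ Icc a b, outQ p (F s) = g (outQ p s) := by
  have hmem : ∀ s, g (outQ p s) ∈ circX none := fun s => by
    have := (mem_circX_perm g).2 (outQ_mem (p := p) s)
    rwa [hg.2.1] at this
  have hcont : Continuous fun s => (g (outQ p s) : ℂ) - sqCtr 0 0 1 :=
    (continuous_subtype_val.comp (g.continuous.comp continuous_outQ)).sub continuous_const
  obtain ⟨G, hG, hGe⟩ := hasLog_of_convex (convex_Icc a b) isCompact_Icc hcont.continuousOn
    fun s _ => sqb_sub_ctr_ne one_pos (mem_circX_none.1 (hmem s))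
  refine ⟨fun s => (G s).im / (2 * Real.pi), (Complex.continuous_im.comp_continuousOn hG).div_const _,
    fun s hs => outQ_eq_of_angle (hmem s) ?_⟩
  have h1 : (g (outQ p s) : ℂ) - sqCtr 0 0 1 = Complex.exp (G s) := hGe s hs
  rw [h1, Complex.arg_exp, Real.Angle.coe_toIocMod]
  congr 1
  have := Real.pi_pos
  field_simp

variable (p) in
/-- Powers of the rotation by a quarter turn. -/
def rotX : ℕ → (sierpinskiCarpet p ≃ₜ sierpinskiCarpet p)
  | 0 => Homeomorph.refl _
  | n + 1 => (rotX n).trans (swX.trans flX)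

lemma refl_mem_Gam0 : Homeomorph.refl (sierpinskiCarpet p) ∈ Gam0 p :=
  ⟨Gam.of_isometry isometry_id, perm_refl _, perm_refl _⟩

lemma rotX_mem_Gam0 (n : ℕ) : rotX p n ∈ Gam0 p := by
  induction n with
  | zero => exact refl_mem_Gam0
  | succ n ih => exact Gam0.trans ih (Gam0.trans swX_mem_Gam0 flX_mem_Gam0)

lemma isometry_rotX (n : ℕ) : Isometry (rotX p n) := by
  induction n with
  | zero => exact isometry_id
  | succ n ih => exact (isometry_flX.comp isometry_swX).comp ih

lemma rotX_outQ (n : ℕ) (s : ℝ) : rotX p n (outQ p s) = outQ p (s + n / 4) := by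
  induction n with
  | zero => simp [rotX]
  | succ n ih =>
    show flX (swX (rotX p n (outQ p s))) = _
    rw [ih]
    apply Subtype.ext
    have e : 2 * Real.pi * (s + ((n + 1 : ℕ) : ℝ) / 4) =
        2 * Real.pi * (s + (n : ℝ) / 4) + Real.pi / 2 := by push_cast; ring
    rw [coe_flX, coe_swX]
    simp only [outQ, e]
    set θ := 2 * Real.pi * (s + (n : ℝ) / 4)
    have hr : sqRad (1 / 2) (θ + Real.pi / 2) = sqRad (1 / 2) θ := by
      simp [sqRad, Real.cos_add_pi_div_two, Real.sin_add_pi_div_two, max_comm]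
    apply Complex.ext
    · rw [fl_re, sw_re, sqPar_im, sqPar_re, hr, Real.cos_add_pi_div_two]
      simp only [sqCtr]; ring
    · rw [fl_im, sw_im, sqPar_im, sqPar_re, hr, Real.sin_add_pi_div_two]
      simp only [sqCtr]

variable (p) in
/-- The stabilizer of a circle and of its images under the rotations of order four. -/
def Stab (v : Word p) : Set (sierpinskiCarpet p ≃ₜ sierpinskiCarpet p) :=
  {h | h ∈ Gam0 p ∧ ∀ j : Fin 4, perm h (perm (rotX p j) (some v)) = perm (rotX p j) (some v)}

lemma Stab.symm {v : Word p} {h : sierpinskiCarpet p ≃ₜ sierpinskiCarpet p} (hh : h ∈ Stab p v) :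
    h.symm ∈ Stab p v := by
  refine ⟨Gam0.symm hh.1, fun j => ?_⟩
  conv_lhs => rw [← hh.2 j]
  exact perm_symm_perm _ _

lemma Stab.trans {v : Word p} {g h : sierpinskiCarpet p ≃ₜ sierpinskiCarpet p}
    (hg : g ∈ Stab p v) (hh : h ∈ Stab p v) : g.trans h ∈ Stab p v :=
  ⟨Gam0.trans hg.1 hh.1, fun j => by rw [perm_trans, hg.2, hh.2]⟩

variable (p) in
/-- There is a circle with finite orbit whose stabilizer fixes the outer circle pointwise. -/
lemma exists_fixing : ∃ v : Word p,
    ((fun f : sierpinskiCarpet p ≃ₜ sierpinskiCarpet p => perm f (some v)) '' Gam0 p).Finite ∧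
    ∀ h ∈ Stab p v, ∀ x ∈ circX none, h x = x := by
  obtain ⟨ε, hε, hclose⟩ := exists_close_param (p := p)
  obtain ⟨v, x0, hx0, hfin, hfix⟩ := exists_almost_fixed (p := p) hε
  obtain ⟨θ, rfl⟩ := exists_outQ hx0
  refine ⟨v, hfin, fun h hh x hx => ?_⟩
  have hnear : ∀ g ∈ Stab p v, ∀ j : Fin 4,
      dist (g (outQ p (θ + (j : ℕ) / 4))) (outQ p (θ + (j : ℕ) / 4)) < ε := by
    intro g hg j
    have hr := rotX_mem_Gam0 (p := p) j
    have := hfix ((rotX p j).trans (g.trans (rotX p j).symm))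
      (Gam0.trans hr (Gam0.trans hg.1 (Gam0.symm hr)))
      (by rw [perm_trans, perm_trans, hg.2, perm_symm_perm])
    rw [← (isometry_rotX j).dist_eq] at this
    simpa [rotX_outQ] using this
  have hnear' : ∀ g ∈ Stab p v, ∀ j : ℤ,
      dist (g (outQ p (θ + j / 4))) (outQ p (θ + j / 4)) < ε := by
    intro g hg j
    have h1 : 0 ≤ j % 4 := Int.emod_nonneg _ (by norm_num)
    have h2 : j % 4 < 4 := Int.emod_lt_of_pos _ (by norm_num)
    have h3 := hnear g hg ⟨(j % 4).toNat, by omega⟩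
    have e : outQ p (θ + j / 4) = outQ p (θ + ((j % 4).toNat : ℝ) / 4) := by
      rw [← outQ_add_int (θ + ((j % 4).toNat : ℝ) / 4) (j / 4)]
      congr 1
      have h4 : (((j % 4).toNat : ℤ) : ℝ) = ((j % 4 : ℤ) : ℝ) := by rw [Int.toNat_of_nonneg h1]
      have h5 : ((j % 4 : ℤ) : ℝ) + 4 * ((j / 4 : ℤ) : ℝ) = j := by
        exact_mod_cast Int.emod_add_mul_ediv j 4
      rw [Int.cast_natCast] at h4
      rw [h4]
      linarith
    rw [e]
    exact h3
  obtain ⟨s, rfl⟩ := exists_outQ hx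
  set j : ℤ := ⌊4 * (s - θ)⌋ - 1 with hj
  set a := θ + (j : ℝ) / 4 with ha
  have hs : s ∈ Icc (a + 1 / 4) (a + 1 / 2) := by
    have h1 := Int.floor_le (4 * (s - θ))
    have h2 := Int.lt_floor_add_one (4 * (s - θ))
    have h3 : (j : ℝ) = (⌊4 * (s - θ)⌋ : ℝ) - 1 := by rw [hj]; push_cast; ring
    constructor <;> linarith
  refine fixed_of_lifts (a := a) continuous_outQ (fun s t => outQ_eq) (fun g => Stab.symm)
    (fun g hg k => Stab.trans hg) ?_ ?_ hs hh
  · intro ε hε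
    obtain ⟨δ, hδ, H⟩ := equicontinuous_outer (p := p) hε
    exact ⟨δ, hδ, fun g hg s y => H g hg.1 _ (outQ_mem s) y⟩
  · intro g hg
    obtain ⟨F, hF, hFe⟩ := exists_lift hg.1 a (a + 3 / 4)
    have hsub : ∀ (s : ℝ) (n : ℤ), outQ p (s - n) = outQ p s := fun s n => by
      rw [← outQ_add_int (s - n) n, sub_add_cancel]
    have hinj : ∀ s ∈ Icc a (a + 3 / 4), ∀ t ∈ Icc a (a + 3 / 4), ∀ n : ℤ,
        F s - F t = n → s = t := by
      intro s hs t ht n hst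
      have h1 : outQ p (F s) = outQ p (F t) := by
        rw [← outQ_add_int (F t) n, ← hst, add_sub_cancel]
      rw [hFe s hs, hFe t ht] at h1
      obtain ⟨m, hm⟩ := outQ_eq (g.injective h1)
      have h2 : |(m : ℝ)| < 1 := by
        rw [← hm, abs_lt]
        constructor <;> linarith [hs.1, hs.2, ht.1, ht.2]
      have h3 : |m| < 1 := by exact_mod_cast h2
      rw [Int.abs_lt_one_iff.1 h3, Int.cast_zero] at hm
      linarith
    have hk : ∀ k : ℕ, k < 4 → ∃ n : ℤ, |F (a + k / 4) - n - (a + k / 4)| ≤ 1 / 16 := by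
      intro k hk
      have hkJ : a + (k : ℝ) / 4 ∈ Icc a (a + 3 / 4) := by
        have h0 : (0 : ℝ) ≤ k := k.cast_nonneg
        have h3 : (k : ℝ) ≤ 3 := by exact_mod_cast Nat.le_of_lt_succ hk
        constructor <;> linarith
      apply hclose
      rw [hFe _ hkJ]
      have e : a + (k : ℝ) / 4 = θ + ((j + k : ℤ) : ℝ) / 4 := by rw [ha]; push_cast; ring
      rw [e]
      exact hnear' g hg _
    obtain ⟨hm, n, hn1, hn2⟩ := lift_bounds hF hinj hk
    refine ⟨fun s => F s - n, hF.sub continuousOn_const,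
      fun s hs t ht hst => sub_lt_sub_right (hm hs ht hst) _,
      fun s hs => by rw [hsub, hFe s hs], hn1, hn2⟩

end

end Carpet

namespace Carpet

open MeasureTheory

noncomputable section

variable {p : ℕ} [OddBase p]

lemma isA_re : IsA fun x : sierpinskiCarpet p => (x : ℂ).re :=
  IsA.of_lipschitz zero_le_one fun x y => by
    rw [one_mul, Subtype.dist_eq, Complex.dist_eq, ← Complex.sub_re]
    exact Complex.abs_re_le_norm _

lemma rho_re_le (w : Word p) : rho (fun x : sierpinskiCarpet p => (x : ℂ).re) (some w) ≤ hs w :=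
  osc_le (hs_pos w).le fun _ hx _ hy =>
    (dist_le_of_mem_csq (circ_some_subset_chole w hx) (circ_some_subset_chole w hy)).1

lemma side_mem {a y : ℝ} (ha : a = 0 ∨ a = 1) (hy' : y ∈ Icc (0 : ℝ) 1) :
    (⟨a, y⟩ : ℂ) ∈ circ (none : Option (Word p)) := by
  have h1 := hy'.1
  have h2 := hy'.2
  rw [mem_circ_none_iff]
  · rcases ha with rfl | rfl <;> simp [bd, h1, h2]
  · rcases ha with rfl | rfl <;> simp [csq, h1, h2]

variable (p) in
/-- A point on the left or right side of the unit square. -/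
def side {a y : ℝ} (ha : a = 0 ∨ a = 1) (hy' : y ∈ Icc (0 : ℝ) 1) : sierpinskiCarpet p :=
  ⟨⟨a, y⟩, circ_subset_carpet none (side_mem ha hy')⟩

lemma side_mem_circX {a y : ℝ} (ha : a = 0 ∨ a = 1) (hy' : y ∈ Icc (0 : ℝ) 1) :
    side p ha hy' ∈ circX none := side_mem (p := p) ha hy'

/-- Pullbacks of the first coordinate under maps fixing the outer circle are extremal for the
length-area inequality. -/
lemma rho_re_comp_eq {h : sierpinskiCarpet p ≃ₜ sierpinskiCarpet p} (hh : h ∈ Gam0 p)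
    (hO : ∀ x ∈ circX none, h x = x) (w : Word p) :
    rho (fun x => (h x : ℂ).re) (some w) = hs w := by
  set u : sierpinskiCarpet p → ℝ := fun x => (h x : ℂ).re with hu
  have huA : IsA u := isA_re.comp hh.1
  have hE : En u ≤ 1 := by
    rw [hu, En_comp isA_re hh]
    exact (isA_re.summ'.tsum_le_tsum
      (fun w => pow_le_pow_left₀ (rho_nonneg _ _) (rho_re_le w) 2) summable_hs_sq).trans
        tsum_hs_sq_le
  have hL := length_area huA (C := 1) (c := 0) (d := 1) zero_le_one fun y hy' => by
    have hy'' : y ∈ Icc (0 : ℝ) 1 := ⟨hy'.1.le, hy'.2.le⟩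
    refine ⟨side p (Or.inr rfl) hy'', side p (Or.inl rfl) hy'',
      Or.inl ⟨Subtype.prop _, rfl, trivial⟩, Or.inl ⟨Subtype.prop _, rfl, trivial⟩, ?_⟩
    rw [hu]
    simp only
    rw [hO _ (side_mem_circX _ hy''), hO _ (side_mem_circX _ hy'')]
    simp [side]
  have hab := summable_hs_mul_rho huA
  have hsum : Summable fun w : Word p => (hs w - rho u (some w)) ^ 2 := by
    refine ((summable_hs_sq.add huA.summ').sub (hab.mul_left 2)).congr fun w => ?_
    ring
  have htot : ∑' w : Word p, (hs w - rho u (some w)) ^ 2 =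
      ∑' w : Word p, hs w ^ 2 + En u - 2 * ∑' w : Word p, hs w * rho u (some w) := by
    rw [En, ← summable_hs_sq.tsum_add huA.summ', ← tsum_mul_left,
      ← (summable_hs_sq.add huA.summ').tsum_sub (hab.mul_left 2)]
    exact tsum_congr fun w => by ring
  have hv := hsum.le_tsum w fun w _ => sq_nonneg _
  have hσ := tsum_hs_sq_le (p := p)
  have h0 : (hs w - rho u (some w)) ^ 2 = 0 := le_antisymm (by linarith) (sq_nonneg _)
  have := pow_eq_zero_iff (two_ne_zero) |>.1 h0
  linarith

lemma abs_sub_le_of_row {u : sierpinskiCarpet p → ℝ} (hu : Continuous u)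
    (hr : ∀ w : Word p, rho u (some w) = hs w) {n : ℕ} {y ε : ℝ} (hε : 0 ≤ ε)
    (hn : cellVar u n y ≤ ENNReal.ofReal ε) {a b : ℝ} (hab : a ≤ b) {z z' : sierpinskiCarpet p}
    (hz : (z : ℂ) ∈ line p y (Icc a b)) (hz' : (z' : ℂ) ∈ line p y (Icc a b)) :
    |u z - u z'| ≤ b - a + ε := by
  have h1 := line_estimate hu n ordConnected_Icc hz hz'
  have h0 : ∀ w : Word p, Icc (hx w) (hx w + hs w) ⊆ Icc a b ↔ a ≤ hx w ∧ hx w + hs w ≤ b :=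
    fun w => Icc_subset_Icc_iff (by linarith [hs_pos w])
  simp only [hr, h0] at h1
  have h2 := h1.trans (add_le_add (row_sum_le y a b) hn)
  rw [← ENNReal.ofReal_add (by linarith) hε] at h2
  exact (ENNReal.ofReal_le_ofReal_iff (by linarith)).1 h2

lemma re_eq_of_fix {h : sierpinskiCarpet p ≃ₜ sierpinskiCarpet p} (hh : h ∈ Gam0 p)
    (hO : ∀ x ∈ circX none, h x = x) (x : sierpinskiCarpet p) : (h x : ℂ).re = (x : ℂ).re := by
  set u : sierpinskiCarpet p → ℝ := fun x => (h x : ℂ).re with hu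
  have huA : IsA u := isA_re.comp hh.1
  have hr := rho_re_comp_eq hh hO
  by_contra hne
  set η := |u x - (x : ℂ).re| with hη
  have hη0 : 0 < η := abs_pos.2 (sub_ne_zero.2 hne)
  have hcont : Continuous fun x : sierpinskiCarpet p => |u x - (x : ℂ).re| :=
    (huA.cont.sub isA_re.cont).abs
  obtain ⟨δ, hδ, hball⟩ := Metric.eventually_nhds_iff.1
    (hcont.continuousAt.eventually_const_lt (show η / 2 < η by linarith))
  obtain ⟨n, hn⟩ := exists_pow_lt_of_lt_one (show 0 < δ / 2 by positivity)
    (show (p : ℝ)⁻¹ < 1 from inv_lt_one_of_one_lt₀ (by have := three_le_real (p := p); linarith))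
  obtain ⟨w, hwl, hxw⟩ := exists_cell n x.2
  have hsc : sc w < δ / 2 := by rwa [sc, hwl, ← inv_pow]
  have hs0 := sc_pos w
  obtain ⟨y, hy', m, hm⟩ := exists_cellVar_le huA (show cy w < cy w + sc w by linarith)
    (show 0 < η / 4 by positivity)
  have hy1 : (y - cy w) / sc w ∈ Icc (0 : ℝ) 1 :=
    ⟨div_nonneg (by linarith [hy'.1]) hs0.le, (div_le_one hs0).2 (by linarith [hy'.2])⟩
  have hy2 : y ∈ Icc (0 : ℝ) 1 :=
    ⟨by linarith [hy'.1, cy_nonneg w], by linarith [hy'.2, cy_add_le w]⟩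
  set z := embX w (side p (Or.inl rfl) hy1) with hz
  have hzre : (z : ℂ).re = cx w := by simp [hz, embX, emb, side]
  have hzim : (z : ℂ).im = y := by
    simp [hz, embX, emb, side]
    field_simp
    ring
  have hzx : dist z x < δ := by
    have : dist (z : ℂ) x ≤ 2 * sc w := dist_le_two_mul (embX_mem_cell w _) hxw
    exact lt_of_le_of_lt this (by linarith)
  have hbig := hball hzx
  have hcx0 := cx_nonneg w
  have hcx1 := cx_add_le w
  have hl := abs_sub_le_of_row huA.cont hr (by positivity) hm hcx0
    (z := z) (z' := side p (Or.inl rfl) hy2)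
    (Or.inl ⟨z.2, hzim, by rw [hzre]; exact ⟨hcx0, le_rfl⟩⟩)
    (Or.inl ⟨Subtype.prop _, rfl, le_rfl, hcx0⟩)
  have hr' := abs_sub_le_of_row huA.cont hr (by positivity) hm (show cx w ≤ 1 by linarith)
    (z := side p (Or.inr rfl) hy2) (z' := z)
    (Or.inl ⟨Subtype.prop _, rfl, by show cx w ≤ 1; linarith, le_rfl⟩)
    (Or.inl ⟨z.2, hzim, by rw [hzre]; exact ⟨le_rfl, by linarith⟩⟩)
  have e0 : u (side p (Or.inl rfl) hy2) = 0 := by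
    rw [hu]; simp only; rw [hO _ (side_mem_circX _ hy2)]; rfl
  have e1 : u (side p (Or.inr rfl) hy2) = 1 := by
    rw [hu]; simp only; rw [hO _ (side_mem_circX _ hy2)]; rfl
  rw [e0, abs_le] at hl
  rw [e1, abs_le] at hr'
  have : |u z - (z : ℂ).re| ≤ η / 4 := by
    rw [hzre, abs_le]
    constructor <;> linarith [hl.2, hr'.2]
  linarith

/-- A homeomorphism in the class fixing the outer circle pointwise is the identity. -/
lemma eq_refl_of_fix {h : sierpinskiCarpet p ≃ₜ sierpinskiCarpet p} (hh : h ∈ Gam0 p)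
    (hO : ∀ x ∈ circX none, h x = x) (x : sierpinskiCarpet p) : h x = x := by
  apply Subtype.ext
  apply Complex.ext
  · exact re_eq_of_fix hh hO x
  · have h1 := re_eq_of_fix (h := swX.trans (h.trans swX))
      (Gam0.trans swX_mem_Gam0 (Gam0.trans hh swX_mem_Gam0)) ?_ (swX x)
    · simpa [swX_swX] using h1
    · intro z hz
      have hz' : swX z ∈ circX none := by
        have := (mem_circX_perm swX).2 hz
        rwa [perm_swX] at this
      show swX (h (swX z)) = z
      rw [hO _ hz', swX_swX]

end

end Carpet

namespace Carpet

open MeasureTheory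

noncomputable section

variable {p : ℕ} [OddBase p]

variable (p) in
lemma finite_Gam0 : (Gam0 p).Finite := by
  obtain ⟨v, hfin, hfix⟩ := exists_fixing p
  refine Set.Finite.of_finite_image
    (f := fun (f : sierpinskiCarpet p ≃ₜ sierpinskiCarpet p) (j : Fin 4) =>
      perm f (perm (rotX p j) (some v))) ?_ ?_
  · refine (Set.Finite.pi' fun _ : Fin 4 => hfin).subset ?_
    rintro _ ⟨f, hf, rfl⟩ j
    exact ⟨(rotX p j).trans f, Gam0.trans (rotX_mem_Gam0 j) hf, perm_trans _ _ _⟩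
  · intro f hf g hg hfg
    have hmem : g.trans f.symm ∈ Stab p v := by
      refine ⟨Gam0.trans hg (Gam0.symm hf), fun j => ?_⟩
      have h1 : perm f (perm (rotX p j) (some v)) = perm g (perm (rotX p j) (some v)) :=
        congrFun hfg j
      rw [perm_trans, ← h1]
      exact perm_symm_perm _ _
    ext1 x
    have h1 : f.symm (g x) = x := eq_refl_of_fix hmem.1 (hfix _ hmem) x
    rw [← f.apply_symm_apply (g x), h1]

variable (p) in
lemma finite_Gam : (Gam (sierpinskiCarpet p)).Finite := by
  have h0 := finite_Gam0 p
  by_cases h : ∃ f1 ∈ Gam (sierpinskiCarpet p), f1 ∉ Gam0 p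
  · obtain ⟨f1, hf1, hf1'⟩ := h
    have hswap : ∀ f ∈ Gam (sierpinskiCarpet p), f ∉ Gam0 p →
        perm f none = some [] ∧ perm f (some []) = none := fun f hf hf' =>
      (perm_pair hf).resolve_left fun h => hf' ⟨hf, h⟩
    refine (h0.union (h0.image fun g => g.trans f1)).subset fun f hf => ?_
    by_cases hf' : f ∈ Gam0 p
    · exact Or.inl hf'
    · refine Or.inr ⟨f.trans f1.symm, ⟨Gam.trans hf (Gam.symm hf1), ?_, ?_⟩, ?_⟩
      · rw [perm_trans, (hswap f hf hf').1, ← (hswap f1 hf1 hf1').1, perm_symm_perm]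
      · rw [perm_trans, (hswap f hf hf').2, ← (hswap f1 hf1 hf1').2, perm_symm_perm]
      · ext1 x
        exact f1.apply_symm_apply (f x)
  · push Not at h
    exact h0.subset h

end

end Carpet

/-- **Finiteness of the quasisymmetry group of `S_p`** (Corollary 5.3).
For every odd `p ≥ 3` the set of quasisymmetric self-homeomorphisms of `S_p` is finite. -/
theorem qs_group_of_Sp_finite (p : ℕ) (hp : 3 ≤ p) (hodd : Odd p) :
    Set.Finite {f : ↥(sierpinskiCarpet p) ≃ₜ ↥(sierpinskiCarpet p) | IsQSMap f} := by
  haveI : Carpet.OddBase p := ⟨hp, hodd⟩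
  exact (Carpet.finite_Gam p).subset fun f hf => Carpet.Gam.of_isQSMap hf
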